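/- arXiv:math/0401235 — 2 statements merged into one kernel-verified Lean document; each statement's English description precedes it below -/
import Mathlib

section
/- Let n ≥ 2, c ≥ 0, 0 ≤ p ≤ n and 0 ≤ k ≤ c be integers, and assume it is not the case that c = 0 and p = 0. Define L_{n,c,p} ∈ ℚ(q) by: if c is even, L_{n,c,p} = ( q^{p(p+1)/2}·binq(n−1,p)·[c;q]/[c+p;q]_n − q^{p(p−1)/2}·binq(n−1,p−1)·[c+2n;q]/[c+p+1;q]_n ) · ([c+1;q]_{n−1}[1;q]_{n−1}/2) · ∏_{i=1}^{n−1} [c+2i+1;q]_{n−i}/([2i;q]_{n−i}[2i;q]); if c is odd, L_{n,c,p} = ( q^{p(p+1)/2}·binq(n−1,p) − q^{p(p−1)/2}·binq(n−1,p−1) ) · ([1;q]_{n−1}/2) · ∏_{i=1}^{n−1} [c+2i;q]_{n−i}/([2i;q]_{n−i}[2i;q]). Define M_{n,c,p} ∈ ℚ(q) by M_{n,c,p} = ((−1)^{n−1} q^{(n−1)(2c+n)/2}/[1;q]_{n−2}) times: if c is even, ( (q^{p(p+1)/2}·binq(n−1,p)·[c;q]/[c+p;q]_n)·(1/[n−1;q]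 − [c+2n−1;q]/([c+n;q][2n−2;q])) + (q^{p(p−1)/2}·binq(n−1,p−1)/[c+p+1;q]_n)·[c+2n−1;q]_2/([c+n;q][2n−2;q]) ) · ∏_{i=1}^{n−1} [c+2i;q]_{n−i}/[2i;q]_{n−i}; if c is odd, ( q^{p(p+1)/2+n−1}·binq(n−1,p) + q^{p(p−1)/2}·binq(n−1,p−1) ) · (1/[2n−2;q]) · ∏_{i=1}^{n−1} [c+2i+1;q]_{n−i−1}/[2i;q]_{n−i}. Then the sum Σ_Π q^{n(Π)} over all strict plane partitions Π with parts in {1,…,n}, at most c columns, exactly p rows of odd length and exactly k parts equal to n equals, in ℚ(q), q^k·( M_{n,c,p}·W_{n,c}(k) + L_{n,c,p}·U_{n,c}(k) ). -/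
open Finset

noncomputable def q : RatFunc ℚ := RatFunc.X

noncomputable def qb (a : ℤ) : RatFunc ℚ := (1 - q ^ a) / (1 - q)

noncomputable def qfac (a : ℤ) (n : ℕ) : RatFunc ℚ := ∏ i ∈ Finset.range n, qb (a + i)

noncomputable def binq (n k : ℤ) : RatFunc ℚ :=
  if 0 ≤ k ∧ k ≤ n then qfac (n - k + 1) k.toNat / qfac 1 k.toNat else 0

/-- A strict plane partition: entries `part i j` (row `i`, column `j`, both 0-indexed),
zero outside the shape; rows weakly decrease and columns strictly decrease on the shape. -/
structure SPP where
  part : ℕ → ℕ → ℕ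
  supp_finite : {ij : ℕ × ℕ | part ij.1 ij.2 ≠ 0}.Finite
  row_decr : ∀ i j₁ j₂, j₁ ≤ j₂ → part i j₂ ≤ part i j₁
  col_strict : ∀ i j, part (i + 1) j ≠ 0 → part (i + 1) j < part i j

/-- The norm of a strict plane partition: the sum of its parts. -/
noncomputable def sppNorm (P : SPP) : ℕ := ∑ᶠ ij : ℕ × ℕ, P.part ij.1 ij.2

/-- The length of the `i`-th row (0-indexed), i.e. the part `λ_{i+1}` of the shape. -/
noncomputable def rowLen (P : SPP) (i : ℕ) : ℕ := {j | P.part i j ≠ 0}.ncard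

/-- The number of rows of odd length. -/
noncomputable def oddRows (P : SPP) : ℕ := {i | Odd (rowLen P i)}.ncard

/-- The number of parts equal to `n`. -/
noncomputable def eqCount (P : SPP) (n : ℕ) : ℕ := {ij : ℕ × ℕ | P.part ij.1 ij.2 = n}.ncard

noncomputable def Wnc (n c : ℕ) (k : ℤ) : RatFunc ℚ :=
  qfac (k + 1) (n - 1) * qfac (k - c - n + 1) (n - 1)

noncomputable def Unc (n c : ℕ) (k : ℤ) : RatFunc ℚ :=
  (-1 : RatFunc ℚ) ^ n * q ^ (((n : ℤ) - 1) * (2 * c + n) / 2) *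
    (∑ i ∈ Finset.Icc 1 (n - 1),
      ((-1 : RatFunc ℚ) ^ c * q ^ (i * (i - 1) / 2) *
          (qfac (k + 1) (n - 1) * qfac (k - c - i + 1) (i - 1) *
            qfac (k - c - n + 1) (n - i - 1)) -
        q ^ (i * (i - 1) / 2) *
          (qfac (k + 1) (i - 1) * qfac (k + i + 1) (n - i - 1) *
            qfac (k - c - n + 1) (n - 1))) /
      (qfac 1 (i - 1) * qfac 1 (n - 1 - i) * qfac (c + i + 1) (n - 1))) +
  (-1 : RatFunc ℚ) ^ k * q ^ (((n : ℤ) - 1) * k)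

noncomputable def Lncp (n c p : ℕ) : RatFunc ℚ :=
  if Even c then
    (q ^ (p * (p + 1) / 2) * binq ((n : ℤ) - 1) p * qb c / qfac (c + p) n -
      q ^ (p * (p - 1) / 2) * binq ((n : ℤ) - 1) ((p : ℤ) - 1) * qb (c + 2 * n) /
        qfac (c + p + 1) n) *
    (qfac (c + 1) (n - 1) * qfac 1 (n - 1) / 2) *
    ∏ i ∈ Finset.Icc 1 (n - 1),
      qfac (c + 2 * i + 1) (n - i) / (qfac (2 * i) (n - i) * qb (2 * i))
  else
    (q ^ (p * (p + 1) / 2) * binq ((n : ℤ) - 1) p -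
      q ^ (p * (p - 1) / 2) * binq ((n : ℤ) - 1) ((p : ℤ) - 1)) *
    (qfac 1 (n - 1) / 2) *
    ∏ i ∈ Finset.Icc 1 (n - 1),
      qfac (c + 2 * i) (n - i) / (qfac (2 * i) (n - i) * qb (2 * i))

noncomputable def Mncp (n c p : ℕ) : RatFunc ℚ :=
  (-1 : RatFunc ℚ) ^ (n - 1) * q ^ (((n : ℤ) - 1) * (2 * c + n) / 2) / qfac 1 (n - 2) *
  (if Even c then
    ((q ^ (p * (p + 1) / 2) * binq ((n : ℤ) - 1) p * qb c / qfac (c + p) n) *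
        (1 / qb ((n : ℤ) - 1) - qb (c + 2 * n - 1) / (qb (c + n) * qb (2 * n - 2))) +
      (q ^ (p * (p - 1) / 2) * binq ((n : ℤ) - 1) ((p : ℤ) - 1) / qfac (c + p + 1) n) *
        (qfac (c + 2 * n - 1) 2 / (qb (c + n) * qb (2 * n - 2)))) *
    ∏ i ∈ Finset.Icc 1 (n - 1), qfac (c + 2 * i) (n - i) / qfac (2 * i) (n - i)
  else
    (q ^ (p * (p + 1) / 2 + n - 1) * binq ((n : ℤ) - 1) p +
      q ^ (p * (p - 1) / 2) * binq ((n : ℤ) - 1) ((p : ℤ) - 1)) *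
    (1 / qb (2 * n - 2)) *
    ∏ i ∈ Finset.Icc 1 (n - 1), qfac (c + 2 * i + 1) (n - i - 1) / qfac (2 * i) (n - i))

section Determinants

variable {R : Type*} [CommRing R]

theorem det_sum_cols {n : ℕ} (s : Fin n → Finset ℕ) (f : Fin n → ℕ → Fin n → R) :
    (Matrix.of fun i j => ∑ k ∈ s j, f j k i).det =
      ∑ κ ∈ Fintype.piFinset s, (Matrix.of fun i j => f j (κ j) i).det := by
  have h := (Matrix.detRowAlternating (n := Fin n) (R := R)).toMultilinearMap.map_sum_finset f s
  rw [← Matrix.det_transpose]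
  have e : ∀ M : Matrix (Fin n) (Fin n) R,
      (Matrix.detRowAlternating (n := Fin n) (R := R)).toMultilinearMap M = M.det := fun _ => rfl
  have e2 : (Matrix.of fun i j => ∑ k ∈ s j, f j k i).transpose = fun i => ∑ k ∈ s i, f i k := by
    ext i j
    simp [Matrix.transpose_apply, Finset.sum_apply]
  rw [e2]
  refine h.trans (Finset.sum_congr rfl fun κ _ => ?_)
  rw [← Matrix.det_transpose]
  rfl

/-- The alternant `det (x i ^ (κ j + j))`. -/
def altDet (n : ℕ) (x : Fin n → R) (κ : Fin n → ℕ) : R :=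
  (Matrix.of fun i j : Fin n => x i ^ (κ j + j)).det

/-- Schur polynomials, defined by the branching rule that removes the first variable. -/
def schurPoly : (n : ℕ) → (Fin n → R) → (Fin n → ℕ) → R
  | 0, _, _ => 1
  | n + 1, x, κ => ∑ ν ∈ Fintype.piFinset fun j : Fin n => Finset.Icc (κ j.castSucc) (κ j.succ),
      x 0 ^ (κ 0 + ∑ j, (κ j.succ - ν j)) * schurPoly n (fun i => x i.succ) ν

theorem altDet_succ {n : ℕ} (x : Fin (n + 1) → R) {κ : Fin (n + 1) → ℕ} (hκ : Monotone κ) :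
    altDet (n + 1) x κ = (∏ i : Fin n, (x i.succ - x 0)) *
      ∑ ν ∈ Fintype.piFinset fun j : Fin n => Finset.Icc (κ j.castSucc) (κ j.succ),
        x 0 ^ (κ 0 + ∑ j, (κ j.succ - ν j)) * altDet n (fun i => x i.succ) ν := by
  have hle : ∀ j : Fin n, κ j.castSucc ≤ κ j.succ := fun j => hκ (Fin.castSucc_le_succ j)
  set B : Matrix (Fin (n + 1)) (Fin (n + 1)) R := Matrix.of fun i j => Fin.cases (x i ^ κ 0)
    (fun j : Fin n => x i ^ (κ j.succ + (j + 1)) -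
      x 0 ^ (κ j.succ - κ j.castSucc + 1) * x i ^ (κ j.castSucc + j)) j with hB
  have h1 : altDet (n + 1) x κ = B.det := by
    unfold altDet
    apply Matrix.det_eq_of_forall_col_eq_smul_add_pred
      (fun j => x 0 ^ (κ j.succ - κ j.castSucc + 1))
    · intro i; simp [hB]
    · intro i j; simp [hB]
  have hB0 : ∀ j : Fin n, B 0 j.succ = 0 := by
    intro j
    simp only [hB, Matrix.of_apply, Fin.cases_succ]
    rw [← pow_add, sub_eq_zero]
    congr 1
    have := hle j
    omega
  rw [h1, Matrix.det_succ_row_zero, Fin.sum_univ_succ]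
  rw [Finset.sum_eq_zero (fun j _ => by rw [hB0]; ring), add_zero]
  have h2 : B.submatrix Fin.succ (Fin.succAbove 0) = Matrix.of fun i j => (x i.succ - x 0) *
      (Matrix.of fun i j => ∑ ν ∈ Finset.Icc (κ (Fin.castSucc j)) (κ (Fin.succ j)),
        x 0 ^ (κ j.succ - ν) * x (Fin.succ i) ^ (ν + j)) i j := by
    ext i j
    simp only [hB, Matrix.submatrix_apply, Fin.succAbove_zero, Matrix.of_apply, Fin.cases_succ]
    have := hle j
    obtain ⟨d, hd⟩ := Nat.exists_eq_add_of_le this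
    rw [hd, ← Finset.Ico_add_one_right_eq_Icc, Finset.sum_Ico_eq_sum_range]
    have e : κ j.castSucc + d + 1 - κ j.castSucc = d + 1 := by omega
    have e2 : κ j.castSucc + d - κ j.castSucc + 1 = d + 1 := by omega
    rw [e, e2]
    have := geom_sum₂_mul (x i.succ) (x 0) (d + 1)
    calc _ = x i.succ ^ (κ j.castSucc + j) * (x i.succ ^ (d+1) - x 0 ^ (d+1)) := by ring
      _ = _ := by
        rw [← this, mul_comm (∑ i ∈ _, _), ← mul_assoc, mul_comm (x i.succ ^ _), mul_assoc,
          Finset.mul_sum]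
        congr 1
        refine Finset.sum_congr rfl fun t ht => ?_
        have ht := Finset.mem_range.1 ht
        have e3 : d + 1 - 1 - t = κ j.castSucc + d - (κ j.castSucc + t) := by omega
        rw [e3]; ring
  rw [h2, Matrix.det_mul_column, det_sum_cols _ (fun j ν i => x 0 ^ (κ j.succ - ν) * x (Fin.succ i) ^ (ν + j))]
  simp only [hB, Matrix.of_apply, Fin.cases_zero]
  rw [Finset.mul_sum, Finset.mul_sum, Finset.mul_sum]
  refine Finset.sum_congr rfl fun ν _ => ?_
  have h3 := Matrix.det_mul_row (fun j => x 0 ^ (κ j.succ - ν j))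
    (Matrix.of fun i j : Fin n => x i.succ ^ (ν j + j))
  simp only [Matrix.of_apply] at h3
  rw [h3, altDet, Finset.prod_pow_eq_pow_sum, pow_add]
  simp only [Fin.val_zero, pow_zero]
  ring

theorem monotone_of_interlacing {n : ℕ} {κ : Fin (n + 1) → ℕ} {ν : Fin n → ℕ}
    (h : ∀ j, κ j.castSucc ≤ ν j ∧ ν j ≤ κ j.succ) : Monotone ν := by
  cases n with
  | zero => exact fun i => i.elim0
  | succ n =>
    refine Fin.monotone_iff_le_succ.2 fun i => (h _).2.trans ?_
    rw [Fin.succ_castSucc]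
    exact (h _).1

theorem prod_sub_mul_schurPoly : ∀ {n : ℕ} (x : Fin n → R) {κ : Fin n → ℕ}, Monotone κ →
    (∏ i, ∏ j ∈ Finset.Ioi i, (x j - x i)) * schurPoly n x κ = altDet n x κ
  | 0, x, κ, _ => by simp [schurPoly, altDet]
  | n + 1, x, κ, hκ => by
    rw [altDet_succ x hκ, Fin.prod_univ_succ, schurPoly, Fin.prod_Ioi_zero, mul_assoc]
    simp_rw [Fin.prod_Ioi_succ]
    congr 1
    rw [Finset.mul_sum]
    refine Finset.sum_congr rfl fun ν hν => ?_
    rw [Fintype.mem_piFinset] at hν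
    rw [← prod_sub_mul_schurPoly (fun i : Fin n => x i.succ)
      (monotone_of_interlacing fun j => Finset.mem_Icc.1 (hν j))]
    ring

open scoped Classical in
/-- Weakly increasing sequences of length `n` with entries at most `c`. -/
noncomputable def monoSeqs (n c : ℕ) : Finset (Fin n → ℕ) :=
  (Fintype.piFinset fun _ => Finset.range (c + 1)).filter Monotone

theorem mem_monoSeqs {n c : ℕ} {κ : Fin n → ℕ} :
    κ ∈ monoSeqs n c ↔ (∀ j, κ j ≤ c) ∧ Monotone κ := by
  simp [monoSeqs, Fintype.mem_piFinset]

/-- The weight recording a factor `z` for odd entries and `w` for even ones. -/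
def parityWt {n : ℕ} (z w : R) (κ : Fin n → ℕ) : R := ∏ j, if Odd (κ j) then z else w

/-- The sum of alternants over sequences bounded by `c`, weighted by parities. -/
noncomputable def altSum (n c : ℕ) (z w : R) (x : Fin n → R) : R :=
  ∑ κ ∈ monoSeqs n c, parityWt z w κ * altDet n x κ

theorem altDet_cons_zero {n : ℕ} (x : Fin (n + 1) → R) (μ : Fin n → ℕ) :
    altDet (n + 1) x (Fin.cons 0 μ) = ∑ i : Fin (n + 1), (-1) ^ (i : ℕ) *
      (∏ j, x (i.succAbove j)) * altDet n (fun j => x (i.succAbove j)) μ := by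
  rw [altDet, Matrix.det_succ_column_zero]
  refine Finset.sum_congr rfl fun i _ => ?_
  rw [altDet, mul_assoc, mul_assoc, ← Matrix.det_mul_column]
  simp only [Matrix.of_apply, Fin.cons_zero, Fin.val_zero, add_zero, pow_zero, one_mul]
  congr 2
  ext a b
  simp only [Matrix.submatrix_apply, Matrix.of_apply, Fin.cons_succ, Fin.val_succ]
  ring

theorem altDet_add_one {n : ℕ} (x : Fin n → R) (κ : Fin n → ℕ) :
    altDet n x (fun j => κ j + 1) = (∏ i, x i) * altDet n x κ := by
  rw [altDet, altDet, ← Matrix.det_mul_column]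
  congr 1
  ext a b
  simp
  ring

theorem parityWt_add_one {n : ℕ} (z w : R) (κ : Fin n → ℕ) :
    parityWt z w (fun j => κ j + 1) = parityWt w z κ := by
  unfold parityWt
  refine Finset.prod_congr rfl fun j _ => ?_
  by_cases h : Odd (κ j) <;> simp [Nat.odd_add_one, h]

theorem altSum_eq_add {n c : ℕ} (z w : R) (x : Fin (n + 1) → R) :
    altSum (n + 1) c z w x =
      ∑ κ ∈ (monoSeqs (n + 1) c).filter (fun κ => κ 0 ≠ 0), parityWt z w κ * altDet (n + 1) x κ +
      w * ∑ i : Fin (n + 1), (-1) ^ (i : ℕ) * (∏ j, x (i.succAbove j)) *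
        altSum n c z w (fun j => x (i.succAbove j)) := by
  rw [altSum, ← Finset.sum_filter_not_add_sum_filter _ (fun κ => κ 0 = 0)]
  congr 1
  simp only [altSum]
  have : ∑ κ ∈ (monoSeqs (n + 1) c).filter (fun κ => κ 0 = 0),
      parityWt z w κ * altDet (n + 1) x κ =
      ∑ μ ∈ monoSeqs n c, parityWt z w (Fin.cons 0 μ : Fin (n + 1) → ℕ) *
        altDet (n + 1) x (Fin.cons 0 μ) := by
    symm
    refine Finset.sum_bij (fun μ _ => (Fin.cons 0 μ : Fin (n + 1) → ℕ)) ?_ ?_ ?_ ?_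
    · intro μ hμ
      obtain ⟨h1, h2⟩ := mem_monoSeqs.1 hμ
      rw [Finset.mem_filter, mem_monoSeqs]
      refine ⟨⟨fun j => ?_, ?_⟩, rfl⟩
      · refine Fin.cases ?_ (fun j => ?_) j
        · simp
        · simpa using h1 j
      · intro a b hab
        induction a using Fin.cases with
        | zero => simp
        | succ a =>
          induction b using Fin.cases with
          | zero => simp at hab
          | succ b => simpa using h2 (Fin.succ_le_succ_iff.1 hab)
    · intro a _ b _ h
      exact Fin.cons_injective2 h |>.2
    · intro κ hκ
      rw [Finset.mem_filter, mem_monoSeqs] at hκ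
      refine ⟨Fin.tail κ, ?_, ?_⟩
      · rw [mem_monoSeqs]
        exact ⟨fun j => hκ.1.1 _, fun a b hab => hκ.1.2 (Fin.succ_le_succ_iff.2 hab)⟩
      · rw [← hκ.2]; exact Fin.cons_self_tail κ
    · intros; rfl
  rw [this]
  have h2 : ∀ μ : Fin n → ℕ, parityWt z w (Fin.cons 0 μ : Fin (n + 1) → ℕ) =
      w * parityWt z w μ := by
    intro μ
    simp [parityWt, Fin.prod_univ_succ]
  simp_rw [h2, altDet_cons_zero, Finset.mul_sum]
  rw [Finset.sum_comm]
  refine Finset.sum_congr rfl fun i _ => Finset.sum_congr rfl fun μ _ => by ring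

theorem altSum_succ_succ {n c : ℕ} (z w : R) (x : Fin (n + 1) → R) :
    altSum (n + 1) (c + 1) z w x = (∏ i, x i) * altSum (n + 1) c w z x +
      w * ∑ i : Fin (n + 1), (-1) ^ (i : ℕ) * (∏ j, x (i.succAbove j)) *
        altSum n (c + 1) z w (fun j => x (i.succAbove j)) := by
  rw [altSum_eq_add]
  congr 1
  rw [altSum, Finset.mul_sum]
  symm
  refine Finset.sum_bij (fun (κ : Fin (n + 1) → ℕ) _ => fun j => κ j + 1) ?_ ?_ ?_ ?_
  · intro κ hκ
    obtain ⟨h1, h2⟩ := mem_monoSeqs.1 hκ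
    rw [Finset.mem_filter, mem_monoSeqs]
    exact ⟨⟨fun j => by simpa using h1 j, fun a b hab => by simpa using h2 hab⟩, by simp⟩
  · intro a _ b _ h
    funext j
    simpa using congrFun h j
  · intro κ hκ
    rw [Finset.mem_filter, mem_monoSeqs] at hκ
    have hpos : ∀ j, 1 ≤ κ j := fun j =>
      (Nat.one_le_iff_ne_zero.2 hκ.2).trans (hκ.1.2 (Fin.zero_le j))
    refine ⟨fun j => κ j - 1, ?_, ?_⟩
    · rw [mem_monoSeqs]
      refine ⟨fun j => ?_, fun a b hab => ?_⟩
      · have := hκ.1.1 j; omega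
      · exact Nat.sub_le_sub_right (hκ.1.2 hab) 1
    · funext j
      have := hpos j
      simp only
      omega
  · intro κ _
    rw [parityWt_add_one, altDet_add_one]
    ring

theorem altSum_succ_zero {n : ℕ} (z w : R) (x : Fin (n + 1) → R) :
    altSum (n + 1) 0 z w x =
      w * ∑ i : Fin (n + 1), (-1) ^ (i : ℕ) * (∏ j, x (i.succAbove j)) *
        altSum n 0 z w (fun j => x (i.succAbove j)) := by
  rw [altSum_eq_add, Finset.filter_false_of_mem, Finset.sum_empty, zero_add]
  intro κ hκ
  have := (mem_monoSeqs.1 hκ).1 0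
  omega

theorem altDet_eq_zero {n : ℕ} (x : Fin n → R) {κ κ' : Fin n → ℕ} (hκ : Monotone κ)
    (h : ∀ j, κ' j = κ j ∨ κ' j = κ j + 1) (hn : ¬ Monotone κ') : altDet n x κ' = 0 := by
  cases n with
  | zero => exact absurd (fun i => i.elim0) hn
  | succ n =>
    rw [Fin.monotone_iff_le_succ] at hn
    push Not at hn
    obtain ⟨j, hj⟩ := hn
    refine Matrix.det_zero_of_column_eq (i := j.castSucc) (j := j.succ)
      (Fin.castSucc_lt_succ).ne fun i => ?_
    have h1 := h j.castSucc
    have h2 := h j.succ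
    have h3 := hκ (Fin.castSucc_le_succ j)
    simp only [Matrix.of_apply, Fin.val_castSucc, Fin.val_succ]
    congr 1
    omega

theorem altSum_odd (n m : ℕ) (z w : R) (x : Fin n → R) :
    altSum n (2 * m + 1) z w x = (∏ i, (w + z * x i)) * altSum n (2 * m) 0 1 x := by
  classical
  have hmaps : ∀ κ ∈ monoSeqs n (2 * m + 1), (fun j => 2 * (κ j / 2)) ∈ monoSeqs n (2 * m) := by
    intro κ hκ
    rw [mem_monoSeqs] at hκ ⊢
    refine ⟨fun j => ?_, fun a b hab => ?_⟩
    · have := hκ.1 j; omega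
    · have := hκ.2 hab
      simp only
      omega
  rw [altSum, ← Finset.sum_fiberwise_of_maps_to hmaps, altSum, Finset.mul_sum]
  refine Finset.sum_congr rfl fun κ hκ => ?_
  rw [mem_monoSeqs] at hκ
  by_cases hev : ∀ j, ¬ Odd (κ j)
  · have hwt : parityWt 0 1 κ = (1 : R) := by
      unfold parityWt
      exact Finset.prod_eq_one fun j _ => by simp [hev j]
    rw [hwt, one_mul, altDet, ← Matrix.det_mul_column]
    have e : (Matrix.of fun i j => (w + z * x i) *
        (Matrix.of fun i j : Fin n => x i ^ (κ j + j)) i j) =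
        Matrix.of fun i j : Fin n => ∑ k ∈ ({κ j, κ j + 1} : Finset ℕ),
          (if Odd k then z else w) * x i ^ (k + j) := by
      ext i j
      have := hev j
      simp only [Matrix.of_apply]
      rw [Finset.sum_pair (by omega), if_neg this, if_pos (by rw [Nat.odd_add_one]; exact this)]
      ring
    rw [e, det_sum_cols _ (fun j k i => (if Odd k then z else w) * x i ^ (k + j))]
    have h4 : ∀ κ' : Fin n → ℕ, (Matrix.of fun i j : Fin n =>
        (if Odd (κ' j) then z else w) * x i ^ (κ' j + j)).det =
        parityWt z w κ' * altDet n x κ' := by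
      intro κ'
      have h3 := Matrix.det_mul_row (fun j => if Odd (κ' j) then z else w)
        (Matrix.of fun i j : Fin n => x i ^ (κ' j + j))
      simpa only [Matrix.of_apply, parityWt, altDet] using h3
    simp_rw [h4]
    refine Finset.sum_subset ?_ ?_
    · intro κ' hκ'
      rw [Finset.mem_filter] at hκ'
      rw [Fintype.mem_piFinset]
      intro j
      have := congrFun hκ'.2 j
      simp only [Finset.mem_insert, Finset.mem_singleton] at this ⊢
      omega
    · intro κ' h1 h2
      rw [Fintype.mem_piFinset] at h1
      have h1' : ∀ j, κ' j = κ j ∨ κ' j = κ j + 1 := fun j => by simpa using h1 j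
      rw [altDet_eq_zero x hκ.2 h1', mul_zero]
      intro hm
      refine h2 ?_
      rw [Finset.mem_filter, mem_monoSeqs]
      refine ⟨⟨fun j => ?_, hm⟩, funext fun j => ?_⟩
      · have := hκ.1 j; have := h1' j; omega
      · have := h1' j
        have h5 := hev j
        rw [Nat.not_odd_iff_even, Nat.even_iff] at h5
        omega
  · push Not at hev
    obtain ⟨j, hj⟩ := hev
    have hwt : parityWt 0 1 κ = (0 : R) :=
      Finset.prod_eq_zero (Finset.mem_univ j) (by simp [hj])
    rw [hwt, zero_mul, mul_zero]
    refine Finset.sum_eq_zero fun κ' hκ' => ?_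
    rw [Finset.mem_filter] at hκ'
    have := congrFun hκ'.2 j
    rw [← this] at hj
    exact absurd hj (Nat.not_odd_iff_even.2 (even_two_mul _))

end Determinants

section Determinants

variable {R : Type*} [CommRing R]

/-- The product of `1 - x i * x j` over `i ≤ j`. -/
def symProd : (n : ℕ) → (Fin n → R) → R
  | 0, _ => 1
  | n + 1, x => (∏ j, (1 - x 0 * x j)) * symProd n (fun i => x i.succ)

theorem symProd_succAbove : ∀ {n : ℕ} (x : Fin (n + 1) → R) (i : Fin (n + 1)),
    symProd (n + 1) x = (∏ j, (1 - x i * x j)) * symProd n (fun j => x (i.succAbove j)) := by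
  intro n
  induction n with
  | zero => intro x i; obtain rfl : i = 0 := Subsingleton.elim (α := Fin 1) i 0; rfl
  | succ n ih =>
    intro x i
    induction i using Fin.cases with
    | zero => simp [symProd]
    | succ i =>
      rw [symProd, ih (fun i => x i.succ) i, symProd,
        Fin.prod_univ_succAbove (fun j => 1 - x 0 * x j) i.succ,
        Fin.prod_univ_succ (fun j => 1 - x i.succ * x j)]
      simp only [Fin.succ_succAbove_zero, Fin.succ_succAbove_succ]
      ring

/-- The `(n + 1)`-rowed determinant with rows `x i ^ r - x i ^ (M - r)` and a last row
`(-z) ^ (n - r) * w ^ r`. -/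
def thetaDet (n M : ℕ) (z w : R) (x : Fin n → R) : R :=
  (Matrix.of fun i r : Fin (n + 1) => Fin.lastCases (motive := fun _ => R)
    ((-z) ^ (n - (r : ℕ)) * w ^ (r : ℕ))
    (fun i => x i ^ (r : ℕ) - x i ^ (M - (r : ℕ))) i).det

/-- The determinant of `x i ^ r - x i ^ (M - r)`. -/
def thetaDet₀ (n M : ℕ) (x : Fin n → R) : R :=
  (Matrix.of fun i r : Fin n => x i ^ (r : ℕ) - x i ^ (M - (r : ℕ))).det

theorem prod_add_mul_eq_sum {n : ℕ} (a b : R) (x : Fin n → R) :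
    ∏ i, (a + b * x i) = ∑ r : Fin (n + 1),
      (∑ t ∈ Finset.powersetCard (r : ℕ) Finset.univ, ∏ i ∈ t, x i) * b ^ (r : ℕ) *
        a ^ (n - (r : ℕ)) := by
  simp_rw [add_comm a]
  rw [Finset.prod_add, Finset.sum_powerset, Finset.card_univ, Fintype.card_fin,
    Finset.sum_range]
  refine Finset.sum_congr rfl fun r _ => ?_
  rw [Finset.sum_mul, Finset.sum_mul]
  refine Finset.sum_congr rfl fun t ht => ?_
  rw [Finset.mem_powersetCard] at ht
  rw [Finset.prod_mul_distrib, Finset.prod_const, Finset.prod_const, ht.2,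
    Finset.card_sdiff_of_subset ht.1, Finset.card_univ, Fintype.card_fin, ht.2]
  ring

theorem thetaDet_zero_one (n M : ℕ) (x : Fin n → R) :
    thetaDet n M 0 1 x = thetaDet₀ n M x := by
  rw [thetaDet, Matrix.det_succ_row _ (Fin.last n), Fin.sum_univ_castSucc,
    Finset.sum_eq_zero, zero_add]
  · simp only [Fin.succAbove_last, Matrix.of_apply, Fin.lastCases_last, thetaDet₀]
    simp only [Fin.val_last, Nat.sub_self, pow_zero, one_pow, mul_one, ← two_mul, pow_mul,
      neg_one_sq, one_mul]
    congr 1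
    ext i j
    simp
  · intro i _
    simp only [Matrix.of_apply, Fin.lastCases_last, Fin.val_castSucc]
    rw [neg_zero, zero_pow (by have := i.2; omega)]
    ring

theorem thetaDet_succ (n M : ℕ) (hM : 2 * n ≤ M) (z w : R) (x : Fin (n + 1) → R) :
    thetaDet (n + 1) (M + 2) z w x =
      (∏ i, x i) * (∏ i, (z + w * x i)) * thetaDet₀ (n + 1) M x +
      w * ∑ i : Fin (n + 1), (-1) ^ (i : ℕ) * (∏ j, x (i.succAbove j)) *
        (∏ j, (1 - x i * x j)) * thetaDet n M z w (fun j => x (i.succAbove j)) := by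
  set A : Matrix (Fin (n + 2)) (Fin (n + 2)) R :=
    Matrix.of fun i r : Fin (n + 2) => Fin.lastCases (motive := fun _ => R)
      ((-z) ^ (n + 1 - (r : ℕ)) * w ^ (r : ℕ))
      (fun i => x i ^ (r : ℕ) - x i ^ (M + 2 - (r : ℕ))) i with hA
  have hθ : thetaDet (n + 1) (M + 2) z w x = A.det := rfl
  set c : Fin (n + 2) → R := fun r =>
    (∑ t ∈ Finset.powersetCard (r : ℕ) Finset.univ, ∏ i ∈ t, x i) * (-1) ^ (r : ℕ) with hc
  have hdet := Matrix.det_updateCol_sum A 0 c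
  have hc0 : c 0 = 1 := by simp [hc]
  rw [hc0, one_smul] at hdet
  rw [hθ, ← hdet, Matrix.det_succ_column_zero, Fin.sum_univ_castSucc, add_comm]
  simp only [Matrix.updateCol_self, smul_eq_mul]
  have hlast : ∑ r, c r * A (Fin.last (n + 1)) r = (-1) ^ (n + 1) * ∏ i, (z + w * x i) := by
    have := prod_add_mul_eq_sum (-z) (-w) x
    rw [show (∏ i, (z + w * x i)) = (-1) ^ (n + 1) * ∏ i, (-z + -w * x i) by
      rw [show (-1 : R) ^ (n + 1) = ∏ _i : Fin (n + 1), (-1 : R) by simp,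
        ← Finset.prod_mul_distrib]
      exact Finset.prod_congr rfl fun i _ => by ring, this, ← mul_assoc, ← mul_pow]
    simp only [mul_neg, mul_one, neg_neg, one_pow, one_mul, hc, hA, Matrix.of_apply,
      Fin.lastCases_last]
    refine Finset.sum_congr rfl fun r _ => ?_
    rw [neg_pow w]
    ring
  have hrow : ∀ i : Fin (n + 1), ∑ r, c r * A i.castSucc r = ∏ j, (1 - x i * x j) := by
    intro i
    have h1 := prod_add_mul_eq_sum 1 (-x i) x
    have h2 := prod_add_mul_eq_sum (x i) (-1) x
    rw [Finset.prod_eq_zero (Finset.mem_univ i) (by ring)] at h2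
    have h3 : ∏ j, (1 - x i * x j) = ∏ j, (1 + -x i * x j) :=
      Finset.prod_congr rfl fun j _ => by ring
    rw [h3, h1, ← sub_eq_zero, ← Finset.sum_sub_distrib, ← mul_zero (-x i ^ (M + 1 - n)), h2,
      Finset.mul_sum]
    refine Finset.sum_congr rfl fun r _ => ?_
    simp only [hc, hA, Matrix.of_apply, Fin.lastCases_castSucc]
    have hr := r.2
    have : M + 2 - (r : ℕ) = (M + 1 - n) + (n + 1 - r) := by omega
    rw [this, neg_pow (x i), pow_add]
    ring
  congr 1
  · rw [hlast]
    have hm : (A.submatrix (Fin.last (n + 1)).succAbove Fin.succ).det =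
        (∏ i, x i) * thetaDet₀ (n + 1) M x := by
      rw [thetaDet₀, ← Matrix.det_mul_column]
      congr 1
      ext i r
      simp only [hA, Matrix.submatrix_apply, Matrix.of_apply, Fin.succAbove_last,
        Fin.lastCases_castSucc, Fin.val_succ]
      have hr := r.2
      have : M + 2 - (r + 1 : ℕ) = M - r + 1 := by omega
      rw [this]; ring
    have hm' : ((A.updateCol 0 fun k => ∑ i, c i * A k i).submatrix
        (Fin.last (n + 1)).succAbove Fin.succ).det = (∏ i, x i) * thetaDet₀ (n + 1) M x := by
      rw [← hm]
      congr 1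
    rw [hm', Fin.val_last]
    calc _ = ((-1) * (-1)) ^ (n + 1) *
        ((∏ i, x i) * (∏ i, (z + w * x i)) * thetaDet₀ (n + 1) M x) := by rw [mul_pow]; ring
      _ = _ := by simp
  · rw [Finset.mul_sum]
    refine Finset.sum_congr rfl fun i _ => ?_
    rw [hrow]
    have hm : ((A.updateCol 0 fun k => ∑ i, c i * A k i).submatrix
        (i.castSucc).succAbove Fin.succ).det =
        (∏ j, x (i.succAbove j)) * w * thetaDet n M z w (fun j => x (i.succAbove j)) := by
      have e : (∏ j, x (i.succAbove j)) * w = ∏ k : Fin (n + 1),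
          Fin.lastCases (motive := fun _ => R) w (fun j => x (i.succAbove j)) k := by
        rw [Fin.prod_univ_castSucc]
        simp
      rw [e, thetaDet, ← Matrix.det_mul_column]
      congr 1
      ext k r
      rw [Matrix.submatrix_apply, Matrix.updateCol_apply, if_neg (Fin.succ_ne_zero r)]
      simp only [Matrix.of_apply]
      have hr := r.2
      induction k using Fin.lastCases with
      | last =>
        rw [Fin.succAbove_castSucc_of_le _ _ (Fin.le_last i), Fin.succ_last]
        simp only [hA, Matrix.of_apply, Fin.lastCases_last, Fin.val_succ]
        rw [Nat.add_sub_add_right]; ring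
      | cast k =>
        rw [Fin.castSucc_succAbove_castSucc]
        simp only [hA, Matrix.of_apply, Fin.lastCases_castSucc, Fin.val_succ]
        have : M + 2 - (r + 1 : ℕ) = M - r + 1 := by omega
        rw [this]; ring
    rw [hm, Fin.val_castSucc]
    ring

theorem thetaDet₀_eq_zero (n : ℕ) (x : Fin (n + 1) → R) : thetaDet₀ (n + 1) (2 * n) x = 0 := by
  refine Matrix.det_eq_zero_of_column_eq_zero (Fin.last n) fun i => ?_
  simp only [Matrix.of_apply, Fin.val_last]
  rw [show 2 * n - n = n by omega, sub_self]

theorem altSum_mul_symProd : ∀ (n m : ℕ) (z w : R) (x : Fin n → R),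
    altSum n (2 * m) z w x * symProd n x = thetaDet n (2 * m + 2 * n) z w x := by
  intro n
  induction n with
  | zero =>
    intro m z w x
    have : monoSeqs 0 (2 * m) = {fun i => i.elim0} := by
      ext κ
      rw [mem_monoSeqs, Finset.mem_singleton]
      exact ⟨fun _ => Subsingleton.elim _ _, fun _ => ⟨fun i => i.elim0, fun i => i.elim0⟩⟩
    rw [altSum, this, Finset.sum_singleton, thetaDet]
    simp [parityWt, altDet, symProd]
    have h1 : (0 : Fin (0 + 1)) = Fin.last 0 := rfl
    rw [h1, Fin.lastCases_last]
  | succ n ih =>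
    intro m
    induction m with
    | zero =>
      intro z w x
      rw [Nat.mul_zero, zero_add, Nat.mul_succ, thetaDet_succ n (2 * n) le_rfl, altSum_succ_zero,
        thetaDet₀_eq_zero, mul_zero, zero_add, mul_assoc, Finset.sum_mul]
      congr 1
      refine Finset.sum_congr rfl fun i _ => ?_
      have := ih 0 z w (fun j => x (i.succAbove j))
      rw [Nat.mul_zero, zero_add] at this
      rw [symProd_succAbove x i, ← this]
      ring
    | succ m ihm =>
      intro z w x
      rw [show 2 * (m + 1) + 2 * (n + 1) = 2 * m + 2 * (n + 1) + 2 by ring,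
        thetaDet_succ n _ (by omega), show 2 * (m + 1) = 2 * m + 1 + 1 by ring, altSum_succ_succ,
        altSum_odd, add_mul, ← thetaDet_zero_one, ← ihm]
      congr 1
      · ring
      · rw [mul_assoc, Finset.sum_mul]
        congr 1
        refine Finset.sum_congr rfl fun i _ => ?_
        have := ih (m + 1) z w (fun j => x (i.succAbove j))
        rw [show 2 * (m + 1) + 2 * n = 2 * m + 2 * (n + 1) by ring] at this
        rw [symProd_succAbove x i, ← this, show 2 * (m + 1) = 2 * m + 1 + 1 by ring]
        ring

end Determinants

section Branching

/-- The row lengths, indexed from the top, of the shape whose rows read from the bottom are `κ`. -/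
def rowFun {n : ℕ} (κ : Fin n → ℕ) (i : ℕ) : ℕ := if h : i < n then κ (Fin.rev ⟨i, h⟩) else 0

theorem rowFun_rev {n : ℕ} (κ : Fin n → ℕ) (j : Fin n) : rowFun κ (Fin.rev j) = κ j := by
  unfold rowFun
  rw [dif_pos (Fin.rev j).2, Fin.eta, Fin.rev_rev]

theorem rowFun_of_le {n : ℕ} (κ : Fin n → ℕ) {i : ℕ} (h : n ≤ i) : rowFun κ i = 0 := by
  simp [rowFun, h]

theorem rowFun_injective {n : ℕ} : Function.Injective (rowFun (n := n)) := fun κ κ' h => by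
  funext j
  rw [← rowFun_rev κ, h, rowFun_rev]

/-- Strict plane partitions with parts at most `n` and row lengths `κ` (read from the bottom). -/
def sppSet (n : ℕ) (κ : Fin n → ℕ) : Set SPP :=
  {P | (∀ i j, P.part i j ≤ n) ∧ ∀ i j, P.part i j ≠ 0 ↔ j < rowFun κ i}

theorem SPP.ext_part {P Q : SPP} (h : ∀ i j, P.part i j = Q.part i j) : P = Q := by
  cases P; cases Q
  congr
  funext i j
  exact h i j

/-- Subtract one from all parts. -/
def SPP.pred (P : SPP) : SPP where
  part i j := P.part i j - 1
  supp_finite := P.supp_finite.subset fun ij h => by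
    simp only [Set.mem_ofPred_eq] at h ⊢
    omega
  row_decr i j₁ j₂ h := Nat.sub_le_sub_right (P.row_decr i j₁ j₂ h) 1
  col_strict i j h := by
    have := P.col_strict i j (by omega)
    omega

theorem mem_piFinset_Icc_iff {n : ℕ} (κ : Fin (n + 1) → ℕ) (ν : Fin n → ℕ) :
    (ν ∈ Fintype.piFinset fun j : Fin n => Finset.Icc (κ j.castSucc) (κ j.succ)) ↔
      ∀ i, rowFun κ (i + 1) ≤ rowFun ν i ∧ rowFun ν i ≤ rowFun κ i := by
  have h1 : ∀ j : Fin n, rowFun κ ((Fin.rev j : ℕ) + 1) = κ j.castSucc := by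
    intro j
    rw [← rowFun_rev κ, Fin.rev_castSucc, Fin.val_succ]
  have h2 : ∀ j : Fin n, rowFun κ (Fin.rev j : ℕ) = κ j.succ := by
    intro j
    rw [← rowFun_rev κ, Fin.rev_succ, Fin.val_castSucc]
  rw [Fintype.mem_piFinset]
  constructor
  · intro h i
    by_cases hi : i < n
    · have := Finset.mem_Icc.1 (h (Fin.rev ⟨i, hi⟩))
      rw [← h1, ← h2, Fin.rev_rev] at this
      simpa [rowFun, hi] using this
    · rw [rowFun_of_le κ (by omega), rowFun_of_le ν (by omega)]
      exact ⟨le_rfl, Nat.zero_le _⟩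
  · intro h j
    have := h (Fin.rev j)
    rw [h1, h2, rowFun_rev] at this
    exact Finset.mem_Icc.2 this

theorem SPP.part_le_sub {n : ℕ} {P : SPP} (hP : ∀ i j, P.part i j ≤ n) :
    ∀ i j, P.part i j ≤ n - i := by
  intro i
  induction i with
  | zero => exact hP 0
  | succ i ih =>
    intro j
    have h1 := ih j
    have h2 := P.col_strict i j
    by_contra h
    have := h2 (by omega)
    omega

theorem exists_mem_sppSet {n : ℕ} (P : SPP) (hP : ∀ i j, P.part i j ≤ n) :
    ∃ κ : Fin n → ℕ, P ∈ sppSet n κ := by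
  have hfin : ∀ i, {j | P.part i j ≠ 0}.Finite := fun i =>
    (P.supp_finite.preimage (f := fun j => (i, j)) fun a _ b _ h => by simpa using h)
  have hrow : ∀ i, ∃ r, ∀ j, P.part i j ≠ 0 ↔ j < r := by
    intro i
    obtain ⟨b, hb⟩ := (hfin i).bddAbove
    have hex : ∃ r, P.part i r = 0 := by
      refine ⟨b + 1, by_contra fun h => ?_⟩
      have := hb h
      omega
    classical
    refine ⟨Nat.find hex, fun j => ?_⟩
    rw [Nat.lt_find_iff]
    refine ⟨fun h m hm hm0 => h ?_, fun h => h j le_rfl⟩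
    have := P.row_decr i m j hm
    omega
  choose r hr using hrow
  refine ⟨fun j => r (Fin.rev j), hP, fun i j => ?_⟩
  by_cases hi : i < n
  · simp only [rowFun, hi, dif_pos, Fin.rev_rev]
    exact hr i j
  · rw [rowFun_of_le _ (by omega)]
    have := SPP.part_le_sub hP i j
    omega

theorem rowFun_succ_le {n : ℕ} {κ : Fin n → ℕ} {P : SPP} (hP : P ∈ sppSet n κ) (i : ℕ) :
    rowFun κ (i + 1) ≤ rowFun κ i := by
  refine le_of_forall_lt fun j hj => ?_
  rw [← hP.2] at hj ⊢
  have := P.col_strict i j hj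
  omega

theorem monotone_of_mem_sppSet {n : ℕ} {κ : Fin n → ℕ} {P : SPP} (hP : P ∈ sppSet n κ) :
    Monotone κ := fun a b hab => by
  rw [← rowFun_rev κ a, ← rowFun_rev κ b]
  exact antitone_nat_of_succ_le (rowFun_succ_le hP) (Fin.rev_le_rev.2 hab)

theorem shape_unique {n : ℕ} {κ κ' : Fin n → ℕ} {P : SPP} (h : P ∈ sppSet n κ)
    (h' : P ∈ sppSet n κ') : κ = κ' := by
  refine rowFun_injective (funext fun i => eq_of_forall_lt_iff fun j => ?_)
  rw [← h.2, ← h'.2]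

theorem exists_pred_mem {n : ℕ} {κ : Fin (n + 1) → ℕ} {P : SPP} (hP : P ∈ sppSet (n + 1) κ) :
    ∃ ν ∈ Fintype.piFinset fun j : Fin n => Finset.Icc (κ j.castSucc) (κ j.succ),
      P.pred ∈ sppSet n ν := by
  obtain ⟨ν, hν⟩ := exists_mem_sppSet (n := n) P.pred fun i j => by
    have := hP.1 i j
    simp only [SPP.pred]
    omega
  refine ⟨ν, (mem_piFinset_Icc_iff κ ν).2 fun i => ⟨?_, ?_⟩, hν⟩
  · refine le_of_forall_lt fun j hj => ?_
    rw [← hP.2] at hj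
    rw [← hν.2]
    have := P.col_strict i j hj
    simp only [SPP.pred]
    omega
  · refine le_of_forall_lt fun j hj => ?_
    rw [← hν.2] at hj
    rw [← hP.2]
    simp only [SPP.pred] at hj
    omega

theorem pred_injOn (n : ℕ) (κ : Fin n → ℕ) : Set.InjOn SPP.pred (sppSet n κ) := by
  intro P hP Q hQ h
  refine SPP.ext_part fun i j => ?_
  have h1 : P.part i j - 1 = Q.part i j - 1 := congrFun (congrFun (congrArg SPP.part h) i) j
  have h2 := hP.2 i j
  rw [← hQ.2 i j] at h2
  omega

theorem exists_pred_eq {n : ℕ} {κ : Fin (n + 1) → ℕ} {ν : Fin n → ℕ}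
    (hν : ν ∈ Fintype.piFinset fun j : Fin n => Finset.Icc (κ j.castSucc) (κ j.succ))
    {Q : SPP} (hQ : Q ∈ sppSet n ν) : ∃ P ∈ sppSet (n + 1) κ, P.pred = Q := by
  rw [mem_piFinset_Icc_iff] at hν
  have hb : ∀ i, rowFun κ i ≤ ∑ j, κ j := by
    intro i
    unfold rowFun
    split_ifs
    · exact Finset.single_le_sum (f := κ) (fun _ _ => Nat.zero_le _) (Finset.mem_univ _)
    · exact Nat.zero_le _
  have hr : ∀ i j₁ j₂, j₁ ≤ j₂ → j₂ < rowFun κ i → j₁ < rowFun κ i := fun _ _ _ => lt_of_le_of_lt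
  refine ⟨⟨fun i j => if j < rowFun κ i then Q.part i j + 1 else 0, ?_, ?_, ?_⟩, ⟨?_, ?_⟩, ?_⟩
  · refine ((Set.finite_Iio (n + 1)).prod (Set.finite_Iio (∑ j, κ j))).subset ?_
    rintro ⟨i, j⟩ h
    simp only [Set.mem_ofPred_eq, ne_eq, ite_eq_right_iff, Nat.add_eq_zero_iff, one_ne_zero,
      and_false, imp_false, not_not] at h
    refine Set.mem_prod.2 ⟨?_, lt_of_lt_of_le h (hb i)⟩
    by_contra hi
    rw [rowFun_of_le κ (by simpa using hi)] at h
    omega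
  · intro i j₁ j₂ h
    have := Q.row_decr i j₁ j₂ h
    have := hr i j₁ j₂ h
    split_ifs <;> omega
  · intro i j h
    have h1 : j < rowFun κ (i + 1) := by
      by_contra h'
      simp [h'] at h
    have h2 : j < rowFun ν i := lt_of_lt_of_le h1 (hν i).1
    have h3 : j < rowFun κ i := lt_of_lt_of_le h2 (hν i).2
    rw [if_pos h1, if_pos h3]
    rw [← hQ.2] at h2
    have := Q.col_strict i j
    omega
  · intro i j
    have := hQ.1 i j
    dsimp only
    split_ifs <;> omega
  · intro i j
    simp
  · refine SPP.ext_part fun i j => ?_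
    simp only [SPP.pred]
    split_ifs with h
    · rfl
    · have h1 := hQ.2 i j
      have := (hν i).2
      omega

theorem sppSet_finite : ∀ (n : ℕ) (κ : Fin n → ℕ), (sppSet n κ).Finite
  | 0, κ => by
    refine Set.Subsingleton.finite fun P hP Q hQ => SPP.ext_part fun i j => ?_
    have := hP.1 i j
    have := hQ.1 i j
    omega
  | n + 1, κ => by
    refine Set.Finite.of_injOn (f := SPP.pred) (t := ⋃ ν ∈ Fintype.piFinset fun j : Fin n =>
      Finset.Icc (κ j.castSucc) (κ j.succ), sppSet n ν) ?_ (pred_injOn _ _) ?_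
    · intro P hP
      obtain ⟨ν, h1, h2⟩ := exists_pred_mem hP
      exact Set.mem_biUnion h1 h2
    · exact Set.Finite.biUnion (Finset.finite_toSet _) fun ν _ => sppSet_finite n ν

theorem ncard_support {n : ℕ} {κ : Fin n → ℕ} {P : SPP} (hP : P ∈ sppSet n κ) :
    {ij : ℕ × ℕ | P.part ij.1 ij.2 ≠ 0}.ncard = ∑ j, κ j := by
  classical
  have h : {ij : ℕ × ℕ | P.part ij.1 ij.2 ≠ 0} =
      ((Finset.range n).biUnion fun i => {i} ×ˢ Finset.range (rowFun κ i) : Finset (ℕ × ℕ)) := by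
    ext ⟨i, j⟩
    simp only [Set.mem_ofPred_eq, Finset.coe_biUnion, Set.mem_iUnion, Finset.mem_coe,
      Finset.mem_product, Finset.mem_singleton, Finset.mem_range, exists_prop]
    rw [hP.2]
    constructor
    · intro h
      refine ⟨i, ?_, rfl, h⟩
      by_contra hi
      rw [rowFun_of_le κ (by omega)] at h
      omega
    · rintro ⟨a, _, rfl, h⟩
      exact h
  rw [h, Set.ncard_coe_finset, Finset.card_biUnion]
  · simp only [Finset.card_product, Finset.card_singleton, one_mul, Finset.card_range]
    rw [Finset.sum_range, ← Equiv.sum_comp Fin.revPerm]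
    exact Finset.sum_congr rfl fun j _ => rowFun_rev κ j
  · intro a _ b _ hab
    rw [Function.onFun, Finset.disjoint_left]
    rintro ⟨i, j⟩ h1 h2
    simp only [Finset.mem_product, Finset.mem_singleton] at h1 h2
    exact hab (h1.1.symm.trans h2.1)

theorem eqCount_add_two (P : SPP) (j : ℕ) : eqCount P (j + 2) = eqCount P.pred (j + 1) := by
  unfold eqCount
  congr 1
  ext ij
  simp only [Set.mem_ofPred_eq, SPP.pred]
  omega

theorem eqCount_one_add (P : SPP) : eqCount P 1 + {ij : ℕ × ℕ | P.pred.part ij.1 ij.2 ≠ 0}.ncard =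
    {ij : ℕ × ℕ | P.part ij.1 ij.2 ≠ 0}.ncard := by
  unfold eqCount
  rw [← Set.ncard_union_eq ?_ ?_ P.pred.supp_finite]
  · congr 1
    ext ij
    simp only [Set.mem_ofPred_eq, SPP.pred, Set.mem_union]
    omega
  · rw [Set.disjoint_left]
    intro ij h1 h2
    simp only [Set.mem_ofPred_eq, SPP.pred] at h1 h2
    omega
  · refine P.supp_finite.subset fun ij h => ?_
    simp only [Set.mem_ofPred_eq] at h ⊢
    omega

variable {R : Type*} [CommRing R]

/-- The monomial recording the multiplicities of the parts `1, …, n`. -/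
noncomputable def sppWeight {n : ℕ} (x : Fin n → R) (P : SPP) : R :=
  ∏ j, x j ^ eqCount P (j + 1)

theorem sum_sppSet : ∀ (n : ℕ) (x : Fin n → R) (κ : Fin n → ℕ),
    ∑ P ∈ (sppSet_finite n κ).toFinset, sppWeight x P = schurPoly n x κ
  | 0, x, κ => by
    have h : (sppSet_finite 0 κ).toFinset = {⟨fun _ _ => 0, by simp, by simp, by simp⟩} := by
      ext P
      rw [Set.Finite.mem_toFinset, Finset.mem_singleton]
      constructor
      · intro h
        exact SPP.ext_part fun i j => Nat.le_zero.1 (h.1 i j)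
      · rintro rfl
        exact ⟨fun _ _ => le_rfl, fun i j => by simp [rowFun]⟩
    rw [h, Finset.sum_singleton]
    simp [sppWeight, schurPoly]
  | n + 1, x, κ => by
    classical
    set V := Fintype.piFinset fun j : Fin n => Finset.Icc (κ j.castSucc) (κ j.succ) with hV
    have hdisj : (V : Set (Fin n → ℕ)).PairwiseDisjoint
        (fun ν => (sppSet_finite n ν).toFinset) := by
      intro a _ b _ hab
      rw [Function.onFun, Finset.disjoint_left]
      intro P h1 h2
      rw [Set.Finite.mem_toFinset] at h1 h2
      exact hab (shape_unique h1 h2)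
    have h1 : ∑ P ∈ (sppSet_finite (n + 1) κ).toFinset, sppWeight x P =
        ∑ Q ∈ V.biUnion fun ν => (sppSet_finite n ν).toFinset,
          x 0 ^ (∑ j, κ j - {ij : ℕ × ℕ | Q.part ij.1 ij.2 ≠ 0}.ncard) *
            sppWeight (fun j => x j.succ) Q := by
      refine Finset.sum_nbij SPP.pred ?_ ?_ ?_ ?_
      · intro P hP
        rw [Set.Finite.mem_toFinset] at hP
        obtain ⟨ν, h1, h2⟩ := exists_pred_mem hP
        rw [Finset.mem_biUnion]
        exact ⟨ν, h1, (Set.Finite.mem_toFinset _).2 h2⟩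
      · rw [Set.Finite.coe_toFinset]
        exact pred_injOn _ _
      · intro Q hQ
        rw [Finset.mem_coe, Finset.mem_biUnion] at hQ
        obtain ⟨ν, h1, h2⟩ := hQ
        rw [Set.Finite.mem_toFinset] at h2
        rw [Set.Finite.coe_toFinset]
        exact exists_pred_eq h1 h2
      · intro P hP
        rw [Set.Finite.mem_toFinset] at hP
        have h1 := eqCount_one_add P
        rw [ncard_support hP] at h1
        rw [sppWeight, Fin.prod_univ_succ, ← h1, Nat.add_sub_cancel]
        congr 1
        refine Finset.prod_congr rfl fun j _ => ?_
        rw [Fin.val_succ, eqCount_add_two]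
    rw [h1, Finset.sum_biUnion hdisj, schurPoly]
    refine Finset.sum_congr rfl fun ν hν => ?_
    rw [← sum_sppSet n _ ν, Finset.mul_sum]
    refine Finset.sum_congr rfl fun Q hQ => ?_
    rw [Set.Finite.mem_toFinset] at hQ
    rw [ncard_support hQ]
    congr 2
    have hle : ∀ j ∈ Finset.univ, ν j ≤ κ j.succ := fun j _ =>
      (Finset.mem_Icc.1 (Fintype.mem_piFinset.1 hν j)).2
    rw [Finset.sum_tsub_distrib _ hle, Fin.sum_univ_succ]
    have := Finset.sum_le_sum hle
    omega

/-- Strict plane partitions with parts at most `n` and at most `c` columns. -/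
def boundedSPP (n c : ℕ) : Set SPP :=
  {P | (∀ i j, P.part i j ≤ n) ∧ ∀ i j, c ≤ j → P.part i j = 0}

theorem mem_boundedSPP_iff {n c : ℕ} {P : SPP} :
    P ∈ boundedSPP n c ↔ ∃ κ ∈ monoSeqs n c, P ∈ sppSet n κ := by
  constructor
  · intro h
    obtain ⟨κ, hκ⟩ := exists_mem_sppSet P h.1
    refine ⟨κ, mem_monoSeqs.2 ⟨fun j => ?_, monotone_of_mem_sppSet hκ⟩, hκ⟩
    rw [← rowFun_rev κ]
    by_contra hc
    rw [not_le, ← hκ.2] at hc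
    exact hc (h.2 _ _ le_rfl)
  · rintro ⟨κ, h1, h2⟩
    refine ⟨h2.1, fun i j hj => ?_⟩
    by_contra h
    rw [← ne_eq, h2.2] at h
    have : rowFun κ i ≤ c := by
      unfold rowFun
      split_ifs
      · exact (mem_monoSeqs.1 h1).1 _
      · exact Nat.zero_le _
    omega

theorem boundedSPP_finite (n c : ℕ) : (boundedSPP n c).Finite := by
  refine (Set.Finite.biUnion (Finset.finite_toSet (monoSeqs n c))
    fun κ _ => sppSet_finite n κ).subset fun P hP => ?_
  obtain ⟨κ, h1, h2⟩ := mem_boundedSPP_iff.1 hP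
  exact Set.mem_biUnion h1 h2

theorem oddRows_eq {n : ℕ} {κ : Fin n → ℕ} {P : SPP} (hP : P ∈ sppSet n κ) :
    oddRows P = (Finset.univ.filter fun j => Odd (κ j)).card := by
  have hrow : ∀ i, rowLen P i = rowFun κ i := by
    intro i
    have : {j | P.part i j ≠ 0} = Set.Iio (rowFun κ i) := by
      ext j
      exact hP.2 i j
    rw [rowLen, this, ← Finset.coe_Iio, Set.ncard_coe_finset, Nat.card_Iio]
  have : {i | Odd (rowLen P i)} =
      ((Finset.univ.filter fun j => Odd (κ j)).image fun j : Fin n => (Fin.rev j : ℕ) :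
        Finset ℕ) := by
    ext i
    simp only [Set.mem_ofPred_eq, hrow, Finset.coe_image, Finset.coe_filter, Finset.mem_univ,
      true_and, Set.mem_image]
    constructor
    · intro h
      by_cases hi : i < n
      · refine ⟨Fin.rev ⟨i, hi⟩, ?_, by simp⟩
        simpa [rowFun, hi] using h
      · rw [rowFun_of_le κ (by omega)] at h
        simp at h
    · rintro ⟨j, h, rfl⟩
      rwa [rowFun_rev]
  rw [oddRows, this, Set.ncard_coe_finset, Finset.card_image_of_injective]
  intro a b h
  exact Fin.rev_injective (Fin.ext h)

theorem parityWt_eq {n : ℕ} {κ : Fin n → ℕ} {P : SPP} (hP : P ∈ sppSet n κ) (z w : R) :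
    parityWt z w κ = z ^ oddRows P * w ^ (n - oddRows P) := by
  have h := Finset.card_filter_add_card_filter_not (s := (Finset.univ : Finset (Fin n)))
    (fun j => Odd (κ j))
  rw [Finset.card_univ, Fintype.card_fin] at h
  rw [parityWt, Finset.prod_ite, Finset.prod_const, Finset.prod_const, oddRows_eq hP]
  congr 2
  omega

theorem oddRows_le {n c : ℕ} {P : SPP} (hP : P ∈ boundedSPP n c) : oddRows P ≤ n := by
  obtain ⟨κ, _, h⟩ := mem_boundedSPP_iff.1 hP
  rw [oddRows_eq h]
  exact (Finset.card_le_univ _).trans_eq (Fintype.card_fin n)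

theorem sum_boundedSPP (n c : ℕ) (z w : R) (x : Fin n → R) :
    ∑ P ∈ (boundedSPP_finite n c).toFinset,
      z ^ oddRows P * w ^ (n - oddRows P) * sppWeight x P =
      ∑ κ ∈ monoSeqs n c, parityWt z w κ * schurPoly n x κ := by
  classical
  have h : (boundedSPP_finite n c).toFinset =
      (monoSeqs n c).biUnion fun κ => (sppSet_finite n κ).toFinset := by
    ext P
    rw [Set.Finite.mem_toFinset, Finset.mem_biUnion, mem_boundedSPP_iff]
    simp only [Set.Finite.mem_toFinset]
  rw [h, Finset.sum_biUnion]
  · refine Finset.sum_congr rfl fun κ _ => ?_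
    rw [← sum_sppSet, Finset.mul_sum]
    refine Finset.sum_congr rfl fun P hP => ?_
    rw [Set.Finite.mem_toFinset] at hP
    rw [parityWt_eq hP]
  · intro a _ b _ hab
    rw [Function.onFun, Finset.disjoint_left]
    intro P h1 h2
    rw [Set.Finite.mem_toFinset] at h1 h2
    exact hab (shape_unique h1 h2)

theorem prod_sub_mul_symProd_mul_sum (n c : ℕ) (z w : R) (x : Fin n → R) :
    (∏ i, ∏ j ∈ Finset.Ioi i, (x j - x i)) * ∑ P ∈ (boundedSPP_finite n c).toFinset,
      z ^ oddRows P * w ^ (n - oddRows P) * sppWeight x P = altSum n c z w x := by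
  rw [sum_boundedSPP, altSum, Finset.mul_sum]
  refine Finset.sum_congr rfl fun κ hκ => ?_
  rw [← prod_sub_mul_schurPoly x (mem_monoSeqs.1 hκ).2]
  ring

theorem eqCount_le {n c : ℕ} (hn : 0 < n) {P : SPP} (hP : P ∈ boundedSPP n c) :
    eqCount P n ≤ c := by
  have : {ij : ℕ × ℕ | P.part ij.1 ij.2 = n} ⊆
      ((Finset.range c).image fun j => (0, j) : Finset (ℕ × ℕ)) := by
    rintro ⟨i, j⟩ h
    simp only [Set.mem_ofPred_eq] at h
    have h1 := SPP.part_le_sub hP.1 i j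
    have h2 := hP.2 i j
    simp only [Finset.coe_image, Finset.coe_range, Set.mem_image, Set.mem_Iio, Prod.mk.injEq]
    exact ⟨j, by omega, by omega, rfl⟩
  refine (Set.ncard_le_ncard this (Finset.finite_toSet _)).trans ?_
  rw [Set.ncard_coe_finset]
  exact Finset.card_image_le.trans_eq (Finset.card_range c)

theorem sppNorm_eq {n : ℕ} {P : SPP} (hP : ∀ i j, P.part i j ≤ n) :
    sppNorm P = ∑ j : Fin n, ((j : ℕ) + 1) * eqCount P (j + 1) := by
  classical
  have hs : Function.support (fun ij : ℕ × ℕ => P.part ij.1 ij.2) ⊆ P.supp_finite.toFinset := by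
    intro ij h
    simpa using h
  rw [sppNorm, finsum_eq_sum_of_support_subset _ hs]
  have hmaps : ∀ ij ∈ P.supp_finite.toFinset, P.part ij.1 ij.2 - 1 ∈ Finset.range n := by
    intro ij h
    rw [Set.Finite.mem_toFinset] at h
    have := hP ij.1 ij.2
    simp only [Set.mem_ofPred_eq] at h
    rw [Finset.mem_range]
    omega
  rw [← Finset.sum_fiberwise_of_maps_to hmaps, Finset.sum_range]
  refine Finset.sum_congr rfl fun j _ => ?_
  have h1 : {ij : ℕ × ℕ | P.part ij.1 ij.2 = j + 1} =
      ((P.supp_finite.toFinset.filter fun ij => P.part ij.1 ij.2 - 1 = j : Finset (ℕ × ℕ)) :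
        Set (ℕ × ℕ)) := by
    ext ij
    simp only [Set.mem_ofPred_eq, Finset.coe_filter, Set.Finite.mem_toFinset]
    omega
  rw [eqCount, h1, Set.ncard_coe_finset, mul_comm, ← smul_eq_mul, ← Finset.sum_const]
  refine Finset.sum_congr rfl fun ij h => ?_
  simp only [Finset.mem_filter, Set.Finite.mem_toFinset, Set.mem_ofPred_eq] at h
  omega

end Branching

section QNumbers

theorem q_ne_zero : q ≠ 0 := RatFunc.X_ne_zero

theorem q_pow_ne_one {m : ℕ} (hm : m ≠ 0) : q ^ m ≠ 1 := by
  intro h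
  rw [q, ← RatFunc.algebraMap_X, ← map_pow, ← map_one (algebraMap (Polynomial ℚ) (RatFunc ℚ))] at h
  have := congrArg Polynomial.natDegree (RatFunc.algebraMap_injective ℚ h)
  rw [Polynomial.natDegree_X_pow, Polynomial.natDegree_one] at this
  exact hm this

theorem q_zpow_ne_one {a : ℤ} (ha : a ≠ 0) : q ^ a ≠ 1 := by
  obtain ⟨m, rfl | rfl⟩ := a.eq_nat_or_neg
  · rw [zpow_natCast]
    exact q_pow_ne_one (by omega)
  · rw [zpow_neg, zpow_natCast, ne_eq, inv_eq_one]
    exact q_pow_ne_one (by omega)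

theorem one_sub_q_zpow_ne_zero {a : ℤ} (ha : a ≠ 0) : 1 - q ^ a ≠ 0 :=
  sub_ne_zero.2 (q_zpow_ne_one ha).symm

theorem one_sub_q_ne_zero : 1 - q ≠ 0 := by
  simpa using one_sub_q_zpow_ne_zero one_ne_zero

theorem q_zpow_injective : Function.Injective fun a : ℤ => q ^ a := fun a b h => by
  by_contra hab
  refine q_zpow_ne_one (sub_ne_zero.2 hab) ?_
  rw [zpow_sub₀ q_ne_zero]
  simp only at h
  rw [h, div_self (zpow_ne_zero _ q_ne_zero)]

theorem one_add_q_zpow_ne_zero (a : ℤ) : 1 + q ^ a ≠ 0 := by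
  intro h
  by_cases ha : a = 0
  · rw [ha, zpow_zero] at h
    norm_num at h
  · refine one_sub_q_zpow_ne_zero (a := 2 * a) (by omega) ?_
    rw [mul_comm, zpow_mul]
    have : (1 - (q ^ a) ^ (2 : ℤ)) = (1 + q ^ a) * (1 - q ^ a) := by
      rw [zpow_ofNat]
      ring
    rw [this, h, zero_mul]

theorem qb_zero : qb 0 = 0 := by simp [qb]

theorem qb_ne_zero {a : ℤ} (ha : a ≠ 0) : qb a ≠ 0 :=
  div_ne_zero (one_sub_q_zpow_ne_zero ha) one_sub_q_ne_zero

theorem qb_neg_mul (a : ℤ) : qb (-a) * q ^ a = -qb a := by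
  rw [qb, qb, zpow_neg]
  have := zpow_ne_zero a q_ne_zero
  field_simp
  ring

@[simp] theorem qfac_zero (a : ℤ) : qfac a 0 = 1 := by simp [qfac]

theorem qfac_succ (a : ℤ) (m : ℕ) : qfac a (m + 1) = qfac a m * qb (a + m) := by
  rw [qfac, Finset.prod_range_succ, qfac]

theorem qfac_succ' (a : ℤ) (m : ℕ) : qfac a (m + 1) = qb a * qfac (a + 1) m := by
  rw [qfac, Finset.prod_range_succ', qfac, mul_comm]
  congr 1
  · simp
  · refine Finset.prod_congr rfl fun i _ => ?_
    push_cast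
    ring_nf

theorem qfac_eq_zero {a : ℤ} {m : ℕ} (h : a ≤ 0) (h' : 0 < a + m) : qfac a m = 0 := by
  refine Finset.prod_eq_zero (i := (-a).toNat) (Finset.mem_range.2 (by omega)) ?_
  rw [Int.toNat_of_nonneg (by omega), add_neg_cancel, qb_zero]

theorem qfac_ne_zero {a : ℤ} (h : 0 < a) (m : ℕ) : qfac a m ≠ 0 :=
  Finset.prod_ne_zero_iff.2 fun i _ => qb_ne_zero (by omega)

theorem triangle_succ (m : ℕ) : (m + 1) * m / 2 = m * (m - 1) / 2 + m := by
  cases m with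
  | zero => rfl
  | succ m =>
    rw [Nat.add_sub_cancel, show (m + 1 + 1) * (m + 1) = (m + 1) * m + (m + 1) * 2 by ring,
      Nat.add_mul_div_right _ _ (by norm_num)]

theorem qfac_reflect (a : ℤ) (m : ℕ) :
    qfac (1 - a - m) m * (q ^ (a * m) * q ^ (m * (m - 1) / 2)) = (-1) ^ m * qfac a m := by
  induction m with
  | zero => simp
  | succ m ih =>
    rw [qfac_succ', qfac_succ, Nat.add_sub_cancel, triangle_succ, pow_add q, pow_succ (-1 : RatFunc ℚ),
      show (1 : ℤ) - a - (m + 1 : ℕ) + 1 = 1 - a - m by push_cast; ring,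
      show (1 : ℤ) - a - (m + 1 : ℕ) = -(a + m) by push_cast; ring,
      show a * (m + 1 : ℕ) = a * m + a by push_cast; ring, zpow_add₀ q_ne_zero]
    have h := qb_neg_mul (a + m)
    rw [zpow_add₀ q_ne_zero, zpow_natCast] at h
    calc _ = (qfac (1 - a - m) m * (q ^ (a * m) * q ^ (m * (m - 1) / 2))) *
        (qb (-(a + m)) * (q ^ a * q ^ m)) := by ring
      _ = _ := by rw [ih, h]; ring

end QNumbers

section PartialFractions

open Polynomial

variable {K : Type*} [Field K] {ι : Type*} [DecidableEq ι]

theorem coeff_eq_sum_of_mul_prod_eq (s : Finset ι) (τ : ι → K) (hinj : Set.InjOn τ s)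
    (h0 : ∀ i ∈ s, τ i ≠ 0) {F P H : K[X]} {d : ℕ} (hP : P.degree < s.card)
    (h : F * ∏ i ∈ s, (1 - C (τ i) * X) = P + X ^ d * H) {k : ℕ} (hk : k < d) :
    F.coeff k = ∑ i ∈ s, P.eval (τ i)⁻¹ / (∏ j ∈ s.erase i, (1 - τ j * (τ i)⁻¹)) * τ i ^ k := by
  set w : ι → K := fun i => P.eval (τ i)⁻¹ / ∏ j ∈ s.erase i, (1 - τ j * (τ i)⁻¹) with hw
  have hdeg : ∀ i, (∏ j ∈ s.erase i, (1 - C (τ j) * X)).natDegree ≤ (s.erase i).card := by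
    intro i
    refine (natDegree_prod_le _ _).trans ((Finset.sum_le_card_nsmul _ _ 1 fun j _ => ?_).trans_eq
      (by simp))
    compute_degree
  have hPs : P = ∑ i ∈ s, C (w i) * ∏ j ∈ s.erase i, (1 - C (τ j) * X) := by
    refine Polynomial.eq_of_degrees_lt_of_eval_index_eq s (v := fun i => (τ i)⁻¹) ?_ hP ?_ ?_
    · intro a ha b hb hab
      exact hinj ha hb (inv_injective hab)
    · refine (Polynomial.degree_sum_le _ _).trans_lt ?_
      rw [Finset.sup_lt_iff (WithBot.bot_lt_coe _)]
      intro i hi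
      rw [← smul_eq_C_mul]
      refine (degree_smul_le _ _).trans_lt (degree_le_natDegree.trans_lt ?_)
      have := hdeg i
      rw [Finset.card_erase_of_mem hi] at this
      have := Finset.card_pos.2 ⟨i, hi⟩
      exact_mod_cast (by omega : _ < s.card)
    · intro i hi
      rw [eval_finsetSum, Finset.sum_eq_single_of_mem i hi]
      · rw [eval_mul, eval_C, eval_prod]
        simp only [eval_sub, eval_one, eval_mul, eval_C, eval_X, hw]
        rw [div_mul_cancel₀]
        refine Finset.prod_ne_zero_iff.2 fun j hj => ?_
        rw [Finset.mem_erase] at hj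
        intro h1
        refine hj.1 (hinj hj.2 hi ?_)
        rw [sub_eq_zero, eq_mul_inv_iff_mul_eq₀ (h0 i hi), one_mul] at h1
        exact h1.symm
      · intro j hj hji
        rw [eval_mul, eval_prod, Finset.prod_eq_zero (i := i), mul_zero]
        · exact Finset.mem_erase.2 ⟨hji.symm, hi⟩
        · simp [h0 i hi]
  have hgeo : ∀ a : K, (((1 - C a * X : K[X]) : PowerSeries K)) * PowerSeries.mk (fun k => a ^ k) = 1 := by
    intro a
    ext k
    rw [Polynomial.coe_sub, Polynomial.coe_one, Polynomial.coe_mul, Polynomial.coe_C,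
      Polynomial.coe_X, sub_mul, one_mul, mul_assoc]
    cases k with
    | zero => simp
    | succ k =>
      rw [map_sub, PowerSeries.coeff_C_mul, PowerSeries.coeff_succ_X_mul, PowerSeries.coeff_mk,
        PowerSeries.coeff_mk, PowerSeries.coeff_one]
      simp
      ring
  set Q : PowerSeries K := ((∏ i ∈ s, (1 - C (τ i) * X) : K[X]) : PowerSeries K) with hQ
  set G : PowerSeries K := ∑ i ∈ s, PowerSeries.C (w i) * PowerSeries.mk (fun k => τ i ^ k) with hG
  have hQG : Q * G = (P : PowerSeries K) := by
    rw [hG, Finset.mul_sum]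
    conv_rhs => rw [hPs]
    rw [← Polynomial.coeToPowerSeries.ringHom_apply, map_sum]
    refine Finset.sum_congr rfl fun i hi => ?_
    rw [hQ, ← Finset.mul_prod_erase s _ hi, Polynomial.coe_mul,
      Polynomial.coeToPowerSeries.ringHom_apply, Polynomial.coe_mul, Polynomial.coe_C]
    linear_combination (PowerSeries.C (w i) *
      ((∏ j ∈ s.erase i, (1 - C (τ j) * X) : K[X]) : PowerSeries K)) * hgeo (τ i)
  have hu : IsUnit Q := by
    rw [PowerSeries.isUnit_iff_constantCoeff, hQ, Polynomial.constantCoeff_coe,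
      Polynomial.coeff_zero_eq_eval_zero, eval_prod]
    simp
  obtain ⟨u, hu⟩ := hu
  have h1 : (F : PowerSeries K) - G = PowerSeries.X ^ d * (((u⁻¹ : (PowerSeries K)ˣ) : PowerSeries K) * (H : PowerSeries K)) := by
    have h2 : (F : PowerSeries K) * Q = (P : PowerSeries K) + PowerSeries.X ^ d * (H : PowerSeries K) := by
      rw [hQ, ← Polynomial.coe_mul, h]
      simp
    have h3 : Q * ((F : PowerSeries K) - G) = PowerSeries.X ^ d * (H : PowerSeries K) := by
      rw [mul_sub, hQG, mul_comm, h2]; ring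
    rw [← hu] at h3
    calc _ = ((u⁻¹ : (PowerSeries K)ˣ) : PowerSeries K) * ((u : PowerSeries K) * ((F : PowerSeries K) - G)) := by rw [Units.inv_mul_cancel_left]
      _ = _ := by rw [h3]; ring
  have h4 := congrArg (PowerSeries.coeff k) h1
  rw [PowerSeries.coeff_X_pow_mul', if_neg (by omega), map_sub, sub_eq_zero,
    Polynomial.coeff_coe] at h4
  rw [h4, hG, map_sum]
  refine Finset.sum_congr rfl fun i _ => ?_
  rw [PowerSeries.coeff_C_mul, PowerSeries.coeff_mk]

end PartialFractions

section Basis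

theorem Wnc_eq_zero {N c : ℕ} {k : ℤ} (h : (-N ≤ k ∧ k < 0) ∨ (c < k ∧ k ≤ c + N)) :
    Wnc (N + 1) c k = 0 := by
  rw [Wnc, Nat.add_sub_cancel]
  push_cast
  rcases h with h | h
  · rw [qfac_eq_zero (a := k + 1) (by omega) (by omega), zero_mul]
  · rw [qfac_eq_zero (a := k - c - (N + 1) + 1) (by omega) (by omega), mul_zero]

theorem triangle_mul_two (m : ℕ) : (m + 1) * m / 2 * 2 = (m + 1) * m :=
  Nat.div_mul_cancel (Nat.even_mul_pred_self (m + 1)).two_dvd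

theorem Unc_exponent (N c : ℕ) : (((N + 1 : ℕ) : ℤ) - 1) * (2 * c + (N + 1 : ℕ)) / 2 =
    N * c + ((N + 1) * N / 2 : ℕ) := by
  have h : (N + 1) * N / 2 * 2 = (N + 1) * N := Nat.div_mul_cancel (Nat.even_mul_pred_self (N + 1)).two_dvd
  push_cast at h ⊢
  rw [Int.ediv_eq_iff_eq_mul_left (by norm_num)]
  · zify at h
    linear_combination -h
  · refine ⟨N * c + ((N + 1) * N / 2 : ℕ), ?_⟩
    push_cast
    zify at h
    linear_combination -h

theorem Unc_eq_zero_left {N c i : ℕ} (hi : 1 ≤ i) (hiN : i ≤ N) : Unc (N + 1) c (-i) = 0 := by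
  rw [Unc, Unc_exponent, Nat.add_sub_cancel,
    Finset.sum_eq_single_of_mem i (Finset.mem_Icc.2 ⟨hi, hiN⟩)]
  · obtain ⟨a, rfl⟩ := Nat.exists_eq_add_of_le' hi
    obtain ⟨b, rfl⟩ := Nat.exists_eq_add_of_le hiN
    rw [show (a + 1 + b + 1 - (a + 1) - 1) = b by omega, show a + 1 + b - (a + 1) = b by omega,
      Nat.add_sub_cancel, qfac_eq_zero (a := -((a + 1 : ℕ) : ℤ) + 1) (m := a + 1 + b) (by omega) (by omega)]
    have h1 := qfac_reflect 1 a
    have h2 := qfac_reflect (c + a + 2) (a + 1 + b)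
    have e1 : (1 : ℤ) - 1 - a = -((a + 1 : ℕ) : ℤ) + 1 := by push_cast; ring
    have e2 : (1 : ℤ) - (c + a + 2) - (a + 1 + b : ℕ) =
        -((a + 1 : ℕ) : ℤ) - c - ((a + 1 + b + 1 : ℕ) : ℤ) + 1 := by push_cast; ring
    rw [e1] at h1
    rw [e2] at h2
    rw [triangle_succ a, triangle_succ (a + 1 + b)]
    have e3 : -((a + 1 : ℕ) : ℤ) + (a + 1 : ℕ) + 1 = 1 := by ring
    have e4 : (c : ℤ) + (a + 1 : ℕ) + 1 = c + a + 2 := by push_cast; ring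
    rw [e3, e4]
    set X1 := qfac (-((a + 1 : ℕ) : ℤ) + 1) a
    set X2 := qfac (-((a + 1 : ℕ) : ℤ) - c - ((a + 1 + b + 1 : ℕ) : ℤ) + 1) (a + 1 + b)
    have n1 := qfac_ne_zero (a := 1) one_pos a
    have n2 := qfac_ne_zero (a := 1) one_pos b
    have n3 := qfac_ne_zero (a := c + a + 2) (by omega) (a + 1 + b)
    set F1 := qfac 1 a
    set F2 := qfac (c + a + 2) (a + 1 + b)
    set T1 := a * (a - 1) / 2
    set T2 := (a + 1 + b) * (a + 1 + b - 1) / 2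
    have g1 : q ^ (T1 + a) * X1 = (-1) ^ a * F1 := by
      rw [one_mul, zpow_natCast] at h1
      rw [← h1]
      ring
    have g2 : q ^ (((a + 1 + b : ℕ) : ℤ) * c + (T2 + (a + 1 + b) : ℕ)) * X2 =
        q ^ ((((a + 1 + b + 1 : ℕ) : ℤ) - 1) * -((a + 1 : ℕ) : ℤ)) * ((-1) ^ (a + 1 + b) * F2) := by
      rw [← h2, mul_comm X2, ← mul_assoc, ← zpow_natCast q T2, ← zpow_add₀ q_ne_zero,
        ← zpow_add₀ q_ne_zero]
      congr 2
      push_cast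
      ring
    have g3 : ((-1 : RatFunc ℚ) ^ (a + 1 + b)) * (-1) ^ (a + 1 + b) = 1 := by
      rw [← mul_pow]
      simp
    rw [zpow_neg, zpow_natCast, ← inv_pow, inv_neg_one]
    rw [zero_mul, zero_mul, mul_zero, zero_sub, neg_div, mul_neg, neg_add_eq_zero,
      mul_div_assoc', div_eq_iff (mul_ne_zero (mul_ne_zero n1 n2) n3)]
    set Q1 := q ^ (((a + 1 + b : ℕ) : ℤ) * c + (T2 + (a + 1 + b) : ℕ))
    set Q2 := q ^ ((((a + 1 + b + 1 : ℕ) : ℤ) - 1) * -((a + 1 : ℕ) : ℤ))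
    calc _ = (-1 : RatFunc ℚ) ^ (a + 1 + b + 1) * qfac 1 b * ((q ^ (T1 + a) * X1) * (Q1 * X2)) := by
          ring
      _ = ((-1 : RatFunc ℚ) ^ (a + 1 + b) * (-1) ^ (a + 1 + b)) * ((-1) ^ (a + 1) * Q2 *
          (F1 * qfac 1 b * F2)) := by
        rw [g1, g2]
        ring
      _ = _ := by rw [g3, one_mul]
  · intro j hj hji
    rw [Finset.mem_Icc] at hj
    rw [qfac_eq_zero (a := -i + 1) (m := N) (by omega) (by omega)]
    rcases lt_or_gt_of_ne hji with h | h
    · rw [qfac_eq_zero (a := -i + j + 1) (by omega) (by omega)]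
      simp
    · rw [qfac_eq_zero (a := -i + 1) (m := j - 1) (by omega) (by omega)]
      simp

theorem Unc_eq_zero_right {N c i : ℕ} (hi : 1 ≤ i) (hiN : i ≤ N) :
    Unc (N + 1) c (c + i : ℕ) = 0 := by
  rw [Unc, Unc_exponent, Nat.add_sub_cancel,
    Finset.sum_eq_single_of_mem i (Finset.mem_Icc.2 ⟨hi, hiN⟩)]
  · obtain ⟨a, rfl⟩ := Nat.exists_eq_add_of_le' hi
    obtain ⟨b, rfl⟩ := Nat.exists_eq_add_of_le hiN
    rw [show (a + 1 + b + 1 - (a + 1) - 1) = b by omega, show a + 1 + b - (a + 1) = b by omega,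
      Nat.add_sub_cancel]
    have h1 := qfac_reflect 1 b
    rw [qfac_eq_zero (a := (c + (a + 1) : ℕ) - c - ((a + 1 + b + 1 : ℕ) : ℤ) + 1)
      (m := a + 1 + b) (by omega) (by omega)]
    have e1 : (1 : ℤ) - 1 - b = (c + (a + 1) : ℕ) - c - ((a + 1 + b + 1 : ℕ) : ℤ) + 1 := by
      push_cast; ring
    have e3 : ((c + (a + 1) : ℕ) : ℤ) - c - (a + 1 : ℕ) + 1 = 1 := by push_cast; ring
    have e4 : ((c + (a + 1) : ℕ) : ℤ) + 1 = c + (a + 1 : ℕ) + 1 := by push_cast; ring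
    rw [e1] at h1
    rw [e3, e4, zpow_natCast, pow_add (-1 : RatFunc ℚ) c]
    rw [one_mul, zpow_natCast] at h1
    have n1 := qfac_ne_zero (a := 1) one_pos a
    have n2 := qfac_ne_zero (a := 1) one_pos b
    have n3 := qfac_ne_zero (a := c + (a + 1 : ℕ) + 1) (by omega) (a + 1 + b)
    set F1 := qfac 1 a
    set F2 := qfac 1 b
    set F3 := qfac (c + (a + 1 : ℕ) + 1) (a + 1 + b)
    set X1 := qfac ((c + (a + 1) : ℕ) - c - ((a + 1 + b + 1 : ℕ) : ℤ) + 1) b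
    have t : (a + 1) * a / 2 + (a + 1 + b + 1) * (a + 1 + b) / 2 =
        b * (b - 1) / 2 + b + (a + 1 + b) * (a + 1) := by
      have h2 := triangle_mul_two a
      have h3 := triangle_mul_two (a + 1 + b)
      have h4 := triangle_mul_two b
      rw [triangle_succ b] at h4
      refine Nat.eq_of_mul_eq_mul_right two_pos ?_
      linear_combination h2 + h3 - h4
    have g1 : q ^ (((a + 1 + b : ℕ) : ℤ) * c + ((a + 1 + b + 1) * (a + 1 + b) / 2 : ℕ)) *
        q ^ ((a + 1) * a / 2) * X1 =
        q ^ ((((a + 1 + b + 1 : ℕ) : ℤ) - 1) * ((c + (a + 1) : ℕ) : ℤ)) * ((-1) ^ b * F2) := by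
      rw [← h1, mul_comm X1, ← mul_assoc]
      congr 1
      simp only [← zpow_natCast, ← zpow_add₀ q_ne_zero]
      congr 1
      zify at t
      push_cast
      linear_combination t
    set Q1 := q ^ (((a + 1 + b : ℕ) : ℤ) * c + ((a + 1 + b + 1) * (a + 1 + b) / 2 : ℕ))
    set Q2 := q ^ ((((a + 1 + b + 1 : ℕ) : ℤ) - 1) * ((c + (a + 1) : ℕ) : ℤ))
    rw [mul_zero, mul_zero, sub_zero, mul_div_assoc', ← eq_neg_iff_add_eq_zero,
      div_eq_iff (mul_ne_zero (mul_ne_zero n1 n2) n3)]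
    calc _ = (-1 : RatFunc ℚ) ^ (a + 1 + b + 1) * (-1) ^ c * F3 * F1 *
          (Q1 * q ^ ((a + 1) * a / 2) * X1) := by
          ring
      _ = ((-1 : RatFunc ℚ) ^ b * (-1) ^ b) * (-((-1) ^ c * ((-1) ^ a * (-1)) * Q2) *
          (F1 * F2 * F3)) := by
        rw [g1]
        ring
      _ = _ := by rw [← mul_pow, neg_mul_neg, one_mul, one_pow]; ring
  · intro j hj hji
    rw [Finset.mem_Icc] at hj
    push_cast
    rw [qfac_eq_zero (a := c + i - c - (N + 1) + 1) (m := N) (by omega) (by omega)]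
    rcases lt_or_gt_of_ne hji with h | h
    · rw [qfac_eq_zero (a := c + i - c - (N + 1) + 1) (by omega) (by omega)]
      simp
    · rw [qfac_eq_zero (a := c + i - c - j + 1) (by omega) (by omega)]
      simp

end Basis

section Interpolation

open Polynomial

/-- The polynomial whose value at `q ^ k` is `[k + a]_m`. -/
noncomputable def qfacPoly (a : ℤ) (m : ℕ) : (RatFunc ℚ)[X] :=
  ∏ i ∈ Finset.range m, (C ((1 - q)⁻¹) - C ((1 - q)⁻¹ * q ^ (a + i)) * X)

theorem eval_qfacPoly (a : ℤ) (m : ℕ) (k : ℤ) : (qfacPoly a m).eval (q ^ k) = qfac (k + a) m := by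
  rw [qfacPoly, eval_prod, qfac]
  refine Finset.prod_congr rfl fun i _ => ?_
  rw [qb, add_assoc, zpow_add₀ q_ne_zero k]
  simp
  ring

theorem natDegree_qfacPoly_le (a : ℤ) (m : ℕ) : (qfacPoly a m).natDegree ≤ m := by
  refine (natDegree_prod_le _ _).trans ((Finset.sum_le_card_nsmul _ _ 1 fun j _ => ?_).trans_eq
    (by simp))
  compute_degree

theorem coeff_qfacPoly (a : ℤ) (m : ℕ) :
    (qfacPoly a m).coeff m * (1 - q) ^ m = (-1) ^ m * ∏ i ∈ Finset.range m, q ^ (a + i) := by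
  have h := Polynomial.coeff_prod_of_natDegree_le (s := Finset.range m)
    (fun i : ℕ => (C ((1 - q)⁻¹) - C ((1 - q)⁻¹ * q ^ (a + i)) * X : (RatFunc ℚ)[X])) 1
    (fun i _ => by compute_degree)
  rw [Finset.card_range, mul_one] at h
  rw [qfacPoly, h]
  have : (1 - q) ^ m = ∏ i ∈ Finset.range m, (1 - q) := by simp
  rw [this, ← Finset.prod_mul_distrib]
  have : (-1 : RatFunc ℚ) ^ m = ∏ i ∈ Finset.range m, (-1) := by simp
  rw [this, ← Finset.prod_mul_distrib]
  refine Finset.prod_congr rfl fun i _ => ?_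
  have := one_sub_q_ne_zero
  simp [coeff_C]
  field_simp

theorem Wnc_eq_eval (N c : ℕ) (k : ℤ) :
    Wnc (N + 1) c k = (qfacPoly 1 N * qfacPoly (-c - N) N).eval (q ^ k) := by
  rw [eval_mul, eval_qfacPoly, eval_qfacPoly, Wnc, Nat.add_sub_cancel]
  congr 2
  push_cast
  ring

theorem coeff_WncPoly (N c : ℕ) :
    (qfacPoly 1 N * qfacPoly (-c - N) N).coeff (2 * N) * ((1 - q) ^ (2 * N) * q ^ (N * c)) = 1 := by
  rw [two_mul, coeff_mul_add_eq_of_natDegree_le (natDegree_qfacPoly_le _ _) (natDegree_qfacPoly_le _ _)]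
  have h1 := coeff_qfacPoly 1 N
  have h2 := coeff_qfacPoly (-c - N) N
  have h3 : (∏ i ∈ Finset.range N, q ^ ((1 : ℤ) + i)) * (∏ i ∈ Finset.range N, q ^ (-(c : ℤ) - N + i)) *
      q ^ (N * c) = 1 := by
    rw [← Finset.prod_range_reflect (fun i : ℕ => q ^ (-(c : ℤ) - N + i)), mul_comm N c, pow_mul,
      show (q ^ c) ^ N = ∏ i ∈ Finset.range N, q ^ c by simp, ← Finset.prod_mul_distrib, ← Finset.prod_mul_distrib]
    refine Finset.prod_eq_one fun i hi => ?_
    rw [Finset.mem_range] at hi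
    rw [← zpow_natCast, ← zpow_add₀ q_ne_zero, ← zpow_add₀ q_ne_zero, ← zpow_zero q]
    congr 1
    omega
  calc _ = ((qfacPoly 1 N).coeff N * (1 - q) ^ N) * ((qfacPoly (-c - N) N).coeff N * (1 - q) ^ N) *
      q ^ (N * c) := by ring
    _ = ((-1) ^ N * (-1) ^ N) * ((∏ i ∈ Finset.range N, q ^ ((1 : ℤ) + i)) *
        (∏ i ∈ Finset.range N, q ^ (-(c : ℤ) - N + i)) * q ^ (N * c)) := by rw [h1, h2]; ring
    _ = 1 := by rw [h3, ← mul_pow, neg_mul_neg, one_mul, one_pow, one_mul]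

theorem exists_Unc_eq_eval (N c : ℕ) : ∃ U : (RatFunc ℚ)[X], U.degree < (2 * N : ℕ) ∧
    ∀ k : ℤ, Unc (N + 1) c k = U.eval (q ^ k) + (-1) ^ k * q ^ (N * k) := by
  refine ⟨C ((-1) ^ (N + 1) * q ^ ((((N + 1 : ℕ) : ℤ) - 1) * (2 * c + (N + 1 : ℕ)) / 2)) *
    ∑ i ∈ Finset.Icc 1 N, (C ((-1) ^ c * q ^ (i * (i - 1) / 2)) *
          (qfacPoly 1 N * qfacPoly (-c - i + 1) (i - 1) * qfacPoly (-c - (N + 1 : ℕ) + 1) (N + 1 - i - 1)) -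
        C (q ^ (i * (i - 1) / 2)) * (qfacPoly 1 (i - 1) * qfacPoly (i + 1) (N + 1 - i - 1) *
            qfacPoly (-c - (N + 1 : ℕ) + 1) N)) *
      C ((qfac 1 (i - 1) * qfac 1 (N - i) * qfac (c + i + 1) N)⁻¹), ?_, fun k => ?_⟩
  · rw [← smul_eq_C_mul]
    refine (degree_smul_le _ _).trans_lt ((Polynomial.degree_sum_le _ _).trans_lt ?_)
    rw [Finset.sup_lt_iff (WithBot.bot_lt_coe _)]
    intro i hi
    rw [Finset.mem_Icc] at hi
    rw [mul_comm, ← smul_eq_C_mul]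
    refine (degree_smul_le _ _).trans_lt ((degree_sub_le _ _).trans_lt (max_lt ?_ ?_))
    · rw [← smul_eq_C_mul]
      refine (degree_smul_le _ _).trans_lt (degree_le_natDegree.trans_lt (Nat.cast_lt.2 ?_))
      refine (natDegree_mul_le.trans (add_le_add (natDegree_mul_le.trans (add_le_add
        (natDegree_qfacPoly_le _ _) (natDegree_qfacPoly_le _ _))) (natDegree_qfacPoly_le _ _))).trans_lt ?_
      omega
    · rw [← smul_eq_C_mul]
      refine (degree_smul_le _ _).trans_lt (degree_le_natDegree.trans_lt (Nat.cast_lt.2 ?_))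
      refine (natDegree_mul_le.trans (add_le_add (natDegree_mul_le.trans (add_le_add
        (natDegree_qfacPoly_le _ _) (natDegree_qfacPoly_le _ _))) (natDegree_qfacPoly_le _ _))).trans_lt ?_
      omega
  · rw [Unc, Nat.add_sub_cancel, eval_mul, eval_C, eval_finsetSum]
    congr 1
    · congr 1
      refine Finset.sum_congr rfl fun i _ => ?_
      simp only [eval_mul, eval_sub, eval_C, eval_qfacPoly]
      rw [div_eq_mul_inv]
      rw [← add_assoc k, ← add_assoc k, ← add_assoc k, sub_eq_add_neg, sub_eq_add_neg, sub_eq_add_neg]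
      ring_nf
    · congr 2
      push_cast
      ring

end Interpolation

section Reconstruction

open Polynomial

theorem coeff_mul_q_pow_eq {N c : ℕ} {f P H : (RatFunc ℚ)[X]} (hf : f.natDegree ≤ c)
    (hP : P.degree ≤ (N + 1 : ℕ))
    (h : f * ((1 + X) * ∏ j ∈ Finset.range (2 * N + 1), (1 - C (q ^ ((j : ℤ) - N)) * X)) =
      P + X ^ (c + N + 1) * H) {k : ℕ} (hk : k ≤ c) :
    f.coeff k * q ^ (N * k) =
      P.eval (q ^ (-N : ℤ)) * (q ^ (N * c) * (1 - q) ^ (2 * N)) /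
        ((1 + q ^ (-N : ℤ)) * ∏ j ∈ Finset.range (2 * N), (1 - q ^ ((j : ℤ) - 2 * N))) *
          Wnc (N + 1) c k +
      P.eval (-1) / (∏ j ∈ Finset.range (2 * N + 1), (1 + q ^ ((j : ℤ) - N))) *
        Unc (N + 1) c k := by
  set τ : ℕ → RatFunc ℚ := fun j => if j < 2 * N + 1 then q ^ ((j : ℤ) - N) else -1 with hτ
  have τ1 : ∀ j ∈ Finset.range (2 * N + 1), τ j = q ^ ((j : ℤ) - N) := fun j hj =>
    if_pos (Finset.mem_range.1 hj)
  have τ2 : τ (2 * N + 1) = -1 := if_neg (by omega)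
  have hq1 : ∀ a : ℤ, q ^ a ≠ -1 := fun a ha => one_add_q_zpow_ne_zero a (by rw [ha]; ring)
  have hinj : Set.InjOn τ (Finset.range (2 * N + 2)) := by
    intro a ha b hb hab
    simp only [Finset.coe_range, Set.mem_Iio] at ha hb
    simp only [hτ] at hab
    split_ifs at hab with h1 h2 h2
    · have := q_zpow_injective hab
      omega
    · exact absurd hab (hq1 _)
    · exact absurd hab.symm (hq1 _)
    · omega
  have h0 : ∀ j ∈ Finset.range (2 * N + 2), τ j ≠ 0 := by
    intro j _
    simp only [hτ]
    split_ifs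
    · exact zpow_ne_zero _ q_ne_zero
    · norm_num
  have hprod : ∏ j ∈ Finset.range (2 * N + 2), (1 - C (τ j) * X) =
      (1 + X) * ∏ j ∈ Finset.range (2 * N + 1), (1 - C (q ^ ((j : ℤ) - N)) * X) := by
    rw [Finset.prod_range_succ, τ2, mul_comm]
    congr 1
    · simp
    · exact Finset.prod_congr rfl fun j hj => by rw [τ1 j hj]
  have hP' : (X ^ N * P).degree < ((Finset.range (2 * N + 2)).card : WithBot ℕ) := by
    rw [Finset.card_range, degree_mul, degree_X_pow]
    refine (add_le_add_right hP (N : WithBot ℕ)).trans_lt ?_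
    exact_mod_cast (by omega : N + (N + 1) < 2 * N + 2)
  have key := fun m => coeff_eq_sum_of_mul_prod_eq (k := m) (Finset.range (2 * N + 2)) τ hinj h0
    (F := X ^ N * f) (H := H) (d := N + (c + N + 1)) hP' (by rw [hprod, mul_assoc, h]; ring)
  set w : ℕ → RatFunc ℚ := fun j => (X ^ N * P).eval (τ j)⁻¹ /
    ∏ i ∈ (Finset.range (2 * N + 2)).erase j, (1 - τ i * (τ j)⁻¹) with hw
  set L := P.eval (-1) / (∏ j ∈ Finset.range (2 * N + 1), (1 + q ^ ((j : ℤ) - N))) with hL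
  set M := P.eval (q ^ (-N : ℤ)) * (q ^ (N * c) * (1 - q) ^ (2 * N)) /
        ((1 + q ^ (-N : ℤ)) * ∏ j ∈ Finset.range (2 * N), (1 - q ^ ((j : ℤ) - 2 * N))) with hM
  have hwL : w (2 * N + 1) = (-1) ^ N * L := by
    simp only [hw, hL, τ2]
    rw [inv_neg_one, eval_mul, eval_pow, eval_X, mul_div_assoc, Finset.range_add_one,
      Finset.erase_insert (by simp)]
    congr 2
    refine Finset.prod_congr rfl fun j hj => ?_
    rw [τ1 j hj]
    ring
  set G : (RatFunc ℚ)[X] := ∑ j ∈ Finset.range (2 * N + 1), C (w j * q ^ (((j : ℤ) - N) * N)) * X ^ j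
    with hG
  have hGev : ∀ m < N + (c + N + 1), q ^ ((N : ℤ) * ((m : ℤ) - N)) * (X ^ N * f).coeff m =
      G.eval (q ^ ((m : ℤ) - N)) + L * ((-1) ^ ((m : ℤ) - N) * q ^ ((N : ℤ) * ((m : ℤ) - N))) := by
    intro m hm
    rw [key m hm, Finset.sum_range_succ, mul_add]
    congr 1
    · rw [hG, eval_finsetSum, Finset.mul_sum]
      refine Finset.sum_congr rfl fun j hj => ?_
      change _ * (w j * τ j ^ m) = _
      rw [τ1 j hj, eval_mul, eval_C, eval_pow, eval_X, ← zpow_natCast (q ^ _), ← zpow_natCast (q ^ _),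
        ← zpow_mul, ← zpow_mul, mul_left_comm, mul_assoc, ← zpow_add₀ q_ne_zero,
        ← zpow_add₀ q_ne_zero]
      congr 2
      ring
    · change _ * (w _ * τ _ ^ m) = _
      rw [hwL, τ2, zpow_sub₀ (by norm_num : (-1 : RatFunc ℚ) ≠ 0), zpow_natCast, zpow_natCast,
        div_eq_mul_inv, ← inv_pow, inv_neg_one]
      ring
  obtain ⟨U, hUdeg, hU⟩ := exists_Unc_eq_eval N c
  set W := qfacPoly 1 N * qfacPoly (-c - N) N with hW
  have hGtop : G.coeff (2 * N) = M * W.coeff (2 * N) := by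
    have e1 : G.coeff (2 * N) = w (2 * N) * q ^ (N * N) := by
      rw [hG, finsetSum_coeff, Finset.sum_eq_single_of_mem (2 * N) (by simp)]
      · rw [coeff_C_mul, coeff_X_pow_self, mul_one, ← zpow_natCast q (N * N)]
        congr 2
        push_cast
        ring
      · intro j _ hj
        rw [coeff_C_mul, coeff_X_pow, if_neg hj.symm, mul_zero]
    have e2 : (Finset.range (2 * N + 2)).erase (2 * N) = insert (2 * N + 1) (Finset.range (2 * N)) := by
      ext j
      simp
      omega
    have e3 : τ (2 * N) = q ^ N := by
      rw [τ1 _ (by simp), ← zpow_natCast]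
      congr 1
      push_cast
      ring
    have e4 : w (2 * N) * q ^ (N * N) = P.eval (q ^ (-N : ℤ)) /
        ((1 + q ^ (-N : ℤ)) * ∏ j ∈ Finset.range (2 * N), (1 - q ^ ((j : ℤ) - 2 * N))) := by
      simp only [hw]
      rw [e2, Finset.prod_insert (by simp), e3, τ2, eval_mul, eval_pow, eval_X, zpow_neg,
        zpow_natCast, neg_one_mul, sub_neg_eq_add, div_mul_eq_mul_div, inv_pow, ← pow_mul,
        mul_right_comm, inv_mul_cancel₀ (pow_ne_zero _ q_ne_zero), one_mul]
      congr 2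
      refine Finset.prod_congr rfl fun j hj => ?_
      rw [τ1 j (by simp at hj ⊢; omega), ← zpow_natCast, ← zpow_neg, ← zpow_add₀ q_ne_zero]
      congr 2
      ring
    have e5 := coeff_WncPoly N c
    rw [e1, e4, hM, hW]
    rw [div_mul_eq_mul_div]
    congr 1
    linear_combination -(P.eval (q ^ (-N : ℤ))) * e5
  have hD : G - C M * W - C L * U = 0 := by
    have hinj' : Set.InjOn (fun m : ℕ => q ^ ((m : ℤ) - N))
        (Finset.range N ∪ Finset.Ico (N + c + 1) (N + c + 1 + N) : Finset ℕ) := by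
      intro a _ b _ hab
      have := q_zpow_injective hab
      omega
    have hcard : (Finset.range N ∪ Finset.Ico (N + c + 1) (N + c + 1 + N)).card = 2 * N := by
      rw [Finset.card_union_of_disjoint]
      · simp
        omega
      · rw [Finset.disjoint_left]
        intro a
        simp
        omega
    refine Polynomial.eq_zero_of_degree_lt_of_eval_index_eq_zero _ hinj' ?_ ?_
    · rw [hcard]
      have hGdeg : G.natDegree ≤ 2 * N := by
        refine natDegree_sum_le_of_forall_le _ _ fun j hj => ?_
        rw [Finset.mem_range] at hj
        exact (natDegree_C_mul_X_pow_le _ _).trans (by omega)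
      have hWdeg : (C M * W).natDegree ≤ 2 * N := by
        refine (natDegree_C_mul_le _ _).trans (natDegree_mul_le.trans ?_)
        have := natDegree_qfacPoly_le 1 N
        have := natDegree_qfacPoly_le (-c - N) N
        omega
      refine (degree_sub_le _ _).trans_lt (max_lt ?_ ?_)
      · rw [degree_lt_iff_coeff_zero]
        intro m hm
        rcases hm.eq_or_lt with rfl | hm
        · rw [coeff_sub, coeff_C_mul, hGtop, sub_self]
        · rw [coeff_sub, coeff_eq_zero_of_natDegree_lt (hGdeg.trans_lt hm),
            coeff_eq_zero_of_natDegree_lt (hWdeg.trans_lt hm), sub_self]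
      · rw [← smul_eq_C_mul]
        exact (degree_smul_le _ _).trans_lt hUdeg
    · intro m hm
      simp only [Finset.mem_union, Finset.mem_range, Finset.mem_Ico] at hm
      have h1 := hGev m (by omega)
      have hU0 : Unc (N + 1) c ((m : ℤ) - N) = 0 := by
        rcases hm with hm | hm
        · rw [← Unc_eq_zero_left (N := N) (c := c) (i := N - m) (by omega) (by omega)]
          congr 1
          omega
        · rw [← Unc_eq_zero_right (N := N) (c := c) (i := m - N - c) (by omega) (by omega)]
          congr 1
          omega
      have hW0 : W.eval (q ^ ((m : ℤ) - N)) = 0 := by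
        rw [hW, ← Wnc_eq_eval, Wnc_eq_zero]
        omega
      have hf0 : (X ^ N * f).coeff m = 0 := by
        rw [coeff_X_pow_mul']
        split_ifs with h
        · exact coeff_eq_zero_of_natDegree_lt (by omega)
        · rfl
      rw [hU] at hU0
      rw [hf0, mul_zero] at h1
      rw [eval_sub, eval_sub, eval_mul (q := W), hW0, eval_mul, eval_C, eval_C]
      linear_combination -h1 - L * hU0
  have h1 := hGev (k + N) (by omega)
  have h2 := congrArg (fun p => eval (q ^ (k : ℤ)) p) hD
  simp only [eval_sub, eval_mul, eval_C, eval_zero] at h2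
  rw [coeff_X_pow_mul, Nat.cast_add, add_sub_cancel_right] at h1
  rw [Wnc_eq_eval, eval_mul, hU]
  rw [hW, eval_mul] at h2
  have h3 : q ^ (N * k) = q ^ ((N : ℤ) * k) := by
    rw [← zpow_natCast]; push_cast; rfl
  rw [h3]
  linear_combination h1 + h2

end Reconstruction

section Peeling

variable {R : Type*} [CommRing R]

theorem det_eq_of_row_eq_pow {k : ℕ} (A : Matrix (Fin (k + 1)) (Fin (k + 1)) R) (i₀ : Fin (k + 1))
    (a : R) (h : ∀ r, A i₀ r = a ^ (r : ℕ)) :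
    A.det = (-1) ^ (i₀ : ℕ) * (Matrix.of fun i r : Fin k =>
      A (i₀.succAbove i) r.succ - a * A (i₀.succAbove i) r.castSucc).det := by
  have h1 : A.det = (Matrix.of fun i (r : Fin (k + 1)) =>
      Fin.cases (motive := fun _ => R) (A i 0) (fun r => A i r.succ - a * A i r.castSucc) r).det := by
    refine Matrix.det_eq_of_forall_col_eq_smul_add_pred (fun _ => a) (fun i => rfl) fun i j => ?_
    simp
  rw [h1, Matrix.det_succ_row _ i₀, Fin.sum_univ_succ, Finset.sum_eq_zero, add_zero]
  · simp only [Matrix.of_apply, Fin.cases_zero, h, Fin.val_zero, pow_zero, add_zero, mul_one]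
    rfl
  · intro r _
    simp [h, pow_succ']

/-- The determinant with rows `x i ^ r - x i ^ (M - r)`, then `a ^ r`, then
`(-z) ^ (n + 1 - r) * w ^ r`. -/
def lowDet (n M : ℕ) (z w : R) (x : Fin n → R) (a : R) : R :=
  (Matrix.of fun i r : Fin (n + 2) => Fin.lastCases (motive := fun _ => R)
    ((-z) ^ (n + 1 - (r : ℕ)) * w ^ (r : ℕ))
    (fun i => Fin.lastCases (motive := fun _ => R) (a ^ (r : ℕ))
      (fun i => x i ^ (r : ℕ) - x i ^ (M - (r : ℕ))) i) i).det

theorem lowDet_zero_one (n M : ℕ) (x : Fin n → R) (a : R) :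
    lowDet n M 0 1 x a = thetaDet n M (-1) a x := by
  rw [lowDet, Matrix.det_succ_row _ (Fin.last (n + 1)), Fin.sum_univ_castSucc,
    Finset.sum_eq_zero, zero_add]
  · simp only [Fin.succAbove_last, Matrix.of_apply, Fin.lastCases_last, thetaDet]
    simp
    congr 1
    ext i r
    induction i using Fin.lastCases <;> simp
  · intro r _
    have := r.2
    simp [zero_pow (show n + 1 - (r : ℕ) ≠ 0 by omega)]

theorem succAbove_castSucc_last_last (n : ℕ) :
    (Fin.last n).castSucc.succAbove (Fin.last n) = Fin.last (n + 1) := by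
  simp [Fin.succAbove]

theorem succAbove_castSucc_last_castSucc {n : ℕ} (i : Fin n) :
    (Fin.last n).castSucc.succAbove i.castSucc = i.castSucc.castSucc := by
  simp [Fin.succAbove, Fin.lt_def]

theorem lowDet_neg_one (n M : ℕ) (hM : n + 1 ≤ M) (z w : R) (x : Fin n → R) :
    lowDet n M z w x (-1) =
      (-1) ^ n * (w - z) * (∏ i, (1 + x i)) * thetaDet n (M - 1) z w x := by
  rw [lowDet, det_eq_of_row_eq_pow _ (Fin.last n).castSucc (-1) (fun r => by simp), thetaDet]
  have h : (∏ i : Fin (n + 1), Fin.lastCases (motive := fun _ => R) (w - z) (fun i => 1 + x i) i) =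
      (w - z) * ∏ i, (1 + x i) := by
    rw [Fin.prod_univ_castSucc]
    simp [mul_comm]
  rw [mul_assoc, mul_assoc, ← mul_assoc (w - z), ← h, ← Matrix.det_mul_column]
  simp only [Fin.val_castSucc, Fin.val_last]
  congr 2
  ext i r
  have hr := r.2
  induction i using Fin.lastCases with
  | last =>
    simp only [Matrix.of_apply, succAbove_castSucc_last_last, Fin.lastCases_last, Fin.val_succ,
      Fin.val_castSucc]
    rw [show n + 1 - ((r : ℕ) + 1) = n - r by omega, show n + 1 - (r : ℕ) = n - r + 1 by omega]
    ring
  | cast i =>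
    simp only [Matrix.of_apply, succAbove_castSucc_last_castSucc, Fin.lastCases_castSucc,
      Fin.val_succ, Fin.val_castSucc]
    rw [show M - ((r : ℕ) + 1) = M - 1 - r by omega, show M - (r : ℕ) = M - 1 - r + 1 by omega]
    ring

theorem lowDet_snoc (n M : ℕ) (hM : n + 2 ≤ M) (z w : R) (x : Fin n → R) {y a : R} (hay : a * y = 1) :
    lowDet (n + 1) M z w (Fin.snoc x y : Fin (n + 1) → R) a =
      -((y - a) * (w + a * z) * (w + y * z) * (∏ i, (x i ^ 2 + 1 - (a + y) * x i)) *
        thetaDet n (M - 2) z w x) := by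
  have h1 : (∏ i : Fin (n + 2), Fin.lastCases (motive := fun _ => R) (w + a * z)
      (fun i => Fin.lastCases (motive := fun _ => R) (y - a) (fun _ => 1) i) i) =
      (y - a) * (w + a * z) := by
    rw [Fin.prod_univ_castSucc, Fin.prod_univ_castSucc]
    simp
  have h2 : (∏ i : Fin (n + 1), Fin.lastCases (motive := fun _ => R) (w + y * z)
      (fun i => x i ^ 2 + 1 - (a + y) * x i) i) =
      (w + y * z) * ∏ i, (x i ^ 2 + 1 - (a + y) * x i) := by
    rw [Fin.prod_univ_castSucc]
    simp [mul_comm]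
  have e1 : lowDet (n + 1) M z w (Fin.snoc x y : Fin (n + 1) → R) a =
      (-1) ^ (n + 1) * ((y - a) * (w + a * z) * (Matrix.of fun i r : Fin (n + 2) =>
        Fin.lastCases (motive := fun _ => R) ((-z) ^ (n + 1 - (r : ℕ)) * w ^ (r : ℕ))
          (fun i => Fin.lastCases (motive := fun _ => R) (y ^ (r : ℕ))
            (fun i => x i ^ (r : ℕ) * (x i - a) - x i ^ (M - 1 - (r : ℕ)) * (1 - a * x i)) i) i).det) := by
    rw [lowDet, det_eq_of_row_eq_pow _ (Fin.last (n + 1)).castSucc a (fun r => by simp), ← h1,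
      ← Matrix.det_mul_column]
    simp only [Fin.val_castSucc, Fin.val_last]
    congr 2
    ext i r
    have hr := r.2
    induction i using Fin.lastCases with
    | last =>
      simp only [Matrix.of_apply, succAbove_castSucc_last_last, Fin.lastCases_last, Fin.val_succ,
        Fin.val_castSucc]
      rw [show n + 1 + 1 - ((r : ℕ) + 1) = n + 1 - r by omega,
        show n + 1 + 1 - (r : ℕ) = n + 1 - r + 1 by omega]
      ring
    | cast i =>
      simp only [Matrix.of_apply, succAbove_castSucc_last_castSucc, Fin.lastCases_castSucc,
        Fin.val_succ, Fin.val_castSucc]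
      rw [show M - ((r : ℕ) + 1) = M - 1 - r by omega, show M - (r : ℕ) = M - 1 - r + 1 by omega]
      induction i using Fin.lastCases with
      | last =>
        simp only [Fin.lastCases_last, Fin.snoc_last]
        linear_combination y ^ (M - 1 - (r : ℕ)) * hay
      | cast i =>
        simp only [Fin.lastCases_castSucc, Fin.snoc_castSucc]
        ring
  rw [e1, det_eq_of_row_eq_pow _ (Fin.last n).castSucc y (fun r => by simp)]
  have e2 : (Matrix.of fun i r : Fin (n + 1) =>
      (Matrix.of fun i r : Fin (n + 2) =>
        Fin.lastCases (motive := fun _ => R) ((-z) ^ (n + 1 - (r : ℕ)) * w ^ (r : ℕ))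
          (fun i => Fin.lastCases (motive := fun _ => R) (y ^ (r : ℕ))
            (fun i => x i ^ (r : ℕ) * (x i - a) - x i ^ (M - 1 - (r : ℕ)) * (1 - a * x i)) i) i)
        ((Fin.last n).castSucc.succAbove i) r.succ - y * (Matrix.of fun i r : Fin (n + 2) =>
        Fin.lastCases (motive := fun _ => R) ((-z) ^ (n + 1 - (r : ℕ)) * w ^ (r : ℕ))
          (fun i => Fin.lastCases (motive := fun _ => R) (y ^ (r : ℕ))
            (fun i => x i ^ (r : ℕ) * (x i - a) - x i ^ (M - 1 - (r : ℕ)) * (1 - a * x i)) i) i)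
        ((Fin.last n).castSucc.succAbove i) r.castSucc).det =
      (w + y * z) * (∏ i, (x i ^ 2 + 1 - (a + y) * x i)) * thetaDet n (M - 2) z w x := by
    rw [← h2, thetaDet, ← Matrix.det_mul_column]
    congr 1
    ext i r
    have hr := r.2
    induction i using Fin.lastCases with
    | last =>
      simp only [Matrix.of_apply, succAbove_castSucc_last_last, Fin.lastCases_last, Fin.val_succ,
        Fin.val_castSucc]
      rw [show n + 1 - ((r : ℕ) + 1) = n - r by omega,
        show n + 1 - (r : ℕ) = n - r + 1 by omega]
      ring
    | cast i =>
      simp only [Matrix.of_apply, succAbove_castSucc_last_castSucc, Fin.lastCases_castSucc,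
        Fin.val_succ, Fin.val_castSucc]
      rw [show M - 1 - ((r : ℕ) + 1) = M - 2 - r by omega,
        show M - 1 - (r : ℕ) = M - 2 - r + 1 by omega]
      linear_combination (x i ^ (r : ℕ) - x i ^ 2 * x i ^ (M - 2 - (r : ℕ))) * hay
  rw [e2]
  have e3 : ((-1 : R) ^ n) * (-1) ^ n = 1 := by rw [← mul_pow]; simp
  rw [Fin.val_castSucc, Fin.val_last, pow_succ]
  linear_combination -((y - a) * (w + a * z) * (w + y * z) * (∏ i, (x i ^ 2 + 1 - (a + y) * x i)) *
        thetaDet n (M - 2) z w x) * e3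

end Peeling

section LagrangeDeterminant

open Polynomial

variable {K : Type*} [Field K]

theorem det_eval_monic_lastCases {n : ℕ} (Z : Fin (n + 1) → K) (hZ : Function.Injective Z)
    (p : Fin n → K[X]) (hp : ∀ i, (p i).Monic) (hdeg : ∀ i, (p i).natDegree = i)
    (y : Fin (n + 1) → K) :
    (Matrix.of fun i r : Fin (n + 1) => Fin.lastCases (motive := fun _ => K) (y r)
      (fun i => (p i).eval (Z r)) i).det =
      (∏ i, ∏ j ∈ Finset.Ioi i, (Z j - Z i)) *
        ∑ r, y r / ∏ s ∈ Finset.univ.erase r, (Z r - Z s) := by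
  set Y := Lagrange.interpolate Finset.univ Z y with hY
  have hYd : Y.degree < (n + 1 : ℕ) := by
    have := Lagrange.degree_interpolate_lt (s := Finset.univ) y hZ.injOn
    rwa [Finset.card_univ, Fintype.card_fin] at this
  have hYe : ∀ r, Y.eval (Z r) = y r := fun r =>
    Lagrange.eval_interpolate_at_node y hZ.injOn (Finset.mem_univ r)
  set P : Fin (n + 1) → K[X] := fun i => Fin.lastCases (motive := fun _ => K[X]) Y p i with hP
  have hPd : ∀ i, (P i).natDegree ≤ i := by
    intro i
    induction i using Fin.lastCases with
    | last =>
      simp only [hP, Fin.lastCases_last, Fin.val_last]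
      rw [natDegree_le_iff_degree_le, ← Order.lt_succ_iff]
      exact hYd
    | cast i =>
      simp [hP, hdeg]
  have e1 : (Matrix.of fun i r : Fin (n + 1) => Fin.lastCases (motive := fun _ => K) (y r)
      (fun i => (p i).eval (Z r)) i) = (Matrix.of fun i j => (P j).eval (Z i)).transpose := by
    ext i r
    induction i using Fin.lastCases <;> simp [hP, hYe]
  have e2 : (Matrix.of fun i j : Fin (n + 1) => (P j).coeff (i : ℕ)).det = Y.coeff n := by
    rw [Matrix.det_of_isUpperTriangular, Fin.prod_univ_castSucc]
    · simp only [Matrix.of_apply, hP, Fin.lastCases_castSucc, Fin.lastCases_last, Fin.val_last,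
        Fin.val_castSucc]
      rw [Finset.prod_eq_one, one_mul]
      intro i _
      have := (hp i).coeff_natDegree
      rwa [hdeg] at this
    · intro i j hij
      exact coeff_eq_zero_of_natDegree_lt ((hPd j).trans_lt hij)
  have e3 := Lagrange.coeff_eq_sum (s := Finset.univ) hZ.injOn (P := Y)
    (by rw [Finset.card_univ, Fintype.card_fin]; exact hYd)
  rw [e1, Matrix.det_transpose, Matrix.eval_matrixOfPolynomials_eq_vandermonde_mul_matrixOfPolynomials _ _ hPd,
    Matrix.det_mul, e2, Matrix.det_vandermonde]
  rw [Finset.card_univ, Fintype.card_fin, Nat.add_sub_cancel] at e3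
  rw [e3]
  simp only [hYe]

theorem monic_dickson_two (a : K) : ∀ n, (dickson 2 a n).Monic ∧ (dickson 2 a n).natDegree = n
  | 0 => by
    rw [dickson_zero]
    norm_num
  | 1 => by
    rw [dickson_one]
    exact ⟨monic_X, natDegree_X⟩
  | n + 2 => by
    have h1 := monic_dickson_two a (n + 1)
    have h0 := monic_dickson_two a n
    rw [dickson_add_two]
    have hm : (X * dickson 2 a (n + 1)).Monic := monic_X.mul h1.1
    have hd : (X * dickson 2 a (n + 1)).natDegree = n + 2 := by
      rw [monic_X.natDegree_mul h1.1, natDegree_X, h1.2]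
      ring
    have hlt : (C a * dickson 2 a n).natDegree < (X * dickson 2 a (n + 1)).natDegree := by
      have := natDegree_C_mul_le a (dickson 2 a n)
      omega
    exact ⟨hm.sub_of_left (degree_lt_degree hlt),
      by rw [natDegree_sub_eq_left_of_natDegree_lt hlt, hd]⟩

theorem sub_mul_eval_dickson_two (a b : K) :
    ∀ n, (a - b) * (dickson 2 (a * b) n).eval (a + b) = a ^ (n + 1) - b ^ (n + 1)
  | 0 => by
    rw [dickson_zero]
    norm_num
  | 1 => by
    rw [dickson_one, eval_X]
    ring
  | n + 2 => by
    have h1 := sub_mul_eval_dickson_two a b (n + 1)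
    have h0 := sub_mul_eval_dickson_two a b n
    rw [dickson_add_two, eval_sub, eval_mul, eval_mul, eval_X, eval_C]
    linear_combination (a + b) * h1 - (a * b) * h0

theorem thetaDet_pow (t : K) {n M : ℕ} (hM : n ≤ M) (z w : K)
    (hd : ∀ r : Fin (n + 1), t ^ (r : ℕ) - t ^ (M - (r : ℕ)) ≠ 0)
    (hZ : Function.Injective fun r : Fin (n + 1) => t ^ (r : ℕ) + t ^ (M - (r : ℕ))) :
    thetaDet n M z w (fun i => t ^ ((i : ℕ) + 1)) =
      ((∏ r : Fin (n + 1), (t ^ (r : ℕ) - t ^ (M - (r : ℕ)))) *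
        ∏ i : Fin (n + 1), ∏ j ∈ Finset.Ioi i,
          ((t ^ (j : ℕ) + t ^ (M - (j : ℕ))) - (t ^ (i : ℕ) + t ^ (M - (i : ℕ))))) *
        ∑ r : Fin (n + 1), (-z) ^ (n - (r : ℕ)) * w ^ (r : ℕ) /
          ((t ^ (r : ℕ) - t ^ (M - (r : ℕ))) * ∏ s ∈ Finset.univ.erase r,
            ((t ^ (r : ℕ) + t ^ (M - (r : ℕ))) - (t ^ (s : ℕ) + t ^ (M - (s : ℕ))))) := by
  have h := det_eval_monic_lastCases (fun r : Fin (n + 1) => t ^ (r : ℕ) + t ^ (M - (r : ℕ))) hZ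
    (fun i => dickson 2 (t ^ M) i) (fun i => (monic_dickson_two _ _).1)
    (fun i => (monic_dickson_two _ _).2)
    (fun r => (-z) ^ (n - (r : ℕ)) * w ^ (r : ℕ) / (t ^ (r : ℕ) - t ^ (M - (r : ℕ))))
  simp only [div_div] at h
  rw [mul_assoc, ← h, ← Matrix.det_mul_row, thetaDet]
  congr 1
  ext i r
  have hr := r.2
  induction i using Fin.lastCases with
  | last =>
    simp only [Matrix.of_apply, Fin.lastCases_last]
    rw [mul_div_cancel₀ _ (hd r)]
  | cast i =>
    simp only [Matrix.of_apply, Fin.lastCases_castSucc]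
    rw [show t ^ M = t ^ (r : ℕ) * t ^ (M - (r : ℕ)) by rw [← pow_add]; congr 1; omega,
      sub_mul_eval_dickson_two]
    ring

end LagrangeDeterminant

section Specialization

theorem prod_one_sub_q_pow (a m : ℕ) :
    ∏ i ∈ range m, (1 - q ^ (a + i)) = (1 - q) ^ m * qfac a m := by
  induction m with
  | zero => simp
  | succ m ih =>
    rw [prod_range_succ, ih, qfac_succ, qb, pow_succ,
      show (a : ℤ) + m = (a + m : ℕ) by push_cast; ring, zpow_natCast]
    have := one_sub_q_ne_zero
    field_simp

theorem prod_sub_smul {R : Type*} [CommRing R] (a : R) {n : ℕ} (x : Fin n → R) :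
    ∏ i, ∏ j ∈ Ioi i, (a * x j - a * x i) =
      a ^ (n * (n - 1) / 2) * ∏ i, ∏ j ∈ Ioi i, (x j - x i) := by
  induction n with
  | zero => simp
  | succ n ih =>
    rw [Fin.prod_univ_succ, Fin.prod_univ_succ]
    simp only [Fin.prod_Ioi_zero, Fin.prod_Ioi_succ]
    rw [ih (fun i => x i.succ), Nat.add_sub_cancel, triangle_succ, pow_add]
    simp only [← mul_sub, prod_mul_distrib, prod_const, card_univ, Fintype.card_fin]
    ring

theorem prod_sub_succ {R : Type*} [CommRing R] {n : ℕ} (x : Fin (n + 1) → R) :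
    ∏ i, ∏ j ∈ Ioi i, (x j - x i) =
      (∏ j : Fin n, (x j.succ - x 0)) * ∏ i, ∏ j ∈ Ioi i, (x (Fin.succ j) - x (Fin.succ i)) := by
  rw [Fin.prod_univ_succ]
  simp only [Fin.prod_Ioi_zero, Fin.prod_Ioi_succ]

/-- The product of the differences and of the `1 - x i * x j` at `x i = q ^ (i + 1)`. -/
noncomputable def qDenom (N : ℕ) : RatFunc ℚ :=
  (∏ i : Fin N, ∏ j ∈ Ioi i, (q ^ ((j : ℕ) + 1) - q ^ ((i : ℕ) + 1))) *
    symProd N (fun i => q ^ ((i : ℕ) + 1))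

theorem prod_q_pow_sub_one (m : ℕ) :
    ∏ i ∈ range m, (q ^ (i + 1) - 1) = (-1) ^ m * (1 - q) ^ m * qfac 1 m := by
  have h := prod_one_sub_q_pow 1 m
  rw [Nat.cast_one] at h
  rw [mul_assoc, ← h, ← card_range m, ← prod_const, card_range, ← prod_mul_distrib]
  exact prod_congr rfl fun i _ => by rw [add_comm]; ring

theorem qDenom_zero : qDenom 0 = 1 := by simp [qDenom, symProd]

theorem qDenom_succ (N : ℕ) : qDenom (N + 1) = qDenom N * (q ^ ((N + 1) * N / 2) *
    (-1) ^ N * (1 - q) ^ (2 * N + 1) * qfac 1 N * qfac (N + 2) (N + 1)) := by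
  rw [qDenom, symProd_succAbove _ (Fin.last N), prod_sub_succ (fun i : Fin (N + 1) => q ^ ((i : ℕ) + 1))]
  simp only [Fin.val_succ, Fin.val_last, Fin.succAbove_last, Fin.val_castSucc, Fin.val_zero]
  have h1 : ∏ j : Fin N, (q ^ ((j : ℕ) + 1 + 1) - q ^ (0 + 1)) =
      q ^ N * ((-1) ^ N * (1 - q) ^ N * qfac 1 N) := by
    rw [← prod_q_pow_sub_one, Fin.prod_univ_eq_prod_range (fun j => q ^ (j + 1 + 1) - q ^ (0 + 1)),
      ← card_range N, ← prod_const, card_range, ← prod_mul_distrib]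
    exact prod_congr rfl fun i _ => by ring
  have h2 : ∏ j : Fin (N + 1), (1 - q ^ (N + 1) * q ^ ((j : ℕ) + 1)) =
      (1 - q) ^ (N + 1) * qfac (N + 2) (N + 1) := by
    have := prod_one_sub_q_pow (N + 2) (N + 1)
    push_cast at this
    rw [← this, Fin.prod_univ_eq_prod_range (fun j => 1 - q ^ (N + 1) * q ^ (j + 1))]
    exact prod_congr rfl fun i _ => by ring
  have h3 : ∏ i : Fin N, ∏ j ∈ Ioi i, (q ^ ((j : ℕ) + 1 + 1) - q ^ ((i : ℕ) + 1 + 1)) =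
      q ^ (N * (N - 1) / 2) * ∏ i : Fin N, ∏ j ∈ Ioi i, (q ^ ((j : ℕ) + 1) - q ^ ((i : ℕ) + 1)) := by
    rw [← prod_sub_smul]
    simp only [pow_succ' q]
  rw [h1, h2, h3, qDenom, triangle_succ, pow_add q]
  ring

/-- The product of the `[a + 2i; q]_{N + 1 - i}` over `1 ≤ i ≤ N`. -/
noncomputable def qTower (a : ℤ) (N : ℕ) : RatFunc ℚ := ∏ i ∈ range N, qfac (a + i + 2) (i + 1)

theorem qTower_succ (a : ℤ) (N : ℕ) :
    qTower a (N + 1) = qTower a N * qfac (a + N + 2) (N + 1) := prod_range_succ _ _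

theorem qTower_ne_zero {a : ℤ} (ha : 0 ≤ a) (N : ℕ) : qTower a N ≠ 0 :=
  prod_ne_zero_iff.2 fun i _ => qfac_ne_zero (by omega) _

theorem qTower_succ' (a : ℤ) (N : ℕ) :
    qTower a (N + 1) = qfac (a + 2) (N + 1) * qTower (a + 2) N := by
  induction N with
  | zero => simp [qTower]
  | succ N ih =>
    rw [qTower_succ, ih, qTower_succ (a + 2), qfac_succ (a + 2) (N + 1), qfac_succ' _ (N + 1)]
    push_cast
    rw [show a + (N + 1) + 2 + 1 = a + 2 + N + 2 by ring, show a + (N + 1 : ℤ) + 2 = a + 2 + (N + 1) by ring]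
    ring

theorem prod_Icc_eq_qTower (a : ℤ) (N : ℕ) :
    ∏ i ∈ Icc 1 N, qfac (a + 2 * i) (N + 1 - i) = qTower a N := by
  induction N generalizing a with
  | zero => simp [qTower]
  | succ N ih =>
    rw [qTower_succ', ← ih (a + 2), ← Finset.Ico_succ_right_eq_Icc, ← Finset.Ico_succ_right_eq_Icc,
      prod_Ico_eq_prod_range, prod_Ico_eq_prod_range]
    simp only [Order.succ_eq_add_one, Nat.add_sub_cancel]
    rw [prod_range_succ', mul_comm]
    congr 1
    refine prod_congr rfl fun i _ => ?_
    congr 1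
    · push_cast; ring
    · omega

theorem add_sub_add_pow {K : Type*} [CommRing K] (t : K) {r s M : ℕ} (h : r + s ≤ M) :
    (t ^ r + t ^ (M - r)) - (t ^ s + t ^ (M - s)) = (t ^ r - t ^ s) * (1 - t ^ (M - r - s)) := by
  obtain ⟨d, rfl⟩ := Nat.exists_eq_add_of_le h
  rw [show r + s + d - r = s + d by omega, show r + s + d - s = r + d by omega,
    show s + d - s = d by omega, pow_add, pow_add]
  ring

/-- The prefactor of the Lagrange expansion of `thetaDet` at powers of `q`. -/
noncomputable def qNumer (N M : ℕ) : RatFunc ℚ :=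
  (∏ r : Fin (N + 1), (q ^ (r : ℕ) - q ^ (M - (r : ℕ)))) *
    ∏ i : Fin (N + 1), ∏ j ∈ Ioi i,
      ((q ^ (j : ℕ) + q ^ (M - (j : ℕ))) - (q ^ (i : ℕ) + q ^ (M - (i : ℕ))))

theorem qNumer_succ (N e : ℕ) : qNumer (N + 1) (e + 2 * (N + 1)) =
    (1 - q) ^ (2 * N + 3) * (-1) ^ (N + 1) * qfac 1 (N + 1) * qfac (e + N + 1) (N + 2) *
      q ^ ((N + 2) * (N + 1) / 2) * qNumer N (e + 2 * N) := by
  rw [qNumer, prod_sub_succ (fun r : Fin (N + 2) => q ^ (r : ℕ) + q ^ (e + 2 * (N + 1) - (r : ℕ))),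
    Fin.prod_univ_succ]
  simp only [Fin.val_succ, Fin.val_zero, pow_zero, Nat.sub_zero]
  have h1 : ∏ r : Fin (N + 1), (q ^ ((r : ℕ) + 1) - q ^ (e + 2 * (N + 1) - ((r : ℕ) + 1))) =
      q ^ (N + 1) * ∏ r : Fin (N + 1), (q ^ (r : ℕ) - q ^ (e + 2 * N - (r : ℕ))) := by
    rw [← Fintype.card_fin (N + 1), ← card_univ, ← prod_const, card_univ, Fintype.card_fin,
      ← prod_mul_distrib]
    refine prod_congr rfl fun r _ => ?_
    have := r.2
    rw [show e + 2 * (N + 1) - ((r : ℕ) + 1) = e + 2 * N - r + 1 by omega]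
    ring
  have h2 : ∏ i : Fin (N + 1), ∏ j ∈ Ioi i,
      (q ^ ((j : ℕ) + 1) + q ^ (e + 2 * (N + 1) - ((j : ℕ) + 1)) -
        (q ^ ((i : ℕ) + 1) + q ^ (e + 2 * (N + 1) - ((i : ℕ) + 1)))) =
      q ^ ((N + 1) * N / 2) * ∏ i : Fin (N + 1), ∏ j ∈ Ioi i,
      ((q ^ (j : ℕ) + q ^ (e + 2 * N - (j : ℕ))) - (q ^ (i : ℕ) + q ^ (e + 2 * N - (i : ℕ)))) := by
    have := prod_sub_smul q (fun r : Fin (N + 1) => q ^ (r : ℕ) + q ^ (e + 2 * N - (r : ℕ)))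
    rw [Nat.add_sub_cancel] at this
    rw [← this]
    have h : ∀ r : Fin (N + 1), q ^ ((r : ℕ) + 1) + q ^ (e + 2 * (N + 1) - ((r : ℕ) + 1)) =
        q * (q ^ (r : ℕ) + q ^ (e + 2 * N - (r : ℕ))) := fun r => by
      have := r.2
      rw [show e + 2 * (N + 1) - ((r : ℕ) + 1) = e + 2 * N - r + 1 by omega]
      ring
    simp only [h]
  have h3 : (1 - q ^ (e + 2 * (N + 1))) * ∏ j : Fin (N + 1),
      (q ^ ((j : ℕ) + 1) + q ^ (e + 2 * (N + 1) - ((j : ℕ) + 1)) - (1 + q ^ (e + 2 * (N + 1)))) =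
      (1 - q) ^ (2 * N + 3) * (-1) ^ (N + 1) * qfac 1 (N + 1) * qfac (e + N + 1) (N + 2) := by
    have h := prod_one_sub_q_pow (e + N + 1) (N + 2)
    push_cast at h
    calc _ = (1 - q ^ (e + N + 1 + (N + 1))) * ∏ j ∈ range (N + 1),
          ((q ^ (j + 1) - 1) * (1 - q ^ (e + N + 1 + (N + 1 - 1 - j)))) := by
          rw [show e + 2 * (N + 1) = e + N + 1 + (N + 1) by ring, ← Fin.prod_univ_eq_prod_range]
          congr 1
          refine prod_congr rfl fun j _ => ?_
          have hj := j.2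
          have := add_sub_add_pow q (r := j + 1) (s := 0) (M := e + N + 1 + (N + 1)) (by omega)
          rw [pow_zero, Nat.sub_zero, Nat.sub_zero] at this
          rw [this, show e + N + 1 + (N + 1) - ((j : ℕ) + 1) = e + N + 1 + (N + 1 - 1 - j) by omega]
      _ = (∏ j ∈ range (N + 1), (q ^ (j + 1) - 1)) *
          ∏ j ∈ range (N + 2), (1 - q ^ (e + N + 1 + j)) := by
          rw [prod_mul_distrib, prod_range_reflect (fun j => 1 - q ^ (e + N + 1 + j)),
            prod_range_succ (fun j => 1 - q ^ (e + N + 1 + j)) (N + 1)]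
          ring
      _ = _ := by
          rw [h, prod_q_pow_sub_one]
          ring
  rw [h1, h2, ← h3, qNumer, triangle_succ (N + 1), pow_add q, Nat.add_sub_cancel]
  ring

theorem qNumer_mul_qTower (N e : ℕ) : qNumer N (e + 2 * N) * qTower 0 N =
    (1 - q) ^ (2 * N + 1) * (-1) ^ N * qfac 1 N * q ^ ((N + 1) * N / 2) *
      (qDenom N * qfac e (N + 1) * qTower e N) := by
  induction N with
  | zero =>
    have := one_sub_q_ne_zero
    simp [qNumer, qTower, qDenom_zero, qfac, qb]
    field_simp
  | succ N ih =>
    have h3 := qfac_succ e (N + 1)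
    have h4 := qfac_succ' (e + N + 1) (N + 1)
    push_cast at h3 h4
    rw [qTower_succ, qTower_succ, qNumer_succ, qDenom_succ]
    rw [show (e : ℤ) + N + 1 + 1 = e + N + 2 by ring] at h4
    rw [show (e : ℤ) + (N + 1) = e + N + 1 by ring] at h3
    rw [zero_add, h3, h4, show 2 * (N + 1) + 1 = 2 * N + 3 by ring]
    linear_combination ((1 - q) ^ (2 * N + 3) * (-1) ^ (N + 1) * qfac 1 (N + 1) *
      (qb (e + N + 1) * qfac (e + N + 2) (N + 1)) * q ^ ((N + 2) * (N + 1) / 2) *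
      qfac (N + 2) (N + 1)) * ih

theorem prod_range_erase {K : Type*} [CommMonoid K] (f : ℕ → K) (r m : ℕ) :
    ∏ s ∈ (range (r + m + 1)).erase r, f s =
      (∏ s ∈ range r, f s) * ∏ s ∈ range m, f (r + 1 + s) := by
  induction m with
  | zero => simp [range_add_one]
  | succ m ih =>
    rw [prod_range_succ, ← mul_assoc, ← ih, ← add_assoc r, range_add_one (n := r + m + 1),
      erase_insert_of_ne (by omega), prod_insert (by simp), mul_comm,
      show r + 1 + m = r + m + 1 by ring]

theorem prod_q_pow_sub_q_pow (r : ℕ) : ∏ s ∈ range r, (q ^ r - q ^ s) =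
    (-1) ^ r * q ^ (r * (r - 1) / 2) * (1 - q) ^ r * qfac 1 r := by
  induction r with
  | zero => simp
  | succ r ih =>
    have h : ∏ s ∈ range r, (q ^ (r + 1) - q ^ (s + 1)) = q ^ r * ∏ s ∈ range r, (q ^ r - q ^ s) := by
      simp only [pow_succ' q, ← mul_sub]
      rw [prod_mul_distrib, prod_const, card_range]
    have hr := prod_q_pow_sub_one (r + 1)
    rw [prod_range_succ, prod_q_pow_sub_one] at hr
    have h1 : q ^ (r + 1) - 1 = - ((1 - q) * qb (r + 1)) := by
      have := one_sub_q_ne_zero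
      rw [qb, ← Nat.cast_succ, zpow_natCast]
      field_simp
      ring
    rw [prod_range_succ', h, ih, pow_zero, h1, qfac_succ, Nat.add_sub_cancel, triangle_succ, pow_add q,
      add_comm (1 : ℤ)]
    ring

theorem prod_q_pow_sub_q_pow_add (r m : ℕ) : ∏ s ∈ range m, (q ^ r - q ^ (r + 1 + s)) =
    q ^ (r * m) * (1 - q) ^ m * qfac 1 m := by
  have h := prod_one_sub_q_pow 1 m
  rw [Nat.cast_one] at h
  rw [mul_assoc, ← h, pow_mul, ← card_range m, ← prod_const, card_range, ← prod_mul_distrib]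
  exact prod_congr rfl fun s _ => by ring

theorem lagrange_denom (e r m : ℕ) :
    (q ^ r - q ^ (e + 2 * (r + m) - r)) * ∏ s ∈ (range (r + m + 1)).erase r,
      ((q ^ r + q ^ (e + 2 * (r + m) - r)) - (q ^ s + q ^ (e + 2 * (r + m) - s))) =
    (-1) ^ r * q ^ (r + r * (r - 1) / 2 + r * m) * (1 - q) ^ (2 * (r + m) + 1) *
      qfac 1 r * qfac 1 m * qfac (e + m) (r + m + 1) := by
  have h1 : ∏ s ∈ (range (r + m + 1)).erase r,
      ((q ^ r + q ^ (e + 2 * (r + m) - r)) - (q ^ s + q ^ (e + 2 * (r + m) - s))) =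
      (∏ s ∈ (range (r + m + 1)).erase r, (q ^ r - q ^ s)) *
      ∏ s ∈ (range (r + m + 1)).erase r, (1 - q ^ (e + 2 * (r + m) - r - s)) := by
    rw [← prod_mul_distrib]
    refine prod_congr rfl fun s hs => add_sub_add_pow q ?_
    have := mem_range.1 (mem_of_mem_erase hs)
    omega
  have h2 : q ^ r - q ^ (e + 2 * (r + m) - r) = q ^ r * (1 - q ^ (e + 2 * (r + m) - r - r)) := by
    rw [mul_sub, ← pow_add, mul_one]
    congr 2
    omega
  have h3 : ∏ s ∈ range (r + m + 1), (1 - q ^ (e + 2 * (r + m) - r - s)) =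
      (1 - q) ^ (r + m + 1) * qfac (e + m) (r + m + 1) := by
    have h := prod_one_sub_q_pow (e + m) (r + m + 1)
    push_cast at h
    rw [← h, ← prod_range_reflect]
    refine prod_congr rfl fun s hs => ?_
    have := mem_range.1 hs
    congr 2
    omega
  rw [h1, h2, prod_range_erase, prod_q_pow_sub_q_pow, prod_q_pow_sub_q_pow_add]
  have h4 := mul_prod_erase (range (r + m + 1)) (fun s => 1 - q ^ (e + 2 * (r + m) - r - s))
    (a := r) (mem_range.2 (by omega))
  rw [h3] at h4
  linear_combination (q ^ r * ((-1) ^ r * q ^ (r * (r - 1) / 2) * (1 - q) ^ r * qfac 1 r *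
    (q ^ (r * m) * (1 - q) ^ m * qfac 1 m))) * h4

theorem qfac_add (a : ℤ) (m k : ℕ) : qfac a (m + k) = qfac a m * qfac (a + m) k := by
  induction k with
  | zero => simp
  | succ k ih =>
    rw [← add_assoc, qfac_succ, ih, qfac_succ, Nat.cast_add, mul_assoc, add_assoc a]

theorem binq_mul (r m : ℕ) : binq (r + m : ℕ) m * (qfac 1 m * qfac 1 r) = qfac 1 (r + m) := by
  have := qfac_ne_zero (a := 1) (by norm_num) m
  rw [binq, if_pos ⟨by omega, by omega⟩, qfac_add, Int.toNat_natCast,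
    show ((r + m : ℕ) : ℤ) - m + 1 = 1 + r by push_cast; ring]
  field_simp

theorem prod_univ_erase_fin {K : Type*} [CommMonoid K] {k : ℕ} (f : ℕ → K) (r : Fin k) :
    ∏ s ∈ univ.erase r, f s = ∏ s ∈ (range k).erase r, f s := by
  refine prod_nbij (fun s => (s : ℕ)) (fun s hs => ?_) (fun s _ t _ h => Fin.ext h)
    (fun s hs => ?_) (fun s _ => rfl)
  · exact mem_erase.2 ⟨fun h => (mem_erase.1 hs).1 (Fin.ext h), mem_range.2 s.2⟩
  · obtain ⟨h1, h2⟩ := mem_erase.1 (mem_coe.1 hs)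
    exact ⟨⟨s, mem_range.1 h2⟩, mem_coe.2 (mem_erase.2 ⟨fun h => h1 (congrArg Fin.val h), mem_univ _⟩), rfl⟩

/-- The `q`-binomial coefficient `binq N p` weighted by `q ^ (p * (p + 1) / 2)`. -/
noncomputable def qBinom (N p : ℕ) : RatFunc ℚ := q ^ ((p + 1) * p / 2) * binq N p

theorem thetaDet_q (N e : ℕ) (he : 0 < e) (z w : RatFunc ℚ) :
    thetaDet N (e + 2 * N) z w (fun i => q ^ ((i : ℕ) + 1)) * qTower 0 N =
      qDenom N * qfac e (N + 1) * qTower e N *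
        ∑ p ∈ range (N + 1), z ^ p * w ^ (N - p) * (qBinom N p / qfac (e + p) (N + 1)) := by
  have hne : ∀ a : ℕ, 0 < a → 1 - q ^ a ≠ 0 := fun a ha =>
    sub_ne_zero.2 (q_pow_ne_one ha.ne').symm
  rw [thetaDet_pow q (by omega) z w, ← qNumer, mul_right_comm, qNumer_mul_qTower]
  · simp only [fun r : Fin (N + 1) => prod_univ_erase_fin (fun s =>
      (q ^ (r : ℕ) + q ^ (e + 2 * N - (r : ℕ))) - (q ^ s + q ^ (e + 2 * N - s))) r]
    rw [Fin.sum_univ_eq_sum_range (fun r => (-z) ^ (N - r) * w ^ r /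
          ((q ^ r - q ^ (e + 2 * N - r)) * ∏ s ∈ (range (N + 1)).erase r,
            ((q ^ r + q ^ (e + 2 * N - r)) - (q ^ s + q ^ (e + 2 * N - s))))),
    ← sum_range_reflect, mul_sum, mul_sum]
    refine sum_congr rfl fun p hp => ?_
    obtain ⟨r, rfl⟩ := Nat.exists_eq_add_of_le' (Nat.lt_succ_iff.1 (mem_range.1 hp))
    rw [show r + p + 1 - 1 - p = r by omega, show r + p - r = p by omega, show r + p - p = r by omega]
    rw [lagrange_denom, ← binq_mul r p, qBinom]
    have h1 := qfac_ne_zero (a := 1) (by norm_num) r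
    have h2 := qfac_ne_zero (a := 1) (by norm_num) p
    have h3 := qfac_ne_zero (a := e + p) (by omega) (r + p + 1)
    have h4 := one_sub_q_ne_zero
    have h5 := q_ne_zero
    have h6 : (r + p + 1) * (r + p) / 2 = (p + 1) * p / 2 + (r + r * (r - 1) / 2 + r * p) := by
      have := triangle_mul_two (r + p)
      have := triangle_mul_two p
      have := triangle_mul_two r
      rw [triangle_succ r] at this
      nlinarith
    rw [h6, pow_add q ((p + 1) * p / 2), pow_add (-1 : RatFunc ℚ), neg_pow z]
    field_simp
    rw [← pow_mul, pow_mul', neg_one_sq, one_pow, one_mul]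
  · intro r
    have hr := r.2
    rw [show e + 2 * N - (r : ℕ) = r + (e + 2 * (N - r)) by omega, pow_add]
    have h := mul_ne_zero (pow_ne_zero (r : ℕ) q_ne_zero) (hne (e + 2 * (N - r)) (by omega))
    rwa [mul_sub, mul_one] at h
  · intro r s h
    have hr := r.2
    have hs := s.2
    have h1 := add_sub_add_pow q (r := r) (s := s) (M := e + 2 * N) (by omega)
    simp only at h
    rw [h, sub_self, zero_eq_mul, sub_eq_zero] at h1
    refine Fin.ext (Nat.cast_injective (R := ℤ) (q_zpow_injective ?_))
    simp only [zpow_natCast]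
    exact h1.resolve_right (hne _ (by omega))

theorem qBinom_zero (N : ℕ) : qBinom N 0 = 1 := by
  simp [qBinom, binq]

theorem thetaDet_q_zero_one (N e : ℕ) (he : 0 < e) :
    thetaDet N (e + 2 * N) 0 1 (fun i => q ^ ((i : ℕ) + 1)) * qTower 0 N =
      qDenom N * qTower e N := by
  rw [thetaDet_q N e he, sum_range_succ', sum_eq_zero fun p _ => by rw [zero_pow (by omega)]; ring,
    qBinom_zero]
  have h3 := qfac_ne_zero (a := e) (by omega) (N + 1)
  simp
  field_simp

end Specialization

section LastVariable

open Polynomial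

variable {R : Type*} [CommRing R]

theorem prod_sub_snoc {n : ℕ} (x : Fin n → R) (y : R) :
    ∏ i : Fin (n + 1), ∏ j ∈ Ioi i, ((Fin.snoc x y : Fin (n + 1) → R) j -
      (Fin.snoc x y : Fin (n + 1) → R) i) =
      (∏ i, (y - x i)) * ∏ i, ∏ j ∈ Ioi i, (x j - x i) := by
  induction n with
  | zero => simp
  | succ n ih =>
    have h : ∀ i : Fin (n + 1), (Fin.snoc x y : Fin (n + 2) → R) i.succ =
        (Fin.snoc (fun i => x i.succ) y : Fin (n + 1) → R) i := by
      intro i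
      induction i using Fin.lastCases with
      | last => rw [Fin.succ_last, Fin.snoc_last, Fin.snoc_last]
      | cast i => rw [Fin.snoc_castSucc, Fin.succ_castSucc, Fin.snoc_castSucc]
    have h0 : (Fin.snoc x y : Fin (n + 2) → R) 0 = x 0 := by
      rw [← Fin.castSucc_zero, Fin.snoc_castSucc]
    rw [prod_sub_succ, prod_sub_succ x]
    simp only [h, h0, ih]
    rw [Fin.prod_univ_castSucc, Fin.prod_univ_succ fun i => y - x i]
    simp only [Fin.snoc_castSucc, Fin.snoc_last]
    ring

theorem symProd_snoc {n : ℕ} (x : Fin n → R) (y : R) :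
    symProd (n + 1) (Fin.snoc x y : Fin (n + 1) → R) =
      (1 - y ^ 2) * (∏ i, (1 - y * x i)) * symProd n x := by
  rw [symProd_succAbove _ (Fin.last n), Fin.prod_univ_castSucc]
  simp only [Fin.succAbove_last, Fin.snoc_castSucc, Fin.snoc_last]
  ring

theorem exists_det_eq_sub {k : ℕ} (A : Matrix (Fin k) (Fin k) R) (i : Fin k) (u v : Fin k → R) (s : R)
    (h : ∀ r, A i r = u r - s * v r) : ∃ H, A.det = (A.updateRow i u).det - s * H := by
  refine ⟨(A.updateRow i v).det, ?_⟩
  rw [← Matrix.det_updateRow_smul, eq_sub_iff_add_eq]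
  nth_rw 1 [← Matrix.updateRow_eq_self A i]
  rw [← Matrix.det_updateRow_add]
  congr 2
  ext r
  simp [h]

theorem exists_thetaDet_snoc {n M d : ℕ} (hM : d + (n + 1) ≤ M) (z w : R) (x : Fin n → R) (y : R) :
    ∃ H, thetaDet (n + 1) M z w (Fin.snoc x y : Fin (n + 1) → R) =
      lowDet n M z w x y - y ^ d * H := by
  obtain ⟨H, hH⟩ := exists_det_eq_sub (Matrix.of fun i r : Fin (n + 2) =>
    Fin.lastCases (motive := fun _ => R) ((-z) ^ (n + 1 - (r : ℕ)) * w ^ (r : ℕ))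
    (fun i => (Fin.snoc x y : Fin (n + 1) → R) i ^ (r : ℕ) -
      (Fin.snoc x y : Fin (n + 1) → R) i ^ (M - (r : ℕ))) i) (Fin.last n).castSucc
    (fun r => y ^ (r : ℕ)) (fun r => y ^ (M - d - (r : ℕ))) (y ^ d) (fun r => by
      have := r.2
      rw [← pow_add, show d + (M - d - (r : ℕ)) = M - r by omega]
      simp)
  refine ⟨H, ?_⟩
  rw [thetaDet, hH, lowDet]
  congr 2
  ext i r
  induction i using Fin.lastCases with
  | last => simp [Matrix.updateRow_apply, Fin.ext_iff]
  | cast i =>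
    induction i using Fin.lastCases with
    | last => simp
    | cast i => simp [Matrix.updateRow_apply, Fin.ext_iff, i.2.ne]

theorem exists_thetaDet₀_snoc {n M d : ℕ} (hM : d + n ≤ M) (x : Fin n → R) (y : R) :
    ∃ H, thetaDet₀ (n + 1) M (Fin.snoc x y : Fin (n + 1) → R) =
      thetaDet n M (-1) y x - y ^ d * H := by
  obtain ⟨H, hH⟩ := exists_det_eq_sub (Matrix.of fun i r : Fin (n + 1) =>
    (Fin.snoc x y : Fin (n + 1) → R) i ^ (r : ℕ) -
      (Fin.snoc x y : Fin (n + 1) → R) i ^ (M - (r : ℕ))) (Fin.last n)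
    (fun r => y ^ (r : ℕ)) (fun r => y ^ (M - d - (r : ℕ))) (y ^ d) (fun r => by
      have := r.2
      rw [← pow_add, show d + (M - d - (r : ℕ)) = M - r by omega]
      simp)
  refine ⟨H, ?_⟩
  rw [thetaDet₀, hH, thetaDet]
  congr 2
  ext i r
  induction i using Fin.lastCases with
  | last => simp
  | cast i => simp [Matrix.updateRow_apply, Fin.ext_iff, i.2.ne]

variable {K : Type*} [Field K]

theorem natDegree_det_le {k : ℕ} (A : Matrix (Fin (k + 1)) (Fin (k + 1)) K[X]) (i₀ : Fin (k + 1))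
    (h : ∀ i ≠ i₀, ∀ r, ∃ a, A i r = C a) (h₀ : ∀ r, (A i₀ r).natDegree ≤ k) :
    A.det.natDegree ≤ k := by
  choose! a ha using h
  rw [Matrix.det_succ_row _ i₀]
  refine natDegree_sum_le_of_forall_le _ _ fun r _ => ?_
  have : (A.submatrix i₀.succAbove r.succAbove) =
      (Matrix.of fun i j => a (i₀.succAbove i) (r.succAbove j)).map C := by
    ext1 i j
    exact ha _ (Fin.succAbove_ne _ _) _
  rw [this, ← RingHom.mapMatrix_apply, ← RingHom.map_det, ← C_1, ← C_neg, ← C_pow]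
  refine (natDegree_mul_C_le _ _).trans ((natDegree_C_mul_le _ _).trans (h₀ r))

theorem natDegree_lowDet_le (n M : ℕ) (z w : K) (x : Fin n → K) :
    (lowDet n M (C z) (C w) (fun i => C (x i)) X).natDegree ≤ n + 1 := by
  refine natDegree_det_le _ (Fin.last n).castSucc (fun i hi r => ?_) fun r => ?_
  · induction i using Fin.lastCases with
    | last => exact ⟨(-z) ^ (n + 1 - (r : ℕ)) * w ^ (r : ℕ), by simp⟩
    | cast i =>
      induction i using Fin.lastCases with
      | last => exact absurd rfl hi
      | cast i => exact ⟨x i ^ (r : ℕ) - x i ^ (M - (r : ℕ)), by simp⟩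
  · have := r.2
    simp
    omega

theorem natDegree_thetaDet_le (n M : ℕ) (x : Fin n → K) :
    (thetaDet n M (-1) X (fun i => C (x i))).natDegree ≤ n := by
  refine natDegree_det_le _ (Fin.last n) (fun i hi r => ?_) fun r => ?_
  · induction i using Fin.lastCases with
    | last => exact absurd rfl hi
    | cast i => exact ⟨x i ^ (r : ℕ) - x i ^ (M - (r : ℕ)), by simp⟩
  · have := r.2
    simp
    omega

theorem map_lowDet {S : Type*} [CommRing S] (f : R →+* S) (n M : ℕ) (z w : R) (x : Fin n → R) (a : R) :
    f (lowDet n M z w x a) = lowDet n M (f z) (f w) (fun i => f (x i)) (f a) := by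
  rw [lowDet, lowDet, RingHom.map_det]
  congr 1
  ext i r
  induction i using Fin.lastCases with
  | last => simp
  | cast i => induction i using Fin.lastCases <;> simp

end LastVariable

section GeneratingPolynomial

open Polynomial

/-- The variables `q, q ^ 2, …, q ^ N`. -/
noncomputable def qVars (N : ℕ) : Fin N → RatFunc ℚ := fun i => q ^ ((i : ℕ) + 1)

/-- The generating polynomial of `boundedSPP (N + 1) c`, where the indeterminate marks the parts
equal to `N + 1` and the other parts `j` have weight `q ^ j`. -/
noncomputable def sppPoly (N c : ℕ) (v : RatFunc ℚ) : (RatFunc ℚ)[X] :=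
  ∑ P ∈ (boundedSPP_finite (N + 1) c).toFinset, (-1) ^ oddRows P * C v ^ (N + 1 - oddRows P) *
    sppWeight (Fin.snoc (fun i => C (qVars N i)) X : Fin (N + 1) → (RatFunc ℚ)[X]) P

theorem sppWeight_snoc (N : ℕ) (P : SPP) :
    sppWeight (Fin.snoc (fun i => C (qVars N i)) X : Fin (N + 1) → (RatFunc ℚ)[X]) P =
      C (∏ i : Fin N, qVars N i ^ eqCount P (i + 1)) * X ^ eqCount P (N + 1) := by
  rw [sppWeight, Fin.prod_univ_castSucc]
  simp

theorem natDegree_sppPoly_le (N c : ℕ) (v : RatFunc ℚ) : (sppPoly N c v).natDegree ≤ c := by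
  refine natDegree_sum_le_of_forall_le _ _ fun P hP => ?_
  rw [Set.Finite.mem_toFinset] at hP
  rw [sppWeight_snoc, ← mul_assoc, ← C_1, ← C_neg, ← C_pow, ← C_pow, ← C_mul, ← C_mul]
  exact (natDegree_C_mul_X_pow_le _ _).trans (eqCount_le (by omega) hP)

theorem prod_range_symm {M : Type*} [CommMonoid M] (g : ℤ → M) (N : ℕ) :
    ∏ j ∈ range (2 * N + 1), g ((j : ℤ) - N) =
      g 0 * ∏ i : Fin N, (g ((i : ℕ) + 1) * g (-((i : ℕ) + 1))) := by
  rw [Fin.prod_univ_eq_prod_range (fun i : ℕ => g ((i : ℤ) + 1) * g (-((i : ℤ) + 1)))]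
  induction N with
  | zero => simp
  | succ N ih =>
    rw [show 2 * (N + 1) + 1 = 2 * N + 1 + 1 + 1 by ring, prod_range_succ _ (2 * N + 1 + 1),
      prod_range_succ' _ (2 * N + 1), prod_range_succ _ N, ← mul_assoc (g 0), ← ih]
    have h : ∀ j : ℕ, ((j + 1 : ℕ) : ℤ) - (N + 1 : ℕ) = j - N := fun j => by push_cast; ring
    simp only [h]
    push_cast
    rw [show (2 * N + 1 : ℤ) - N = N + 1 by ring, show (0 : ℤ) - (N + 1) = -(N + 1) by ring]
    ac_rfl

/-- The common denominator of the generating polynomials. -/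
noncomputable def sppDenom (N : ℕ) : (RatFunc ℚ)[X] :=
  (1 + X) * ∏ j ∈ range (2 * N + 1), (1 - C (q ^ ((j : ℤ) - N)) * X)

/-- The constant relating `sppDenom` to the denominator at `q, …, q ^ N, X`. -/
noncomputable def sppConst (N : ℕ) : RatFunc ℚ := (-1) ^ N * q ^ ((N + 1) * N / 2) * qDenom N

theorem prod_qVars (N : ℕ) : ∏ i, qVars N i = q ^ ((N + 1) * N / 2) := by
  simp only [qVars]
  rw [Fin.prod_univ_eq_prod_range (fun i => q ^ (i + 1)), prod_pow_eq_pow_sum]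
  congr 1
  have h := sum_range_id_mul_two (N + 1)
  rw [sum_range_succ'] at h
  simp only [add_zero, Nat.add_sub_cancel] at h
  have := triangle_mul_two N
  omega

theorem prod_sub_mul_symProd_snoc (N : ℕ) :
    (∏ i : Fin (N + 1), ∏ j ∈ Ioi i,
      ((Fin.snoc (fun i => C (qVars N i)) X : Fin (N + 1) → (RatFunc ℚ)[X]) j -
        (Fin.snoc (fun i => C (qVars N i)) X : Fin (N + 1) → (RatFunc ℚ)[X]) i)) *
      symProd (N + 1) (Fin.snoc (fun i => C (qVars N i)) X : Fin (N + 1) → (RatFunc ℚ)[X]) =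
      C (sppConst N) * sppDenom N := by
  have hsym : ∀ (n : ℕ) (x : Fin n → RatFunc ℚ), symProd n (fun i => C (x i)) = C (symProd n x) := by
    intro n
    induction n with
    | zero => intro x; simp [symProd]
    | succ n ih => intro x; simp [symProd, ih, map_prod]
  have hpair : ∀ i : Fin N, (X - C (qVars N i)) * (1 - X * C (qVars N i)) =
      C (-1 * qVars N i) * ((1 - C (q ^ (((i : ℕ) : ℤ) + 1)) * X) *
        (1 - C (q ^ (-(((i : ℕ) : ℤ) + 1))) * X)) := by
    intro i
    have h : C (qVars N i) * C (qVars N i)⁻¹ = (1 : (RatFunc ℚ)[X]) := by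
      rw [← C_mul, mul_inv_cancel₀ (show qVars N i ≠ 0 from pow_ne_zero _ q_ne_zero), C_1]
    rw [zpow_neg, show q ^ (((i : ℕ) : ℤ) + 1) = qVars N i by rw [qVars, ← zpow_natCast]; simp]
    rw [C_mul, C_neg, C_1]
    linear_combination (-X + X ^ 2 * C (qVars N i)) * h
  rw [prod_sub_snoc, symProd_snoc, hsym, sppDenom, prod_range_symm (fun a => 1 - C (q ^ a) * X)]
  have h1 : (∏ i, (X - C (qVars N i))) * ∏ i, (1 - X * C (qVars N i)) =
      C ((-1) ^ N * q ^ ((N + 1) * N / 2)) * ∏ i : Fin N, ((1 - C (q ^ (((i : ℕ) : ℤ) + 1)) * X) *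
        (1 - C (q ^ (-(((i : ℕ) : ℤ) + 1))) * X)) := by
    rw [← prod_mul_distrib, prod_congr rfl fun i _ => hpair i, prod_mul_distrib, ← map_prod,
      prod_mul_distrib, prod_qVars]
    simp
  have h2 : C (sppConst N) = C ((-1) ^ N * q ^ ((N + 1) * N / 2)) *
      ((∏ i : Fin N, ∏ j ∈ Ioi i, (C (qVars N j) - C (qVars N i))) * C (symProd N (qVars N))) := by
    rw [sppConst, C_mul, qDenom, C_mul (a := ∏ i, _)]
    simp only [map_prod, C_sub]
    rfl
  rw [h2, zpow_zero, C_1]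
  linear_combination ((∏ i : Fin N, ∏ j ∈ Ioi i, (C (qVars N j) - C (qVars N i))) *
    C (symProd N (qVars N)) * (1 - X ^ 2)) * h1

theorem sppConst_ne_zero (N : ℕ) : sppConst N ≠ 0 := by
  have h : ∀ N, qDenom N ≠ 0 := by
    intro N
    induction N with
    | zero => simp [qDenom_zero]
    | succ N ih =>
      rw [qDenom_succ]
      have h1 := qfac_ne_zero (a := 1) (by norm_num) N
      have h2 := qfac_ne_zero (a := N + 2) (by omega) (N + 1)
      exact mul_ne_zero ih (mul_ne_zero (mul_ne_zero (mul_ne_zero (mul_ne_zero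
        (pow_ne_zero _ q_ne_zero) (by simp)) (pow_ne_zero _ one_sub_q_ne_zero)) h1) h2)
  exact mul_ne_zero (mul_ne_zero (by simp) (pow_ne_zero _ q_ne_zero)) (h N)

theorem sppPoly_mul_sppDenom_even (N m : ℕ) (v : RatFunc ℚ) : ∃ H,
    C (sppConst N) * (sppPoly N (2 * m) v * sppDenom N) =
      lowDet N (2 * m + 2 * N + 2) (-1) (C v) (fun i => C (qVars N i)) X - X ^ (2 * m + N + 1) * H := by
  obtain ⟨H, hH⟩ := exists_thetaDet_snoc (M := 2 * m + 2 * N + 2) (d := 2 * m + N + 1) (n := N)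
    (by omega) (-1) (C v) (fun i => C (qVars N i)) X
  refine ⟨H, ?_⟩
  rw [← hH, show 2 * m + 2 * N + 2 = 2 * m + 2 * (N + 1) by ring, ← altSum_mul_symProd,
    ← prod_sub_mul_symProd_mul_sum, ← sppPoly, mul_left_comm, ← prod_sub_mul_symProd_snoc]
  ring

theorem sppPoly_mul_sppDenom_odd (N m : ℕ) (v : RatFunc ℚ) : ∃ H,
    C (sppConst N) * (sppPoly N (2 * m + 1) v * sppDenom N) =
      (C v - X) * C (∏ i, (v - qVars N i)) *
        thetaDet N (2 * m + 2 * N + 2) (-1) X (fun i => C (qVars N i)) -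
      X ^ (2 * m + 1 + N + 1) * H := by
  obtain ⟨H, hH⟩ := exists_thetaDet₀_snoc (M := 2 * m + 2 * N + 2) (d := 2 * m + 1 + N + 1) (n := N)
    (by omega) (fun i => C (qVars N i)) X
  refine ⟨(C v - X) * C (∏ i, (v - qVars N i)) * H, ?_⟩
  rw [eq_add_of_sub_eq hH.symm, ← thetaDet_zero_one,
    show 2 * m + 2 * N + 2 = 2 * m + 2 * (N + 1) by ring, ← altSum_mul_symProd]
  have h := prod_sub_mul_symProd_mul_sum (N + 1) (2 * m + 1) (-1) (C v)
    (Fin.snoc (fun i => C (qVars N i)) X : Fin (N + 1) → (RatFunc ℚ)[X])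
  rw [← sppPoly, altSum_odd, Fin.prod_univ_castSucc (fun i => C v + -1 *
    (Fin.snoc (fun i => C (qVars N i)) X : Fin (N + 1) → (RatFunc ℚ)[X]) i)] at h
  simp only [Fin.snoc_castSucc, Fin.snoc_last] at h
  rw [mul_left_comm, ← prod_sub_mul_symProd_snoc, map_prod]
  simp only [C_sub]
  simp only [neg_one_mul, ← sub_eq_add_neg] at h
  linear_combination symProd (N + 1)
    (Fin.snoc (fun i => C (qVars N i)) X : Fin (N + 1) → (RatFunc ℚ)[X]) * h

end GeneratingPolynomial

section Evaluation

open Polynomial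

/-- The factor of `Unc` contributed by the denominators. -/
noncomputable def scaleU (N : ℕ) : RatFunc ℚ :=
  1 / ((∏ j ∈ range (2 * N + 1), (1 + q ^ ((j : ℤ) - N))) * sppConst N)

/-- The factor of `Wnc` contributed by the denominators. -/
noncomputable def scaleW (N c : ℕ) : RatFunc ℚ :=
  q ^ (N * c) * (1 - q) ^ (2 * N) /
    ((1 + q ^ (-N : ℤ)) * (∏ j ∈ range (2 * N), (1 - q ^ ((j : ℤ) - 2 * N))) * sppConst N)

theorem coeff_of_mul_sppDenom {N c : ℕ} {f P H : (RatFunc ℚ)[X]} (hf : f.natDegree ≤ c)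
    (hP : P.natDegree ≤ N + 1)
    (h : C (sppConst N) * (f * sppDenom N) = P - X ^ (c + N + 1) * H) {k : ℕ} (hk : k ≤ c) :
    f.coeff k * q ^ (N * k) = scaleW N c * P.eval (q ^ (-N : ℤ)) * Wnc (N + 1) c k +
      scaleU N * P.eval (-1) * Unc (N + 1) c k := by
  have h0 := sppConst_ne_zero N
  have hC : C (sppConst N)⁻¹ * C (sppConst N) = 1 := by rw [← C_mul, inv_mul_cancel₀ h0, C_1]
  rw [coeff_mul_q_pow_eq (P := C (sppConst N)⁻¹ * P) (H := -(C (sppConst N)⁻¹ * H)) hf ?_ ?_ hk]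
  · rw [scaleW, scaleU, eval_C_mul, eval_C_mul]
    simp only [div_eq_mul_inv, mul_inv, one_mul]
    ring
  · exact degree_le_of_natDegree_le ((natDegree_C_mul_le _ _).trans hP)
  · rw [← sppDenom]
    linear_combination (-(f * sppDenom N)) * hC + C (sppConst N)⁻¹ * h

theorem scaleU_mul (N : ℕ) :
    scaleU N * ((-1) ^ N * (∏ i, (1 + qVars N i)) * qDenom N) * (2 * ∏ i, (1 + qVars N i)) = 1 := by
  have h : (∏ j ∈ range (2 * N + 1), (1 + q ^ ((j : ℤ) - N))) * q ^ ((N + 1) * N / 2) =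
      2 * (∏ i, (1 + qVars N i)) ^ 2 := by
    rw [prod_range_symm (fun a => 1 + q ^ a), ← prod_qVars, mul_assoc, ← prod_mul_distrib,
      ← prod_pow, zpow_zero, one_add_one_eq_two]
    congr 1
    refine prod_congr rfl fun i _ => ?_
    have h1 : q ^ (((i : ℕ) : ℤ) + 1) = qVars N i := by rw [qVars, ← zpow_natCast]; simp
    have h2 : qVars N i ≠ 0 := pow_ne_zero _ q_ne_zero
    rw [zpow_neg, h1]
    field_simp
    ring
  have h1 := sppConst_ne_zero N
  have h2 : ∏ j ∈ range (2 * N + 1), (1 + q ^ ((j : ℤ) - N)) ≠ 0 :=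
    prod_ne_zero_iff.2 fun j _ => one_add_q_zpow_ne_zero _
  rw [scaleU, div_mul_eq_mul_div, div_mul_eq_mul_div, div_eq_one_iff_eq (mul_ne_zero h2 h1), sppConst]
  linear_combination (-((-1) ^ N * qDenom N)) * h

theorem prod_sq_add_one_sub (N : ℕ) :
    (∏ i : Fin N, (qVars N i ^ 2 + 1 - (q ^ (-(N + 1 : ℕ) : ℤ) + q ^ (N + 1)) * qVars N i)) *
      q ^ ((N + 1) * N / 2) =
    (-1) ^ N * (1 - q) ^ (2 * N) * qfac 1 N * qfac (N + 2) N := by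
  have hq := pow_ne_zero (N + 1) q_ne_zero
  have h : ∀ i ∈ range N, (q ^ (i + 1)) ^ 2 + 1 - (q ^ (-(N + 1 : ℕ) : ℤ) + q ^ (N + 1)) * q ^ (i + 1) =
      -(q ^ (N + 1))⁻¹ * q ^ (i + 1) * ((1 - q ^ (1 + (N - 1 - i))) * (1 - q ^ (N + 2 + i))) := by
    intro i hi
    have := mem_range.1 hi
    have e : q ^ (N + 1) = q ^ (i + 1) * q ^ (1 + (N - 1 - i)) := by
      rw [← pow_add]; congr 1; omega
    have e2 : q ^ (N + 2 + i) = q ^ (N + 1) * q ^ (i + 1) := by rw [← pow_add]; congr 1; omega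
    rw [zpow_neg, zpow_natCast, e2]
    field_simp
    rw [e]
    ring
  simp only [qVars]
  rw [Fin.prod_univ_eq_prod_range (fun i => (q ^ (i + 1)) ^ 2 + 1 -
    (q ^ (-(N + 1 : ℕ) : ℤ) + q ^ (N + 1)) * q ^ (i + 1)), prod_congr rfl h, prod_mul_distrib,
    prod_mul_distrib, prod_mul_distrib, prod_range_reflect (fun i => 1 - q ^ (1 + i)),
    prod_one_sub_q_pow, prod_one_sub_q_pow, prod_const, card_range, neg_pow, inv_pow,
    ← Fin.prod_univ_eq_prod_range (fun i => q ^ (i + 1))]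
  have h1 := prod_qVars N
  simp only [qVars] at h1
  rw [h1]
  have h2 : (q ^ (N + 1)) ^ N = q ^ ((N + 1) * N / 2) * q ^ ((N + 1) * N / 2) := by
    rw [← pow_add, ← pow_mul]
    congr 1
    have := triangle_mul_two N
    omega
  rw [h2]
  have h3 := pow_ne_zero ((N + 1) * N / 2) q_ne_zero
  push_cast
  field_simp
  ring

theorem prod_one_sub_zpow (N : ℕ) : (∏ j ∈ range (2 * N), (1 - q ^ ((j : ℤ) - 2 * N))) *
    q ^ (N * (2 * N + 1)) = (1 - q) ^ (2 * N) * qfac 1 (2 * N) := by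
  have h := prod_one_sub_q_pow 1 (2 * N)
  rw [Nat.cast_one] at h
  rw [← h, ← prod_range_reflect, ← Nat.mul_div_cancel_left (N * (2 * N + 1)) (show 0 < 2 by norm_num),
    show 2 * (N * (2 * N + 1)) = (2 * N + 1) * (2 * N) by ring, ← prod_qVars]
  simp only [qVars]
  rw [Fin.prod_univ_eq_prod_range (fun i => q ^ (i + 1)), ← prod_mul_distrib]
  have h2 : ∀ j ∈ range (2 * N), (1 - q ^ (((2 * N - 1 - j : ℕ) : ℤ) - 2 * N)) * q ^ (j + 1) =
      -(1 - q ^ (1 + j)) := by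
    intro j hj
    have := mem_range.1 hj
    have e : q ^ (((2 * N - 1 - j : ℕ) : ℤ) - 2 * N) * q ^ (j + 1) = 1 := by
      rw [← zpow_natCast, ← zpow_add₀ q_ne_zero, show ((2 * N - 1 - j : ℕ) : ℤ) - 2 * N + (j + 1 : ℕ) = 0 by
        omega, zpow_zero]
    rw [sub_mul, e]
    ring
  rw [prod_congr rfl h2, prod_neg, card_range, pow_mul, neg_one_sq, one_pow, one_mul]

theorem qDenom_ne_zero (N : ℕ) : qDenom N ≠ 0 :=
  right_ne_zero_of_mul (sppConst_ne_zero N)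

theorem one_sub_pow_eq (a : ℕ) : 1 - q ^ a = (1 - q) * qb a := by
  have := one_sub_q_ne_zero
  rw [qb, zpow_natCast]
  field_simp

theorem scaleW_mul (N c : ℕ) : scaleW (N + 1) c *
    (-((q ^ (N + 1) - q ^ (-(N + 1 : ℕ) : ℤ)) * (∏ i : Fin N,
      (qVars N i ^ 2 + 1 - (q ^ (-(N + 1 : ℕ) : ℤ) + q ^ (N + 1)) * qVars N i)) * qDenom N)) *
    (qfac 1 N * qb (2 * N + 2) * qfac (N + 2) (N + 1)) =
    (-1) ^ (N + 1) * q ^ ((N + 1) * c + (N + 2) * (N + 1) / 2 + (N + 1)) := by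
  have hP := prod_sq_add_one_sub N
  have hD := prod_one_sub_zpow (N + 1)
  have hY : q ^ (-(N + 1 : ℕ) : ℤ) = (q ^ (N + 1))⁻¹ := by rw [zpow_neg, zpow_natCast]
  have h2 : (q ^ (N + 1)) ^ N = q ^ ((N + 1) * N / 2) * q ^ ((N + 1) * N / 2) := by
    rw [← pow_add, ← pow_mul]
    congr 1
    have := triangle_mul_two N
    omega
  have ht : q ^ ((N + 2) * (N + 1) / 2) = q ^ ((N + 1) * N / 2) * q ^ (N + 1) := by
    rw [triangle_succ, pow_add, Nat.add_sub_cancel]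
  have h3 : q ^ ((N + 1) * (2 * (N + 1) + 1)) = (q ^ (N + 1)) ^ 3 * ((q ^ (N + 1)) ^ N) ^ 2 := by
    rw [pow_mul, ← pow_mul _ N, ← pow_add]
    congr 1
    ring
  have h4 : qfac 1 (2 * (N + 1)) = qfac 1 N * qb (N + 1) * qfac (N + 2) (N + 1) := by
    rw [two_mul, qfac_add, qfac_succ]
    push_cast
    rw [add_comm (1 : ℤ) N, show (1 : ℤ) + (N + 1) = N + 2 by ring]
  have h5 : qfac (N + 2) (N + 1) = qfac (N + 2) N * qb (2 * N + 2) := by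
    rw [qfac_succ, show (N : ℤ) + 2 + N = 2 * N + 2 by ring]
  have h6 : 1 - q ^ (N + 1) = (1 - q) * qb (N + 1) := by
    rw [one_sub_pow_eq]; push_cast; rfl
  have n1 := qfac_ne_zero (a := 1) (by norm_num) N
  have n2 := qfac_ne_zero (a := N + 2) (by omega) N
  have n3 := qb_ne_zero (a := 2 * N + 2) (by omega)
  have n4 := qb_ne_zero (a := N + 1) (by omega)
  have n5 := one_sub_q_ne_zero
  have n6 := qDenom_ne_zero N
  have n7 := pow_ne_zero (N + 1) q_ne_zero
  have n8 := pow_ne_zero ((N + 1) * N / 2) q_ne_zero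
  have n9 : 1 + q ^ (N + 1) ≠ 0 := by
    have := one_add_q_zpow_ne_zero (N + 1 : ℕ)
    rwa [zpow_natCast] at this
  rw [scaleW, sppConst, qDenom_succ, hY, pow_add q ((N + 1) * c + (N + 2) * (N + 1) / 2) (N + 1),
    pow_add q ((N + 1) * c), ht, h5]
  rw [h3, h4, h2, h5, ← eq_div_iff (by simp [n7, n8])] at hD
  rw [hD]
  rw [hY, ← eq_div_iff n8] at hP
  rw [hP]
  generalize q ^ ((N + 1) * N / 2) = T at *
  generalize q ^ (N + 1) = Y at *
  have hs : ((-1 : RatFunc ℚ) ^ N) ^ 2 = 1 := by rw [← pow_mul, pow_mul', neg_one_sq, one_pow]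
  have n10 : (-1 : RatFunc ℚ) ^ N ≠ 0 := by simp
  rw [pow_succ (-1 : RatFunc ℚ)]
  generalize (-1 : RatFunc ℚ) ^ N = σ at *
  field_simp
  rw [add_comm 1 Y] at n9
  rw [div_eq_iff n9]
  linear_combination q ^ ((N + 1) * c) * (1 - q) ^ (2 * N) *
    ((1 - q) * qb (N + 1) * (Y + 1) * hs - (Y + 1) * h6)

end Evaluation

section AlternatingGenerating

variable {K : Type*} [Field K]

/-- The sequence `0, a 0, a 1, …`. -/
def prevTerm (a : ℕ → K) (p : ℕ) : K := if p = 0 then 0 else a (p - 1)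

@[simp] theorem prevTerm_zero (a : ℕ → K) : prevTerm a 0 = 0 := if_pos rfl

@[simp] theorem prevTerm_succ (a : ℕ → K) (p : ℕ) : prevTerm a (p + 1) = a p := by
  simp [prevTerm]

/-- The homogeneous alternating generating polynomial of `a 0, …, a n`. -/
def altGen (n : ℕ) (v : K) (a : ℕ → K) : K :=
  ∑ p ∈ range (n + 1), (-1) ^ p * v ^ (n - p) * a p

theorem add_mul_altGen {n : ℕ} {a : ℕ → K} (ha : a (n + 1) = 0) (v t : K) :
    (v + t) * altGen n v a = altGen (n + 1) v fun p => a p - t * prevTerm a p := by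
  have h1 : v * altGen n v a = ∑ p ∈ range (n + 2), (-1) ^ p * v ^ (n + 1 - p) * a p := by
    rw [sum_range_succ, ha, mul_zero, add_zero, altGen, mul_sum]
    refine sum_congr rfl fun p hp => ?_
    rw [Nat.succ_sub (Nat.le_of_lt_succ (mem_range.1 hp)), pow_succ v]
    ring
  have h2 : t * altGen n v a =
      -∑ p ∈ range (n + 2), (-1) ^ p * v ^ (n + 1 - p) * (t * prevTerm a p) := by
    rw [sum_range_succ', prevTerm_zero, mul_zero, mul_zero, add_zero, altGen, mul_sum,
      ← sum_neg_distrib]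
    refine sum_congr rfl fun p _ => ?_
    rw [prevTerm_succ, Nat.add_sub_add_right, pow_succ]
    ring
  rw [add_mul, h1, h2, ← sub_eq_add_neg, ← sum_sub_distrib, altGen]
  exact sum_congr rfl fun p _ => by ring

theorem mul_altGen (n : ℕ) (s v : K) (a : ℕ → K) : s * altGen n v a = altGen n v fun p => s * a p := by
  rw [altGen, altGen, mul_sum]
  exact sum_congr rfl fun p _ => by ring

end AlternatingGenerating

theorem binq_eq_zero {N p : ℕ} (h : N < p) : binq N p = 0 := if_neg (by omega)

theorem qBinom_eq_zero {N p : ℕ} (h : N < p) : qBinom N p = 0 := by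
  rw [qBinom, binq_eq_zero h, mul_zero]

theorem q_pow_mul_binq (N p : ℕ) : q ^ (p * (p + 1) / 2) * binq N p = qBinom N p := by
  rw [qBinom, mul_comm p]

theorem q_pow_mul_binq_sub_one (N p : ℕ) :
    q ^ (p * (p - 1) / 2) * binq N ((p : ℤ) - 1) = prevTerm (qBinom N) p := by
  cases p with
  | zero => simp [binq]
  | succ p =>
    rw [prevTerm_succ, qBinom, Nat.add_sub_cancel]
    push_cast
    rw [add_sub_cancel_right]

/-- `[N-p] A_p(N) q^{p+1} = [p+1] A_{p+1}(N)`. -/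
theorem qBinom_succ_mul (N p : ℕ) :
    qBinom N (p + 1) * qb ((p : ℤ) + 1) = q ^ (p + 1) * (qBinom N p * qb ((N : ℤ) - p)) := by
  rcases lt_trichotomy p N with h | rfl | h
  · obtain ⟨r, rfl⟩ := Nat.exists_eq_add_of_lt h
    have h1 := binq_mul r (p + 1)
    have h2 := binq_mul (r + 1) p
    rw [show r + (p + 1) = p + r + 1 by ring] at h1
    rw [show r + 1 + p = p + r + 1 by ring, ← h1] at h2
    rw [qBinom, qBinom, triangle_succ, pow_add q, Nat.add_sub_cancel]
    rw [qfac_succ 1 p, qfac_succ 1 r] at h2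
    have n1 := qfac_ne_zero (a := 1) (by norm_num) p
    have n2 := qfac_ne_zero (a := 1) (by norm_num) r
    have h3 : binq ((p + r + 1 : ℕ) : ℤ) p * qb (1 + r) =
        binq ((p + r + 1 : ℕ) : ℤ) (p + 1 : ℕ) * qb (1 + p) :=
      mul_right_cancel₀ (mul_ne_zero n1 n2) (by linear_combination h2)
    rw [show ((p + r + 1 : ℕ) : ℤ) - p = 1 + r by push_cast; ring, add_comm (p : ℤ) 1]
    linear_combination (-q ^ ((p + 1) * p / 2) * q ^ (p + 1)) * h3
  · rw [qBinom_eq_zero p.lt_succ_self, sub_self, qb_zero]; ring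
  · rw [qBinom_eq_zero h, qBinom_eq_zero (h.trans p.lt_succ_self)]; ring

theorem qBinom_succ_succ_mul (N p : ℕ) :
    qBinom (N + 1) (p + 1) * qb ((p : ℤ) + 1) = q ^ (p + 1) * (qBinom N p * qb ((N : ℤ) + 1)) := by
  rcases le_or_gt p N with h | h
  · obtain ⟨r, rfl⟩ := Nat.exists_eq_add_of_le' h
    have h1 := binq_mul r (p + 1)
    have h2 := binq_mul r p
    rw [← add_assoc, qfac_succ 1 (r + p), ← h2, qfac_succ 1 p] at h1
    have n1 := qfac_ne_zero (a := 1) (by norm_num) p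
    have n2 := qfac_ne_zero (a := 1) (by norm_num) r
    have h3 : binq ((r + p + 1 : ℕ) : ℤ) (p + 1 : ℕ) * qb (1 + p) =
        binq ((r + p : ℕ) : ℤ) p * qb (1 + (r + p : ℕ)) :=
      mul_right_cancel₀ (mul_ne_zero n1 n2) (by linear_combination h1)
    rw [qBinom, qBinom, triangle_succ, pow_add q, Nat.add_sub_cancel, add_comm _ (1 : ℤ),
      add_comm _ (1 : ℤ)]
    linear_combination (q ^ ((p + 1) * p / 2) * q ^ (p + 1)) * h3
  · rw [qBinom_eq_zero h, qBinom_eq_zero (Nat.succ_lt_succ h)]; ring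

theorem qb_add (a b : ℤ) : qb (a + b) = qb a + q ^ a * qb b := by
  have := one_sub_q_ne_zero
  rw [qb, qb, qb, zpow_add₀ q_ne_zero]
  field_simp
  ring

theorem qBinom_succ_left (N p : ℕ) :
    qBinom (N + 1) p = qBinom N p + q ^ (N + 1) * prevTerm (qBinom N) p := by
  cases p with
  | zero => simp [qBinom_zero]
  | succ p =>
    rw [prevTerm_succ]
    refine mul_right_cancel₀ (qb_ne_zero (a := (p : ℤ) + 1) (by omega)) ?_
    rw [qBinom_succ_succ_mul, add_mul, qBinom_succ_mul, show (N : ℤ) + 1 = (N - p) + (p + 1) by ring,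
      qb_add]
    have h : q ^ (p + 1) * q ^ ((N : ℤ) - p) = q ^ (N + 1) := by
      rw [← zpow_natCast, ← zpow_natCast, ← zpow_add₀ q_ne_zero]
      congr 1
      push_cast
      ring
    linear_combination qBinom N p * qb (p + 1) * h

theorem prod_sub_qVars (N : ℕ) (v : RatFunc ℚ) :
    ∏ i, (v - qVars N i) = altGen N v (qBinom N) := by
  induction N with
  | zero => simp [altGen, qBinom_zero]
  | succ N ih =>
    have h : ∏ i : Fin N, (v - qVars (N + 1) i.castSucc) = ∏ i, (v - qVars N i) := by
      simp [qVars]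
    rw [Fin.prod_univ_castSucc, h, ih, mul_comm, qVars, Fin.val_last, sub_eq_add_neg,
      add_mul_altGen (qBinom_eq_zero N.lt_succ_self)]
    congr 1
    ext p
    rw [qBinom_succ_left]
    ring

section Values

theorem qVars_succ (N : ℕ) : qVars (N + 1) =
    (Fin.snoc (qVars N) (q ^ (N + 1)) : Fin (N + 1) → RatFunc ℚ) := by
  ext i
  induction i using Fin.lastCases with
  | last => simp [qVars]
  | cast i => simp [qVars]

theorem thetaDet_qVars (N e : ℕ) (he : 0 < e) (v : RatFunc ℚ) :
    thetaDet N (e + 2 * N) (-1) v (qVars N) * qTower 0 N = qDenom N * qfac e (N + 1) * qTower e N *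
      altGen N v (fun p => qBinom N p / qfac (e + p) (N + 1)) :=
  thetaDet_q N e he (-1) v

theorem thetaDet_qVars_zero_one (N e : ℕ) (he : 0 < e) :
    thetaDet N (e + 2 * N) 0 1 (qVars N) * qTower 0 N = qDenom N * qTower e N :=
  thetaDet_q_zero_one N e he

theorem scaleU_mul_lowDet (N c : ℕ) (v : RatFunc ℚ) :
    scaleU N * lowDet N (c + 2 * N + 2) (-1) v (qVars N) (-1) *
      ((2 * ∏ i, (1 + qVars N i)) * qTower 0 N) =
    qfac (c + 1) (N + 1) * qTower (c + 1) N * altGen (N + 1) v (fun p =>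
      qBinom N p / qfac (c + 1 + p) (N + 1) -
        prevTerm (fun p => qBinom N p / qfac (c + 1 + p) (N + 1)) p) := by
  have h := thetaDet_qVars N (c + 1) (by omega) v
  push_cast at h
  have h2 := add_mul_altGen (n := N) (a := fun p => qBinom N p / qfac (c + 1 + p) (N + 1))
    (by rw [qBinom_eq_zero N.lt_succ_self, zero_div]) v 1
  simp only [one_mul] at h2
  rw [lowDet_neg_one N _ (by omega), show c + 2 * N + 2 - 1 = c + 1 + 2 * N by omega, ← h2]
  linear_combination
    scaleU N * (-1) ^ N * (∏ i, (1 + qVars N i)) * (2 * ∏ i, (1 + qVars N i)) * (v + 1) * h +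
    (v + 1) * (qfac (c + 1) (N + 1) * qTower (c + 1) N *
      altGen N v (fun p => qBinom N p / qfac (c + 1 + p) (N + 1))) * scaleU_mul N

theorem scaleU_mul_thetaDet (N c : ℕ) (hc : 0 < c) (v : RatFunc ℚ) :
    scaleU N * ((v + 1) * (∏ i, (v - qVars N i)) *
        thetaDet N (c + 2 * N + 1) (-1) (-1) (qVars N)) *
      ((2 * ∏ i, (1 + qVars N i)) * qTower 0 N) =
    qTower c N * altGen (N + 1) v (fun p => qBinom N p - prevTerm (qBinom N) p) := by
  have h := thetaDet_qVars_zero_one N c hc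
  have h2 := add_mul_altGen (n := N) (a := qBinom N) (qBinom_eq_zero N.lt_succ_self) v 1
  simp only [one_mul] at h2
  rw [← lowDet_zero_one, lowDet_neg_one N _ (by omega), show c + 2 * N + 1 - 1 = c + 2 * N by omega,
    prod_sub_qVars, h2]
  linear_combination altGen (N + 1) v (fun p => qBinom N p - prevTerm (qBinom N) p) *
    (scaleU N * (-1) ^ N * (∏ i, (1 + qVars N i)) * (2 * ∏ i, (1 + qVars N i)) * h +
      qTower c N * scaleU_mul N)

theorem scaleW_mul_lowDet (N c : ℕ) (v : RatFunc ℚ) :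
    scaleW (N + 1) c * lowDet (N + 1) (c + 2 * (N + 1) + 2) (-1) v (qVars (N + 1))
        (q ^ (-(N + 1 : ℕ) : ℤ)) * (qfac 1 N * qb (2 * N + 2) * qTower 0 (N + 1)) =
    (-1) ^ (N + 1) * q ^ ((N + 1) * c + (N + 2) * (N + 1) / 2 + (N + 1)) * qTower c (N + 1) *
      altGen (N + 2) v (fun p => qBinom N p / qfac (c + 2 + p) (N + 1) +
        (q ^ (N + 1) + q ^ (-(N + 1 : ℕ) : ℤ)) *
          prevTerm (fun p => qBinom N p / qfac (c + 2 + p) (N + 1)) p +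
        prevTerm (prevTerm fun p => qBinom N p / qfac (c + 2 + p) (N + 1)) p) := by
  have hay : q ^ (-(N + 1 : ℕ) : ℤ) * q ^ (N + 1) = 1 := by
    rw [zpow_neg, zpow_natCast, inv_mul_cancel₀ (pow_ne_zero _ q_ne_zero)]
  have h := thetaDet_qVars N (c + 2) (by omega) v
  have hW := scaleW_mul N c
  push_cast at h
  rw [qVars_succ, lowDet_snoc N _ (by omega) _ _ _ hay, qTower_succ, qTower_succ',
    show c + 2 * (N + 1) + 2 - 2 = c + 2 + 2 * N by omega, zero_add]
  generalize q ^ (-(N + 1 : ℕ) : ℤ) = a at *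
  generalize q ^ (N + 1) = y at *
  have hb : qBinom N (N + 1) = 0 := qBinom_eq_zero N.lt_succ_self
  have hb2 : qBinom N (N + 2) = 0 := qBinom_eq_zero (by omega)
  set b : ℕ → RatFunc ℚ := fun p => qBinom N p / qfac (c + 2 + p) (N + 1) with hbdef
  have h2 := add_mul_altGen (n := N) (a := b) (by simp [hbdef, hb]) v (-a)
  have h3 := add_mul_altGen (n := N + 1) (a := fun p => b p - -a * prevTerm b p)
    (by simp [hbdef, hb, hb2]) v (-y)
  have h4 : (fun p => b p - -a * prevTerm b p - -y * prevTerm (fun p => b p - -a * prevTerm b p) p) =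
      fun p => b p + (y + a) * prevTerm b p + prevTerm (prevTerm b) p := by
    ext p
    cases p with
    | zero => simp
    | succ p =>
      simp only [prevTerm_succ]
      linear_combination prevTerm b p * hay
  rw [← h2, h4] at h3
  rw [← h3]
  linear_combination (-scaleW (N + 1) c * (y - a) * (v - a) * (v - y) *
      (∏ i, (qVars N i ^ 2 + 1 - (a + y) * qVars N i)) * qfac 1 N * qb (2 * N + 2) *
      qfac (N + 2) (N + 1)) * h +
    (v - a) * (v - y) * (qfac (c + 2) (N + 1) * qTower (c + 2) N * altGen N v b) * hW

theorem scaleW_mul_thetaDet (N c : ℕ) (v : RatFunc ℚ) :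
    scaleW (N + 1) c * ((v - q ^ (-(N + 1 : ℕ) : ℤ)) * (∏ i, (v - qVars (N + 1) i)) *
      thetaDet (N + 1) (c + 2 * (N + 1) + 1) (-1) (q ^ (-(N + 1 : ℕ) : ℤ)) (qVars (N + 1))) *
      (qfac 1 N * qb (2 * N + 2) * qTower 0 (N + 1)) =
    (-1) ^ (N + 1) * q ^ ((N + 1) * c + (N + 2) * (N + 1) / 2 + (N + 1)) * qTower (c + 1) N *
      altGen (N + 2) v (fun p => qBinom (N + 1) p +
        q ^ (-(N + 1 : ℕ) : ℤ) * prevTerm (qBinom (N + 1)) p) := by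
  have hay : q ^ (-(N + 1 : ℕ) : ℤ) * q ^ (N + 1) = 1 := by
    rw [zpow_neg, zpow_natCast, inv_mul_cancel₀ (pow_ne_zero _ q_ne_zero)]
  have h := thetaDet_qVars_zero_one N (c + 1) (by omega)
  have hW := scaleW_mul N c
  push_cast at h
  have h3 := add_mul_altGen (n := N + 1) (a := qBinom (N + 1)) (qBinom_eq_zero (N + 1).lt_succ_self) v
    (-q ^ (-(N + 1 : ℕ) : ℤ))
  simp only [neg_mul, sub_neg_eq_add] at h3
  rw [prod_sub_qVars, sub_eq_add_neg, h3, ← lowDet_zero_one, qVars_succ,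
    lowDet_snoc N _ (by omega) _ _ _ hay, qTower_succ,
    show c + 2 * (N + 1) + 1 - 2 = c + 1 + 2 * N by omega, zero_add]
  generalize q ^ (-(N + 1 : ℕ) : ℤ) = a at *
  generalize q ^ (N + 1) = y at *
  linear_combination altGen (N + 2) v (fun p => qBinom (N + 1) p + a * prevTerm (qBinom (N + 1)) p) *
    ((-scaleW (N + 1) c * (y - a) * (∏ i, (qVars N i ^ 2 + 1 - (a + y) * qVars N i)) * qfac 1 N *
      qb (2 * N + 2) * qfac (N + 2) (N + 1)) * h + qTower (c + 1) N * hW)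

end Values

section MatchingL

theorem qb_two_mul (a : ℕ) : qb (2 * (a : ℤ)) = (1 + q ^ a) * qb a := by
  rw [two_mul, qb_add, zpow_natCast]
  ring

theorem prod_qb_two_mul (N : ℕ) :
    ∏ i ∈ Icc 1 N, qb (2 * (i : ℤ)) = (∏ i, (1 + qVars N i)) * qfac 1 N := by
  induction N with
  | zero => simp
  | succ N ih =>
    have h : ∏ i : Fin N, (1 + qVars (N + 1) i.castSucc) = ∏ i, (1 + qVars N i) := by
      simp [qVars]
    rw [prod_Icc_succ_top (by omega), ih, Fin.prod_univ_castSucc, h, qb_two_mul, qVars, Fin.val_last,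
      qfac_succ]
    push_cast
    rw [add_comm (1 : ℤ) N]
    ring

theorem prod_div_mul_qTower (a : ℤ) (N : ℕ) :
    (∏ i ∈ Icc 1 N, qfac (a + 2 * i) (N + 1 - i) / (qfac (2 * i) (N + 1 - i) * qb (2 * i))) *
      ((∏ i, (1 + qVars N i)) * qTower 0 N * qfac 1 N) = qTower a N := by
  have h := prod_Icc_eq_qTower 0 N
  simp only [zero_add] at h
  have h0 := qTower_ne_zero le_rfl N
  have h1 : ∏ i ∈ Icc 1 N, qb (2 * (i : ℤ)) ≠ 0 :=
    prod_ne_zero_iff.2 fun i hi => qb_ne_zero (by have := mem_Icc.1 hi; omega)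
  rw [prod_div_distrib, prod_mul_distrib, h, prod_Icc_eq_qTower]
  rw [mul_right_comm, ← prod_qb_two_mul]
  field_simp

theorem prod_div_mul_qTower' (a : ℤ) (N : ℕ) :
    (∏ i ∈ Icc 1 N, qfac (a + 2 * i) (N + 1 - i) / qfac (2 * i) (N + 1 - i)) * qTower 0 N =
      qTower a N := by
  have h := prod_Icc_eq_qTower 0 N
  simp only [zero_add] at h
  have h0 := qTower_ne_zero le_rfl N
  rw [prod_div_distrib, h, prod_Icc_eq_qTower, div_mul_cancel₀ _ h0]

theorem qfac_mul_qb (a : ℤ) (n : ℕ) : qfac a n * qb (a + n) = qb a * qfac (a + 1) n := by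
  rw [← qfac_succ, qfac_succ']

theorem qb_mul_sub_even (N c p : ℕ) (h0 : ¬(c = 0 ∧ p = 0)) :
    qBinom N p * qb c / qfac (c + p) (N + 1) -
      prevTerm (qBinom N) p * qb (c + 2 * (N + 1)) / qfac (c + p + 1) (N + 1) =
    qb (c + (N + 1)) * (qBinom N p / qfac (c + 1 + p) (N + 1) -
      prevTerm (fun p => qBinom N p / qfac (c + 1 + p) (N + 1)) p) := by
  cases p with
  | zero =>
    have hc : 0 < (c : ℤ) := by omega
    have h := qfac_mul_qb c (N + 1)
    have n1 := qfac_ne_zero hc (N + 1)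
    have n2 := qfac_ne_zero (a := c + 1) (by omega) (N + 1)
    simp only [prevTerm_zero, qBinom_zero, Nat.cast_zero, add_zero, zero_mul, zero_div, sub_zero]
    push_cast at h
    field_simp
    linear_combination -h
  | succ p =>
    have h := qfac_mul_qb (c + p + 1) (N + 1)
    have hA := qBinom_succ_mul N p
    have n0 := one_sub_q_ne_zero
    have n1 := qfac_ne_zero (a := c + p + 1) (by omega) (N + 1)
    have n2 := qfac_ne_zero (a := c + p + 1 + 1) (by omega) (N + 1)
    have n3 := qb_ne_zero (a := c + p + 1) (by omega)
    have n4 := qb_ne_zero (a := c + p + 1 + (N + 1)) (by omega)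
    simp only [prevTerm_succ]
    push_cast at h ⊢
    rw [← eq_div_iff n4] at h
    rw [show (c : ℤ) + 1 + (p + 1) = c + p + 1 + 1 by ring, ← add_assoc (c : ℤ) p 1,
      add_right_comm (c : ℤ) 1 p, h]
    field_simp
    have h2 : qBinom N (p + 1) * (1 - q ^ p * q) = qBinom N p * (q ^ p * q - q ^ N * q) := by
      simp only [qb, zpow_add₀ q_ne_zero, zpow_sub₀ q_ne_zero, zpow_natCast, zpow_one] at hA
      have := pow_ne_zero p q_ne_zero
      field_simp at hA
      exact mul_left_cancel₀ this (by linear_combination hA)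
    have hN : q ^ (2 * ((N : ℤ) + 1)) = (q ^ N) ^ 2 * q ^ 2 := by
      rw [← pow_mul, ← pow_add, ← zpow_natCast]
      congr 1
      push_cast
      ring
    simp only [qb, zpow_add₀ q_ne_zero, hN, zpow_natCast, zpow_one]
    field_simp
    linear_combination (-q ^ c * (1 - q ^ N * q)) * h2

theorem Lncp_even {N c p : ℕ} (hc : Even c) (h0 : ¬(c = 0 ∧ p = 0)) :
    Lncp (N + 1) c p * ((2 * ∏ i, (1 + qVars N i)) * qTower 0 N) =
      qfac (c + 1) (N + 1) * qTower (c + 1) N * (qBinom N p / qfac (c + 1 + p) (N + 1) -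
        prevTerm (fun p => qBinom N p / qfac (c + 1 + p) (N + 1)) p) := by
  have h1 := prod_div_mul_qTower (c + 1) N
  rw [Lncp, if_pos hc]
  simp only [Nat.add_sub_cancel]
  rw [show ((N + 1 : ℕ) : ℤ) - 1 = N by push_cast; ring, q_pow_mul_binq, q_pow_mul_binq_sub_one]
  push_cast
  rw [qb_mul_sub_even N c p h0, qfac_succ (c + 1) N, ← h1, add_right_comm (c : ℤ) 1 N]
  simp only [add_right_comm (c : ℤ) 1 (2 * _), ← add_assoc]
  ring

theorem Lncp_odd {N c p : ℕ} (hc : ¬Even c) :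
    Lncp (N + 1) c p * ((2 * ∏ i, (1 + qVars N i)) * qTower 0 N) =
      qTower c N * (qBinom N p - prevTerm (qBinom N) p) := by
  have h1 := prod_div_mul_qTower c N
  rw [Lncp, if_neg hc]
  simp only [Nat.add_sub_cancel]
  rw [show ((N + 1 : ℕ) : ℤ) - 1 = N by push_cast; ring, q_pow_mul_binq, q_pow_mul_binq_sub_one, ← h1]
  ring

end MatchingL

section MatchingM

theorem one_sub_mul_qBinom (N p : ℕ) :
    qBinom N p * (1 - q ^ p) = prevTerm (qBinom N) p * (q ^ p - q ^ (N + 1)) := by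
  cases p with
  | zero => simp
  | succ p =>
    have hA := qBinom_succ_mul N p
    have n0 := one_sub_q_ne_zero
    have n1 := pow_ne_zero p q_ne_zero
    rw [prevTerm_succ, pow_succ q p, pow_succ q N]
    simp only [qb, zpow_add₀ q_ne_zero, zpow_sub₀ q_ne_zero, zpow_natCast, zpow_one] at hA
    field_simp at hA
    exact mul_left_cancel₀ n1 (by linear_combination hA)

theorem prevTerm_qBinom_mul (N p : ℕ) :
    prevTerm (qBinom N) p * (q - q ^ p) =
      prevTerm (prevTerm (qBinom N)) p * (q ^ p - q ^ (N + 1) * q) := by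
  cases p with
  | zero => simp
  | succ p =>
    rw [prevTerm_succ, prevTerm_succ, pow_succ q p]
    linear_combination q * one_sub_mul_qBinom N p

theorem qBinom_three_term (Q x y a₀ a₁ a₂ : RatFunc ℚ) (hQ : Q ≠ 0) (h₁ : a₀ * (1 - y) = a₁ * (y - Q))
    (h₂ : a₁ * (q - y) = a₂ * (y - Q * q)) :
    Q * (1 - x * q * Q) * (a₀ * (1 - x * y) * (1 - x * y * q) +
        (Q + Q⁻¹) * a₁ * (1 - x * y) * (1 - x * y * q * Q) +
        a₂ * (1 - x * y * Q) * (1 - x * y * q * Q)) =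
      (a₀ + Q * a₁) * (1 - x) * Q * (1 - x * q) * (1 - x * y * q * Q) +
        (a₁ + Q * a₂) * (1 - x * q * Q ^ 2) * (1 - x * q ^ 2 * Q ^ 2) * (1 - x * y) := by
  have hi : Q * Q⁻¹ = 1 := mul_inv_cancel₀ hQ
  linear_combination Q * x * (1 + q - Q * q - x * q - x * y * q * (1 - x * Q * q)) * h₁ -
    Q * x * ((1 - x * q * Q) * q * Q ^ 2 * x * y + 1 - Q - q * Q + x * q ^ 2 * Q ^ 3) * h₂ +
    (1 - x * q * Q) * a₁ * (1 - x * y) * (1 - x * y * q * Q) * hi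

theorem prevTerm_div (a : ℕ → RatFunc ℚ) (c : ℤ) (n p : ℕ) :
    prevTerm (fun p => a p / qfac (c + 1 + p) n) p = prevTerm a p / qfac (c + p) n := by
  cases p with
  | zero => simp
  | succ p =>
    rw [prevTerm_succ, prevTerm_succ]
    push_cast
    rw [add_assoc c, add_comm 1 (p : ℤ)]

theorem one_div_qb_sub (N c : ℕ) :
    1 / qb ((N : ℤ) + 1) - qb (c + 2 * N + 3) / (qb (c + N + 2) * qb (2 * N + 2)) =
      q ^ (N + 1) * qb (c + 1) / (qb (c + N + 2) * qb (2 * N + 2)) := by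
  have n0 := one_sub_q_ne_zero
  have n1 := qb_ne_zero (a := (N : ℤ) + 1) (by omega)
  have n2 := qb_ne_zero (a := (c : ℤ) + N + 2) (by omega)
  have n3 := qb_ne_zero (a := 2 * (N : ℤ) + 2) (by omega)
  have h := qb_two_mul (N + 1)
  rw [show 2 * ((N + 1 : ℕ) : ℤ) = 2 * N + 2 by push_cast; ring] at h
  rw [h]
  rw [h] at n3
  have n4 := left_ne_zero_of_mul n3
  push_cast at *
  have hN : q ^ (2 * (N : ℤ)) = (q ^ N) ^ 2 := by
    rw [← pow_mul, ← zpow_natCast]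
    congr 1
    push_cast
    ring
  have h3 : q ^ (3 : ℤ) = q ^ 3 := by norm_cast
  have h2 : q ^ (2 : ℤ) = q ^ 2 := by norm_cast
  field_simp
  simp only [qb, zpow_add₀ q_ne_zero, hN, zpow_natCast, zpow_one, h2, h3]
  field_simp
  ring

theorem mul_three_term_eq (N c p : ℕ) (h0 : ¬(c = 0 ∧ p = 0)) :
    q ^ (N + 1) / qb (2 * N + 2) * (qBinom N p / qfac (c + 2 + p) (N + 1) +
        (q ^ (N + 1) + q ^ (-(N + 1 : ℕ) : ℤ)) *
          prevTerm (fun p => qBinom N p / qfac (c + 2 + p) (N + 1)) p +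
        prevTerm (prevTerm fun p => qBinom N p / qfac (c + 2 + p) (N + 1)) p) =
    qBinom (N + 1) p * qb c / qfac (c + p) (N + 2) *
        (1 / qb ((N : ℤ) + 1) - qb (c + 2 * N + 3) / (qb (c + N + 2) * qb (2 * N + 2))) +
      prevTerm (qBinom (N + 1)) p / qfac (c + p + 1) (N + 2) *
        (qfac (c + 2 * N + 3) 2 / (qb (c + N + 2) * qb (2 * N + 2))) := by
  have hm : 0 < (c : ℤ) + p := by omega
  have e1 : (prevTerm fun p => qBinom N p / qfac ((c : ℤ) + 2 + p) (N + 1)) =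
      fun p => prevTerm (qBinom N) p / qfac ((c : ℤ) + 1 + p) (N + 1) := by
    ext p
    rw [show (c : ℤ) + 2 = c + 1 + 1 by ring, prevTerm_div]
  have e2 : prevTerm (qBinom (N + 1)) p =
      prevTerm (qBinom N) p + q ^ (N + 1) * prevTerm (prevTerm (qBinom N)) p := by
    cases p with
    | zero => simp
    | succ p => simp only [prevTerm_succ, qBinom_succ_left]
  have h1 := one_sub_mul_qBinom N p
  have h2 := prevTerm_qBinom_mul N p
  rw [e1, prevTerm_div, e2, qBinom_succ_left, one_div_qb_sub, zpow_neg, zpow_natCast]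
  have h := qBinom_three_term (q ^ (N + 1)) (q ^ c) (q ^ p) _ _ _ (pow_ne_zero _ q_ne_zero) h1 h2
  simp only
  have n0 := one_sub_q_ne_zero
  have n1 := qb_ne_zero (a := (c : ℤ) + p) (by omega)
  have n2 := qb_ne_zero (a := (c : ℤ) + p + 1) (by omega)
  have n3 := qb_ne_zero (a := (c : ℤ) + p + N + 2) (by omega)
  have n4 := qb_ne_zero (a := (c : ℤ) + p + N + 1) (by omega)
  have n5 := qb_ne_zero (a := 2 * (N : ℤ) + 2) (by omega)
  have n6 := qb_ne_zero (a := (c : ℤ) + N + 2) (by omega)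
  have n7 := qfac_ne_zero (a := (c : ℤ) + p + 2) (by omega) N
  have f1 : qfac ((c : ℤ) + 2 + p) (N + 1) = qfac (c + p + 2) N * qb (c + p + N + 2) := by
    rw [qfac_succ, add_right_comm (c : ℤ) 2 p, add_right_comm _ (2 : ℤ) (N : ℤ)]
  have f2 : qfac ((c : ℤ) + 1 + p) (N + 1) = qb (c + p + 1) * qfac (c + p + 2) N := by
    rw [qfac_succ', add_right_comm (c : ℤ) 1 p, add_assoc _ (1 : ℤ) 1, one_add_one_eq_two]
  have f3 : qfac ((c : ℤ) + p + 1) (N + 2) = qb (c + p + 1) * (qfac (c + p + 2) N * qb (c + p + N + 2)) := by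
    rw [qfac_succ', qfac_succ, add_assoc _ (1 : ℤ) 1, one_add_one_eq_two, add_right_comm _ (2 : ℤ) (N : ℤ)]
  have f4 : qfac ((c : ℤ) + p) (N + 2) = qb (c + p) * (qb (c + p + 1) * qfac (c + p + 2) N) := by
    rw [qfac_succ', qfac_succ', add_assoc _ (1 : ℤ) 1, one_add_one_eq_two]
  have f5 : qfac ((c : ℤ) + p) (N + 1) =
      qb (c + p) * (qb (c + p + 1) * qfac (c + p + 2) N) / qb (c + p + N + 1) := by
    rw [← f4, eq_div_iff n4, qfac_succ _ (N + 1)]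
    push_cast
    rw [add_assoc _ (N : ℤ) 1]
  have f6 : qfac ((c : ℤ) + 2 * N + 3) 2 = qb (c + 2 * N + 3) * qb (c + 2 * N + 4) := by
    rw [qfac_succ', qfac_succ', qfac_zero, mul_one]
    ring_nf
  rw [f1, f2, f3, f4, f5, f6]
  field_simp
  have g1 : (q : RatFunc ℚ) ^ (2 : ℤ) = q ^ 2 := by norm_cast
  have g2 : (q : RatFunc ℚ) ^ (3 : ℤ) = q ^ 3 := by norm_cast
  have g3 : (q : RatFunc ℚ) ^ (4 : ℤ) = q ^ 4 := by norm_cast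
  have hN : q ^ (2 * (N : ℤ)) = (q ^ N) ^ 2 := by
    rw [← pow_mul, ← zpow_natCast]
    congr 1
    push_cast
    ring
  have nq := pow_ne_zero (N + 1) q_ne_zero
  field_simp at h
  simp only [qb, zpow_add₀ q_ne_zero, hN, zpow_natCast, zpow_one, g1, g2, g3]
  field_simp
  linear_combination h

theorem Mncp_even {N c p : ℕ} (hc : Even c) (h0 : ¬(c = 0 ∧ p = 0)) :
    Mncp (N + 2) c p * (qfac 1 N * qb (2 * N + 2) * qTower 0 (N + 1)) =
      (-1) ^ (N + 1) * q ^ ((N + 1) * c + (N + 2) * (N + 1) / 2 + (N + 1)) * qTower c (N + 1) *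
        (qBinom N p / qfac (c + 2 + p) (N + 1) +
          (q ^ (N + 1) + q ^ (-(N + 1 : ℕ) : ℤ)) *
            prevTerm (fun p => qBinom N p / qfac (c + 2 + p) (N + 1)) p +
          prevTerm (prevTerm fun p => qBinom N p / qfac (c + 2 + p) (N + 1)) p) := by
  have h1 := prod_div_mul_qTower' c (N + 1)
  have h := mul_three_term_eq N c p h0
  have hU := Unc_exponent (N + 1) c
  have n1 := qfac_ne_zero (a := 1) (by norm_num) N
  have n5 := qb_ne_zero (a := 2 * (N : ℤ) + 2) (by omega)
  rw [div_mul_eq_mul_div, div_eq_iff n5] at h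
  rw [Mncp, if_pos hc, hU, pow_add q ((N + 1) * c + (N + 2) * (N + 1) / 2)]
  simp only [show N + 2 - 1 = N + 1 by omega, show N + 2 - 2 = N by omega,
    show ∀ i, N + 2 - i = N + 1 + 1 - i from fun i => rfl]
  rw [show ((N + 2 : ℕ) : ℤ) - 1 = ((N + 1 : ℕ) : ℤ) by push_cast; ring, q_pow_mul_binq,
    q_pow_mul_binq_sub_one, show (c : ℤ) + 2 * (N + 2 : ℕ) - 1 = c + 2 * N + 3 by push_cast; ring,
    show (c : ℤ) + (N + 2 : ℕ) = c + N + 2 by push_cast; ring,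
    show (2 : ℤ) * (N + 2 : ℕ) - 2 = 2 * N + 2 by push_cast; ring, ← h1,
    show ((N + 1 : ℕ) : ℤ) * c + ((N + 1 + 1) * (N + 1) / 2 : ℕ) =
      ((N + 1) * c + (N + 2) * (N + 1) / 2 : ℕ) by push_cast; rfl, zpow_natCast,
    show ((N + 1 : ℕ) : ℤ) = (N : ℤ) + 1 by push_cast; rfl]
  rw [show ((N + 1 : ℕ) : ℤ) = (N : ℤ) + 1 by push_cast; rfl] at h
  rw [div_mul_eq_mul_div, div_mul_eq_mul_div, div_eq_iff n1]
  linear_combination (-((-1) ^ (N + 1) * q ^ ((N + 1) * c + (N + 2) * (N + 1) / 2) * qfac 1 N *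
    (∏ i ∈ Icc 1 (N + 1), qfac (c + 2 * i) (N + 1 + 1 - i) / qfac (2 * i) (N + 1 + 1 - i)) *
    qTower 0 (N + 1))) * h

theorem Mncp_odd {N c p : ℕ} (hc : ¬Even c) :
    Mncp (N + 2) c p * (qfac 1 N * qb (2 * N + 2) * qTower 0 (N + 1)) =
      (-1) ^ (N + 1) * q ^ ((N + 1) * c + (N + 2) * (N + 1) / 2 + (N + 1)) * qTower (c + 1) N *
        (qBinom (N + 1) p + q ^ (-(N + 1 : ℕ) : ℤ) * prevTerm (qBinom (N + 1)) p) := by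
  have h1 : (∏ i ∈ Icc 1 (N + 1), qfac (c + 2 * i + 1) (N + 2 - i - 1) / qfac (2 * i) (N + 2 - i)) *
      qTower 0 (N + 1) = qTower (c + 1) N := by
    have h := prod_Icc_eq_qTower 0 (N + 1)
    simp only [zero_add] at h
    have h0 := qTower_ne_zero le_rfl (N + 1)
    rw [prod_div_distrib, h, div_mul_cancel₀ _ h0, prod_Icc_succ_top (by omega),
      show N + 2 - (N + 1) - 1 = 0 by omega, qfac_zero, mul_one, ← prod_Icc_eq_qTower]
    refine prod_congr rfl fun i _ => ?_
    rw [show N + 2 - i - 1 = N + 1 - i by omega, add_right_comm]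
  have hU := Unc_exponent (N + 1) c
  have n1 := qfac_ne_zero (a := 1) (by norm_num) N
  have n5 := qb_ne_zero (a := 2 * (N : ℤ) + 2) (by omega)
  have n7 := pow_ne_zero (N + 1) q_ne_zero
  rw [Mncp, if_neg hc, hU, pow_add q ((N + 1) * c + (N + 2) * (N + 1) / 2)]
  simp only [show N + 2 - 1 = N + 1 by omega, show N + 2 - 2 = N by omega,
    show p * (p + 1) / 2 + (N + 2) - 1 = p * (p + 1) / 2 + (N + 1) by omega]
  rw [show ((N + 2 : ℕ) : ℤ) - 1 = ((N + 1 : ℕ) : ℤ) by push_cast; ring, pow_add q (p * (p + 1) / 2),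
    mul_right_comm (q ^ (p * (p + 1) / 2)), q_pow_mul_binq,
    q_pow_mul_binq_sub_one, show (2 : ℤ) * (N + 2 : ℕ) - 2 = 2 * N + 2 by push_cast; ring, ← h1,
    show ((N + 1 : ℕ) : ℤ) * c + ((N + 1 + 1) * (N + 1) / 2 : ℕ) =
      ((N + 1) * c + (N + 2) * (N + 1) / 2 : ℕ) by push_cast; rfl, zpow_natCast, zpow_neg, zpow_natCast]
  field_simp

end MatchingM

section Coefficients

open Polynomial

theorem eval_lowDet (N M : ℕ) (z w α : RatFunc ℚ) :
    (lowDet N M (C z) (C w) (fun i => C (qVars N i)) X).eval α = lowDet N M z w (qVars N) α := by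
  rw [← coe_evalRingHom, map_lowDet]
  simp

theorem eval_thetaDet (N M : ℕ) (α : RatFunc ℚ) :
    (thetaDet N M (-1) X (fun i => C (qVars N i))).eval α = thetaDet N M (-1) α (qVars N) := by
  rw [← lowDet_zero_one, ← lowDet_zero_one, ← eval_lowDet, C_0, C_1]

theorem coeff_sppPoly_even (N m : ℕ) (v : RatFunc ℚ) {k : ℕ} (hk : k ≤ 2 * m) :
    (sppPoly N (2 * m) v).coeff k * q ^ (N * k) =
      scaleW N (2 * m) * lowDet N (2 * m + 2 * N + 2) (-1) v (qVars N) (q ^ (-N : ℤ)) *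
          Wnc (N + 1) (2 * m) k +
        scaleU N * lowDet N (2 * m + 2 * N + 2) (-1) v (qVars N) (-1) * Unc (N + 1) (2 * m) k := by
  obtain ⟨H, hH⟩ := sppPoly_mul_sppDenom_even N m v
  rw [← C_1, ← C_neg] at hH
  rw [coeff_of_mul_sppDenom (natDegree_sppPoly_le _ _ _) (natDegree_lowDet_le _ _ _ _ _) hH hk,
    eval_lowDet, eval_lowDet]

theorem coeff_sppPoly_odd (N m : ℕ) (v : RatFunc ℚ) {k : ℕ} (hk : k ≤ 2 * m + 1) :
    (sppPoly N (2 * m + 1) v).coeff k * q ^ (N * k) =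
      scaleW N (2 * m + 1) * ((v - q ^ (-N : ℤ)) * (∏ i, (v - qVars N i)) *
          thetaDet N (2 * m + 1 + 2 * N + 1) (-1) (q ^ (-N : ℤ)) (qVars N)) *
          Wnc (N + 1) (2 * m + 1) k +
        scaleU N * ((v + 1) * (∏ i, (v - qVars N i)) *
          thetaDet N (2 * m + 1 + 2 * N + 1) (-1) (-1) (qVars N)) * Unc (N + 1) (2 * m + 1) k := by
  obtain ⟨H, hH⟩ := sppPoly_mul_sppDenom_odd N m v
  have hdeg : ((C v - X) * C (∏ i, (v - qVars N i)) *
      thetaDet N (2 * m + 2 * N + 2) (-1) X (fun i => C (qVars N i))).natDegree ≤ N + 1 := by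
    refine natDegree_mul_le.trans ?_
    have h1 := natDegree_thetaDet_le N (2 * m + 2 * N + 2) (qVars N)
    have h2 : ((C v - X) * C (∏ i, (v - qVars N i))).natDegree ≤ 1 :=
      (natDegree_mul_C_le _ _).trans (natDegree_sub_le_of_le
        ((natDegree_C v).le.trans zero_le_one) natDegree_X_le)
    omega
  rw [coeff_of_mul_sppDenom (natDegree_sppPoly_le _ _ _) hdeg hH hk,
    show 2 * m + 2 * N + 2 = 2 * m + 1 + 2 * N + 1 by ring]
  simp only [eval_mul, eval_sub, eval_C, eval_X, eval_thetaDet, sub_neg_eq_add]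

theorem eq_altGen_of_mul_eq {n : ℕ} {x d s v : RatFunc ℚ} {a : ℕ → RatFunc ℚ} (hd : d ≠ 0)
    (h : x * d = s * altGen n v a) : x = altGen n v fun p => s * a p / d := by
  rw [eq_div_of_mul_eq hd h, div_eq_inv_mul, ← mul_assoc, mul_altGen]
  congr 1
  ext p
  ring

theorem exists_coeff_sppPoly (N c : ℕ) : ∃ m l : ℕ → RatFunc ℚ,
    (∀ p, ¬(c = 0 ∧ p = 0) → m p = Mncp (N + 2) c p ∧ l p = Lncp (N + 2) c p) ∧
    ∀ v k, k ≤ c → (sppPoly (N + 1) c v).coeff k * q ^ ((N + 1) * k) =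
      altGen (N + 2) v m * Wnc (N + 2) c k + altGen (N + 2) v l * Unc (N + 2) c k := by
  have n1 : qfac 1 N * qb (2 * N + 2) * qTower 0 (N + 1) ≠ 0 :=
    mul_ne_zero (mul_ne_zero (qfac_ne_zero (by norm_num) N) (qb_ne_zero (by omega)))
      (qTower_ne_zero le_rfl _)
  have n2 : (2 * ∏ i, (1 + qVars (N + 1) i)) * qTower 0 (N + 1) ≠ 0 := by
    refine mul_ne_zero (mul_ne_zero two_ne_zero (prod_ne_zero_iff.2 fun i _ => ?_))
      (qTower_ne_zero le_rfl _)
    rw [qVars, ← zpow_natCast]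
    exact one_add_q_zpow_ne_zero _
  obtain ⟨r, rfl | rfl⟩ := c.even_or_odd'
  · have hc : Even (2 * r) := even_two_mul r
    refine ⟨_, _, fun p h0 => ⟨(eq_div_of_mul_eq n1 (Mncp_even hc h0)).symm,
      (eq_div_of_mul_eq n2 (Lncp_even hc h0)).symm⟩, fun v k hk => ?_⟩
    rw [coeff_sppPoly_even _ _ _ hk, eq_altGen_of_mul_eq n1 (scaleW_mul_lowDet N (2 * r) v),
      eq_altGen_of_mul_eq n2 (scaleU_mul_lowDet (N + 1) (2 * r) v)]
  · have hc : ¬Even (2 * r + 1) := Nat.not_even_two_mul_add_one r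
    refine ⟨_, _, fun p _ => ⟨(eq_div_of_mul_eq n1 (Mncp_odd hc)).symm,
      (eq_div_of_mul_eq n2 (Lncp_odd hc)).symm⟩, fun v k hk => ?_⟩
    rw [coeff_sppPoly_odd _ _ _ hk, eq_altGen_of_mul_eq n1 (scaleW_mul_thetaDet N (2 * r + 1) v),
      eq_altGen_of_mul_eq n2 (scaleU_mul_thetaDet (N + 1) (2 * r + 1) (by omega) v)]

end Coefficients

section Refinement

open Polynomial

/-- The contribution to `q ^ sppNorm P` of the parts at most `N` of `P`. -/
noncomputable def lowWeight (N : ℕ) (P : SPP) : RatFunc ℚ :=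
  ∏ i : Fin N, qVars N i ^ eqCount P (i + 1)

theorem q_pow_sppNorm {N : ℕ} {P : SPP} (hP : ∀ i j, P.part i j ≤ N + 1) :
    q ^ sppNorm P = lowWeight N P * q ^ ((N + 1) * eqCount P (N + 1)) := by
  rw [sppNorm_eq hP, Fin.sum_univ_castSucc, pow_add q, ← prod_pow_eq_pow_sum, lowWeight]
  simp [qVars, pow_mul]

theorem coeff_sppPoly (N c k : ℕ) (v : RatFunc ℚ) : (sppPoly N c v).coeff k =
    altGen (N + 1) v fun p => ∑ P ∈ (boundedSPP_finite (N + 1) c).toFinset with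
      oddRows P = p ∧ eqCount P (N + 1) = k, lowWeight N P := by
  have h : ∀ P ∈ (boundedSPP_finite (N + 1) c).toFinset, oddRows P ∈ range (N + 1 + 1) := fun P hP =>
    mem_range.2 (Nat.lt_succ_of_le (oddRows_le ((Set.Finite.mem_toFinset _).1 hP)))
  rw [sppPoly, finsetSum_coeff, ← sum_fiberwise_of_maps_to h, altGen]
  refine sum_congr rfl fun p _ => ?_
  rw [← filter_filter, sum_filter (fun P => eqCount P (N + 1) = k), mul_sum]
  refine sum_congr rfl fun P hP => ?_
  rw [(mem_filter.1 hP).2, sppWeight_snoc, ← mul_assoc, ← C_1, ← C_neg, ← C_pow, ← C_pow, ← C_mul,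
    ← C_mul, coeff_C_mul_X_pow, lowWeight, mul_ite, mul_zero]
  simp only [eq_comm]

theorem altGen_injective {K : Type*} [Field K] [Infinite K] {n : ℕ} {a b : ℕ → K}
    (h : ∀ v, altGen n v a = altGen n v b) {p : ℕ} (hp : p ≤ n) : a p = b p := by
  have hP : ∀ f : ℕ → K, ∀ v, (∑ p ∈ range (n + 1), C ((-1) ^ p * f p) * X ^ (n - p)).eval v =
      altGen n v f := fun f v => by
    rw [altGen, eval_finsetSum]
    refine sum_congr rfl fun p _ => ?_
    simp only [eval_mul, eval_C, eval_pow, eval_X]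
    ring
  have hc : ∀ f : ℕ → K, (∑ p ∈ range (n + 1), C ((-1) ^ p * f p) * X ^ (n - p)).coeff (n - p) =
      (-1) ^ p * f p := fun f => by
    rw [finsetSum_coeff, sum_eq_single p]
    · rw [coeff_C_mul_X_pow, if_pos rfl]
    · intro r hr hrp
      have := mem_range.1 hr
      rw [coeff_C_mul_X_pow, if_neg (by omega)]
    · intro h
      exact absurd (mem_range.2 (by omega)) h
  have h1 := hc a
  rw [Polynomial.funext fun v => (hP a v).trans ((h v).trans (hP b v).symm), hc b] at h1
  exact (mul_left_cancel₀ (by simp) h1).symm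

end Refinement

/-- **Main Theorem (Theorem 1).** The generating function of strict plane partitions with
parts in `{1,…,n}`, at most `c` columns, `p` rows of odd length and `k` parts equal to `n`. -/
theorem statement0 (n c p k : ℕ) (hn : 2 ≤ n) (hp : p ≤ n) (hk : k ≤ c)
    (h0 : ¬(c = 0 ∧ p = 0)) :
    ∃ hfin : {P : SPP | (∀ i j, P.part i j ≤ n) ∧ (∀ i j, c ≤ j → P.part i j = 0) ∧
        oddRows P = p ∧ eqCount P n = k}.Finite,
      ∑ P ∈ hfin.toFinset, q ^ sppNorm P =
        q ^ k * (Mncp n c p * Wnc n c k + Lncp n c p * Unc n c k) := by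
  obtain ⟨N, rfl⟩ := Nat.exists_eq_add_of_le' hn
  have hfin : {P : SPP | (∀ i j, P.part i j ≤ N + 2) ∧ (∀ i j, c ≤ j → P.part i j = 0) ∧
      oddRows P = p ∧ eqCount P (N + 2) = k}.Finite :=
    (boundedSPP_finite (N + 2) c).subset fun P hP => ⟨hP.1, hP.2.1⟩
  refine ⟨hfin, ?_⟩
  obtain ⟨m, l, hml, hcoeff⟩ := exists_coeff_sppPoly N c
  have hs : hfin.toFinset = {P ∈ (boundedSPP_finite (N + 1 + 1) c).toFinset |
      oddRows P = p ∧ eqCount P (N + 1 + 1) = k} := by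
    ext P
    simp [boundedSPP, and_assoc]
  have h := altGen_injective (n := N + 2) (p := p)
    (a := fun p => q ^ ((N + 1) * k) * ∑ P ∈ (boundedSPP_finite (N + 1 + 1) c).toFinset with
      oddRows P = p ∧ eqCount P (N + 1 + 1) = k, lowWeight (N + 1) P)
    (b := fun p => m p * Wnc (N + 2) c k + l p * Unc (N + 2) c k) (fun v => ?_) hp
  · rw [(hml p h0).1, (hml p h0).2, ← hs] at h
    rw [← h, ← mul_assoc, ← pow_add, mul_sum]
    refine sum_congr rfl fun P hP => ?_
    have hP' := (Set.Finite.mem_toFinset _).1 hP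
    rw [q_pow_sppNorm (N := N + 1) hP'.1, hP'.2.2.2, mul_comm]
    congr 2
    ring
  · have h1 := hcoeff v k hk
    rw [coeff_sppPoly, mul_comm, mul_altGen] at h1
    rw [h1, mul_comm _ (Wnc _ _ _), mul_comm _ (Unc _ _ _), mul_altGen, mul_altGen, altGen, altGen,
      altGen, ← sum_add_distrib]
    exact sum_congr rfl fun p _ => by ring
end

section
/- Let r, n, c be integers with 1 ≤ r ≤ n−1 and c ≥ 0, and let (k_1,…,k_{n−r}) ∈ ℤ^{n−r}. If k_1 ∈ {−1,−2,…,−r} or k_{n−r} ∈ {c+1,c+2,…,c+r}, then there exists no (r,n,c)-pattern (a_{i,j}) whose top row satisfies a_{r+1,r+i} = k_i for i = 1,…,n−r. -/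
open Finset

/-- A generalized `(r,n,c)` Gelfand-Tsetlin pattern, encoded as `a : ℕ → ℕ → ℤ` with rows
`i = 1,…,r+1` and entries `a i j` for `i-1 ≤ j ≤ n+1`. -/
def IsPattern (r n c : ℕ) (a : ℕ → ℕ → ℤ) : Prop :=
  (∀ i, 1 ≤ i → i ≤ r + 1 → a i (i - 1) = 0 ∧ a i (n + 1) = c) ∧
  (∀ i j, 2 ≤ i → i ≤ r + 1 → i ≤ j + 1 → j ≤ n →
    ((a i j ≤ a i (j + 1) → a i j ≤ a (i - 1) j ∧ a (i - 1) j ≤ a i (j + 1)) ∧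
     (a i (j + 1) < a i j → a i (j + 1) < a (i - 1) j ∧ a (i - 1) j < a i j)))

/-- The first free entry of row `m + 1` of a pattern never lies in `{-m, …, -1}`. -/
theorem IsPattern.first_entry {r n c : ℕ} {a : ℕ → ℕ → ℤ} (ha : IsPattern r n c a)
    (hrn : r ≤ n) (m : ℕ) (hm : m ≤ r) (h₁ : -(m : ℤ) ≤ a (m + 1) (m + 1))
    (h₂ : a (m + 1) (m + 1) ≤ -1) : False := by
  induction m with
  | zero => rw [Nat.cast_zero] at h₁; omega
  | succ m ih =>
    have hb := (ha.1 (m + 1 + 1) (by omega) (by omega)).1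
    have hs := (ha.2 (m + 1 + 1) (m + 1) (by omega) (by omega) (by omega) (by omega)).2
    simp only [Nat.add_sub_cancel] at hb hs
    have hlt := hs (by omega)
    push_cast at h₁
    exact ih (by omega) (by omega) (by omega)

/-- The last free entry of row `m + 1` of a pattern never lies in `{c + 1, …, c + m}`. -/
theorem IsPattern.last_entry {r n c : ℕ} {a : ℕ → ℕ → ℤ} (ha : IsPattern r n c a)
    (hrn : r ≤ n) (m : ℕ) (hm : m ≤ r) (h₁ : (c : ℤ) + 1 ≤ a (m + 1) n)
    (h₂ : a (m + 1) n ≤ c + m) : False := by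
  induction m with
  | zero => rw [Nat.cast_zero] at h₂; omega
  | succ m ih =>
    have hb := (ha.1 (m + 1 + 1) (by omega) (by omega)).2
    have hs := (ha.2 (m + 1 + 1) n (by omega) (by omega) (by omega) le_rfl).2
    simp only [Nat.add_sub_cancel] at hs
    have hlt := hs (by omega)
    push_cast at h₂
    exact ih (by omega) (by omega) (by omega)

/-- **Lemma 10 (zeros).** There is no `(r,n,c)`-pattern whose top row
`(k_1,…,k_{n-r})` has `k_1 ∈ {-1,…,-r}` or `k_{n-r} ∈ {c+1,…,c+r}`. -/
theorem statement8 (r n c : ℕ) (hr : 1 ≤ r) (hrn : r ≤ n - 1) (k : ℕ → ℤ)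
    (hk : (-(r : ℤ) ≤ k 1 ∧ k 1 ≤ -1) ∨ ((c : ℤ) + 1 ≤ k (n - r) ∧ k (n - r) ≤ c + r)) :
    ¬∃ a : ℕ → ℕ → ℤ, IsPattern r n c a ∧
      ∀ i, 1 ≤ i → i ≤ n - r → a (r + 1) (r + i) = k i := by
  rintro ⟨a, ha, htop⟩
  rcases hk with ⟨h₁, h₂⟩ | ⟨h₁, h₂⟩
  · rw [← htop 1 le_rfl (by omega)] at h₁ h₂
    exact ha.first_entry (by omega) r le_rfl h₁ h₂
  · rw [← htop (n - r) (by omega) le_rfl, show r + (n - r) = n by omega] at h₁ h₂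
    exact ha.last_entry (by omega) r le_rfl h₁ h₂
end
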